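/- Suppose f is a homeomorphism of the torus 𝕋² = ℝ²/ℤ² homotopic to the identity, with a lift F : ℝ² → ℝ² whose rotation set is ρ(F) = {α} × [ρ⁻, ρ⁺] with ρ⁻ < ρ⁺ and α irrational. Then f has unbounded horizontal deviation: sup over x ∈ ℝ² and n ∈ ℕ of |pr₁(Fⁿ(x) − x) − nα| = +∞. -/

import Mathlib

open Filter Metric Set

noncomputable section

abbrev R2 := ℝ × ℝ

/-- The rotation set of a lift F : ℝ² → ℝ² :
ρ(F) = { lim_i (F^{n_i}(x_i) − x_i)/n_i : x_i ∈ ℝ², n_i ↗ +∞ }. -/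
def rotSet (F : R2 → R2) : Set R2 :=
  {w | ∃ (x : ℕ → R2) (n : ℕ → ℕ), StrictMono n ∧
    Tendsto (fun i => ((n i : ℝ))⁻¹ • (F^[n i] (x i) - x i)) atTop (nhds w)}

open Bornology Topology
/-- A continuous function on a preconnected set whose exponential is one is constant. -/
theorem eq_of_exp_eq_one {X : Type*} [TopologicalSpace X] {s : Set X} (hs : IsPreconnected s)
    {h : X → ℂ} (hc : ContinuousOn h s) (he : ∀ x ∈ s, Complex.exp (h x) = 1) {x y : X}
    (hx : x ∈ s) (hy : y ∈ s) : h x = h y := by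
  have hd : DiscreteTopology (AddSubgroup.zmultiples (2 * Real.pi * Complex.I)) :=
    NormedSpace.discreteTopology_zmultiples _
  refine hs.constant_of_mapsTo (T := (AddSubgroup.zmultiples (2 * Real.pi * Complex.I) : Set ℂ))
    ⟨hd⟩ hc (fun z hz => ?_) hx hy
  obtain ⟨n, hn⟩ := Complex.exp_eq_one_iff.1 (he z hz)
  exact ⟨n, by simp [hn]⟩

theorem norm_two_pi_I : ‖(2 * Real.pi * Complex.I : ℂ)‖ = 2 * Real.pi := by
  simp [abs_of_pos Real.pi_pos]

theorem eq_zero_of_exp_eq_one_of_norm_lt {z : ℂ} (he : Complex.exp z = 1)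
    (hz : ‖z‖ < 2 * Real.pi) : z = 0 := by
  obtain ⟨n, hn⟩ := Complex.exp_eq_one_iff.1 he
  rw [hn, norm_mul, norm_two_pi_I, Complex.norm_intCast] at hz
  have h1 : |(n : ℝ)| < 1 := by
    have := Real.two_pi_pos
    by_contra! hh
    nlinarith
  have h2 : n = 0 := by
    have : |n| < 1 := by exact_mod_cast h1
    exact Int.abs_lt_one_iff.1 this
  simp [hn, h2]

theorem isPreconnected_norm_gt {R : ℝ} (hR : 0 < R) : IsPreconnected {y : ℂ | R < ‖y‖} := by
  have h1 : {y : ℂ | R < ‖y‖} = Complex.exp '' {z : ℂ | Real.log R < z.re} := by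
    ext y
    constructor
    · intro hy
      have hy' : y ≠ 0 := by
        rintro rfl
        simp at hy
        linarith
      exact ⟨Complex.log y, by simpa [Complex.log_re] using Real.log_lt_log hR hy,
        Complex.exp_log hy'⟩
    · rintro ⟨z, hz, rfl⟩
      simp only [mem_ofPred_eq, Complex.norm_exp]
      exact (Real.log_lt_iff_lt_exp hR).1 hz
  rw [h1]
  exact ((convex_halfSpace_re_gt _).isPreconnected).image _ Complex.continuous_exp.continuousOn

theorem isPreconnected_ball_diff_center (c : ℂ) (r : ℝ) : IsPreconnected (ball c r \ {c}) := by
  rcases le_or_gt r 0 with hr | hr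
  · rw [ball_eq_empty.2 hr]
    simp [isPreconnected_empty]
  have h1 : ball c r \ {c} = (fun z => c + Complex.exp z) '' {z : ℂ | z.re < Real.log r} := by
    ext y
    constructor
    · rintro ⟨hy, hyc⟩
      have hy' : y - c ≠ 0 := sub_ne_zero.2 hyc
      refine ⟨Complex.log (y - c), ?_, by simp [Complex.exp_log hy']⟩
      simp only [mem_ofPred_eq, Complex.log_re]
      exact Real.log_lt_log (norm_pos_iff.2 hy') (by simpa [dist_eq_norm] using hy)
    · rintro ⟨z, hz, rfl⟩
      refine ⟨?_, by simp [Complex.exp_ne_zero]⟩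
      simp only [mem_ball, dist_eq_norm, add_sub_cancel_left, Complex.norm_exp]
      exact (Real.lt_log_iff_exp_lt hr).1 hz
  rw [h1]
  exact ((convex_halfSpace_re_lt _).isPreconnected).image _
    (by fun_prop)

/-- Removing a point from a planar connected open set leaves it connected. -/
theorem IsOpen.isPreconnected_diff_singleton {U : Set ℂ} (ho : IsOpen U) (hU : IsPreconnected U)
    (c : ℂ) : IsPreconnected (U \ {c}) := by
  by_cases hc : c ∈ U
  swap
  · rwa [sdiff_singleton_eq_self hc]
  have ho' : IsOpen (U \ {c}) := ho.sdiff isClosed_singleton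
  obtain ⟨r, hr, hrU⟩ := Metric.isOpen_iff.1 ho c hc
  have hB := isPreconnected_ball_diff_center c r
  have hBU : ball c r \ {c} ⊆ U \ {c} := sdiff_subset_sdiff_left hrU
  rw [isPreconnected_iff_subset_of_disjoint]
  -- it is enough to treat the case where the punctured ball lies in the first piece
  have key : ∀ u v : Set ℂ, IsOpen u → IsOpen v → U \ {c} ⊆ u ∪ v → (U \ {c}) ∩ (u ∩ v) = ∅ →
      ball c r \ {c} ⊆ u → U \ {c} ⊆ u := by
    intro u v hu hv huv hd hb x hx
    have hop : IsOpen ((U ∩ u) ∪ ball c r) := (ho.inter hu).union isOpen_ball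
    have h2 := (isPreconnected_iff_subset_of_disjoint.1 hU) _ _ hop (ho'.inter hv) ?_ ?_
    · rcases h2 with h2 | h2
      · rcases h2 hx.1 with h | h
        · exact h.2
        · exact hb ⟨h, hx.2⟩
      · exact absurd (h2 hc).1.2 (by simp)
    · intro y hy
      by_cases hyc : y = c
      · left; right; rw [hyc]; exact mem_ball_self hr
      · rcases huv ⟨hy, hyc⟩ with h | h
        · exact Or.inl (Or.inl ⟨hy, h⟩)
        · exact Or.inr ⟨⟨hy, hyc⟩, h⟩
    · rw [eq_empty_iff_forall_notMem] at hd ⊢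
      rintro y ⟨hy, h3 | h3, h4⟩
      · exact hd y ⟨h4.1, h3.2, h4.2⟩
      · exact hd y ⟨h4.1, hb ⟨h3, h4.1.2⟩, h4.2⟩
  intro u v hu hv huv hd
  have h1 := (isPreconnected_iff_subset_of_disjoint.1 hB) u v hu hv (hBU.trans huv)
    (subset_empty_iff.1 (hd ▸ inter_subset_inter_left _ hBU))
  rcases h1 with h1 | h1
  · exact Or.inl (key u v hu hv huv hd h1)
  · exact Or.inr (key v u hv hu (by rwa [union_comm]) (by rwa [inter_comm v u]) h1)

theorem IsOpen.isPreconnected_diff_finite {U : Set ℂ} (ho : IsOpen U) (hU : IsPreconnected U)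
    {C : Set ℂ} (hC : C.Finite) : IsPreconnected (U \ C) := by
  induction C, hC using Set.Finite.induction_on with
  | empty => simpa using hU
  | @insert a s _ hs ih =>
    rw [insert_eq, union_comm, ← sdiff_sdiff]
    exact (ho.sdiff hs.isClosed).isPreconnected_diff_singleton ih a

/-- If a nowhere vanishing continuous function on a planar domain has a continuous logarithm on
every compact subset, then it has one on the whole domain. -/
theorem exists_log_of_compact {U : Set ℂ} (ho : IsOpen U) (hU : IsPreconnected U) {g : ℂ → ℂ}
    (hg : ContinuousOn g U) (hg0 : ∀ y ∈ U, g y ≠ 0)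
    (hP : ∀ P ⊆ U, IsCompact P → ∃ l : ℂ → ℂ, ContinuousOn l P ∧ ∀ y ∈ P, Complex.exp (l y) = g y) :
    ∃ h : ℂ → ℂ, ContinuousOn h U ∧ ∀ y ∈ U, Complex.exp (h y) = g y := by
  classical
  rcases U.eq_empty_or_nonempty with rfl | ⟨a, ha⟩
  · exact ⟨fun _ => 0, continuousOn_empty _, by simp⟩
  have : LocallyPathConnectedSpace U := ho.locallyPathConnectedSpace
  have : PathConnectedSpace U :=
    isPathConnected_iff_pathConnectedSpace.1 ((ho.isConnected_iff_isPathConnected).1 ⟨⟨a, ha⟩, hU⟩)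
  have cov := Complex.isCoveringMap_exp
  let G : C(U, {z : ℂ // z ≠ 0}) := ⟨fun y => ⟨g y, hg0 y y.2⟩,
    (continuousOn_iff_continuous_domRestrict.1 hg).subtype_mk _⟩
  obtain ⟨H, ⟨-, hH⟩, -⟩ := cov.isLocalHomeomorph.existsUnique_continuousMap_lifts G ⟨a, ha⟩
    (Complex.log (g a)) (Subtype.ext (Complex.exp_log (hg0 a ha)))
    (fun γ γ0 => by
      simpa [and_comm] using cov.exists_path_lifts (G.comp γ) (Complex.log (g a))
        (Subtype.ext (by rw [ContinuousMap.comp_apply, γ0]; exact (Complex.exp_log (hg0 a ha)).symm)))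
    (by
      intro γ γ' Γ Γ' h0 h0' H0 H0' hl hl' h1
      let P : Set ℂ := range (fun t => (γ t : ℂ)) ∪ range (fun t => (γ' t : ℂ))
      have hPc : IsCompact P := (isCompact_range (by fun_prop)).union (isCompact_range (by fun_prop))
      have hPU : P ⊆ U := by
        rintro _ (⟨t, rfl⟩ | ⟨t, rfl⟩)
        · exact (γ t).2
        · exact (γ' t).2
      obtain ⟨l, hlc, hle⟩ := hP P hPU hPc
      have aux : ∀ (δ : C(unitInterval, U)) (Δ : C(unitInterval, ℂ)),
          (fun z : ℂ => (⟨_, z.exp_ne_zero⟩ : {z : ℂ // z ≠ 0})) ∘ Δ = G.comp δ →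
          (∀ t, (δ t : ℂ) ∈ P) → Δ 0 - l (δ 0) = Δ 1 - l (δ 1) := by
        intro δ Δ hΔ hδ
        refine eq_of_exp_eq_one (s := univ) (h := fun t => Δ t - l (δ t)) isPreconnected_univ ?_ ?_
          (mem_univ _) (mem_univ _)
        · refine Continuous.continuousOn ?_
          exact Δ.continuous.sub (hlc.comp_continuous (by fun_prop) hδ)
        · intro t _
          have h3 := congrArg Subtype.val (congrFun hΔ t)
          simp only [Function.comp_apply, ContinuousMap.comp_apply, G] at h3
          simp only [Complex.exp_sub, hle _ (hδ t), h3]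
          exact div_self (hg0 _ (δ t).2)
      have e1 := aux γ Γ hl (fun t => Or.inl ⟨t, rfl⟩)
      have e2 := aux γ' Γ' hl' (fun t => Or.inr ⟨t, rfl⟩)
      rw [H0, h0] at e1
      rw [H0', h0'] at e2
      rw [h1] at e1
      linear_combination e2 - e1)
  refine ⟨fun y => if hy : y ∈ U then H ⟨y, hy⟩ else 0, ?_, ?_⟩
  · rw [continuousOn_iff_continuous_domRestrict]
    convert! H.continuous using 1
    ext y
    simp
  · intro y hy
    have h3 := congrArg Subtype.val (congrFun hH ⟨y, hy⟩)
    simp only [hy, dif_pos]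
    exact h3

/-- A homeomorphism of the plane fixing the origin, together with a continuous branch of the
logarithm of its difference quotient. -/
structure LogHomeo where
  /-- the underlying homeomorphism -/
  map : ℂ ≃ₜ ℂ
  /-- the logarithm of the difference quotient -/
  quot : ℂ → ℂ → ℂ
  map_zero : map 0 = 0
  cont : ∀ u v : ℂ, u ≠ v → ContinuousAt (fun p : ℂ × ℂ => quot p.1 p.2) (u, v)
  exp_quot : ∀ u v : ℂ, u ≠ v → Complex.exp (quot u v) = (map u - map v) / (u - v)
  lim : ∀ a b : ℂ, Tendsto (fun y => quot b y - quot a y) (cobounded ℂ) (𝓝 0)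

/-- The identity as a `LogHomeo`. -/
def LogHomeo.id : LogHomeo where
  map := Homeomorph.refl ℂ
  quot := fun _ _ => 0
  map_zero := rfl
  cont := fun _ _ _ => continuousAt_const
  exp_quot := fun u v h => by simp [div_self (sub_ne_zero.2 h)]
  lim := fun _ _ => by simp

/-- `S` is the support of an oriented arc from `a` to `b`, and `L y` is the total variation of a
continuous logarithm of `x - y` when `x` runs along the arc. -/
structure IsArc (S : Set ℂ) (a b : ℂ) (L : ℂ → ℂ) : Prop where
  compact : IsCompact S
  interior_eq : interior S = ∅
  left_mem : a ∈ S
  right_mem : b ∈ S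
  cont : ContinuousOn L Sᶜ
  exp_eq : ∀ y ∉ S, Complex.exp (L y) = (b - y) / (a - y)
  lim : Tendsto L (cobounded ℂ) (𝓝 0)

theorem IsArc.trans {S S' : Set ℂ} {a b c : ℂ} {L L' : ℂ → ℂ} (h : IsArc S a b L)
    (h' : IsArc S' b c L') : IsArc (S ∪ S') a c (fun y => L y + L' y) where
  compact := h.compact.union h'.compact
  interior_eq := by
    rw [interior_union_isClosed_of_interior_empty h.compact.isClosed h'.interior_eq, h.interior_eq]
  left_mem := Or.inl h.left_mem
  right_mem := Or.inr h'.right_mem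
  cont := (h.cont.mono (compl_subset_compl.2 subset_union_left)).add
    (h'.cont.mono (compl_subset_compl.2 subset_union_right))
  exp_eq := fun y hy => by
    have h1 : y ∉ S := fun hh => hy (Or.inl hh)
    have h2 : y ∉ S' := fun hh => hy (Or.inr hh)
    have hb : b - y ≠ 0 := fun hh => h1 (by rw [← sub_eq_zero.1 hh]; exact h.right_mem)
    have ha : a - y ≠ 0 := fun hh => h1 (by rw [← sub_eq_zero.1 hh]; exact h.left_mem)
    rw [Complex.exp_add, h.exp_eq y h1, h'.exp_eq y h2]
    field_simp
  lim := by simpa using h.lim.add h'.lim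

theorem LogHomeo.tendsto_symm (φ : LogHomeo) : Tendsto φ.map.symm (cobounded ℂ) (cobounded ℂ) := by
  rw [Metric.cobounded_eq_cocompact]
  exact φ.map.symm.isClosedEmbedding.tendsto_cocompact

/-- The logarithmic variation along an arc, transported by a homeomorphism. -/
def LogHomeo.push (φ : LogHomeo) (a b : ℂ) (L : ℂ → ℂ) (y : ℂ) : ℂ :=
  L (φ.map.symm y) + (φ.quot b (φ.map.symm y) - φ.quot a (φ.map.symm y))

theorem LogHomeo.continuousAt_quot_sub (φ : LogHomeo) {a b w : ℂ} (ha : a ≠ w) (hb : b ≠ w) :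
    ContinuousAt (fun w => φ.quot b w - φ.quot a w) w := by
  have h1 : ContinuousAt (fun w => φ.quot b w) w :=
    ContinuousAt.comp (f := fun w => (b, w)) (φ.cont b w hb) (by fun_prop)
  have h2 : ContinuousAt (fun w => φ.quot a w) w :=
    ContinuousAt.comp (f := fun w => (a, w)) (φ.cont a w ha) (by fun_prop)
  exact h1.sub h2

theorem LogHomeo.exp_quot_sub (φ : LogHomeo) {a b w : ℂ} (ha : a ≠ w) (hb : b ≠ w) :
    Complex.exp (φ.quot b w - φ.quot a w) =
      (φ.map b - φ.map w) / (φ.map a - φ.map w) * ((a - w) / (b - w)) := by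
  have ha' : a - w ≠ 0 := sub_ne_zero.2 ha
  have hb' : b - w ≠ 0 := sub_ne_zero.2 hb
  have ha2 : φ.map a - φ.map w ≠ 0 := sub_ne_zero.2 (fun h => ha (φ.map.injective h))
  rw [Complex.exp_sub, φ.exp_quot _ _ ha, φ.exp_quot _ _ hb]
  field_simp

theorem IsArc.push {S : Set ℂ} {a b : ℂ} {L : ℂ → ℂ} (h : IsArc S a b L) (φ : LogHomeo) :
    IsArc (φ.map '' S) (φ.map a) (φ.map b) (φ.push a b L) where
  compact := h.compact.image φ.map.continuous
  interior_eq := by rw [← φ.map.image_interior, h.interior_eq, image_empty]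
  left_mem := mem_image_of_mem _ h.left_mem
  right_mem := mem_image_of_mem _ h.right_mem
  cont := by
    intro y hy
    have hw : φ.map.symm y ∉ S := fun hh => hy ⟨_, hh, by simp⟩
    refine ContinuousAt.continuousWithinAt ?_
    refine ContinuousAt.comp (g := fun w => L w + (φ.quot b w - φ.quot a w)) (f := φ.map.symm) ?_
      φ.map.symm.continuous.continuousAt
    refine ContinuousAt.add (h.cont.continuousAt (h.compact.isClosed.isOpen_compl.mem_nhds hw)) ?_
    exact φ.continuousAt_quot_sub (fun hh => hw (hh ▸ h.left_mem)) (fun hh => hw (hh ▸ h.right_mem))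
  exp_eq := by
    intro y hy
    have hw : φ.map.symm y ∉ S := fun hh => hy ⟨_, hh, by simp⟩
    have ha : a ≠ φ.map.symm y := fun hh => hw (hh ▸ h.left_mem)
    have hb : b ≠ φ.map.symm y := fun hh => hw (hh ▸ h.right_mem)
    have ha' := sub_ne_zero.2 ha
    have hb' := sub_ne_zero.2 hb
    rw [LogHomeo.push, Complex.exp_add, h.exp_eq _ hw, φ.exp_quot_sub ha hb]
    simp only [Homeomorph.apply_symm_apply]
    field_simp
  lim := by
    have h1 := (h.lim.add (φ.lim a b)).comp φ.tendsto_symm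
    rw [add_zero] at h1
    exact h1

theorem interior_segment_eq_empty (A B : ℂ) : interior (segment ℝ A B) = ∅ := by
  rw [eq_empty_iff_forall_notMem]
  intro x hx
  obtain ⟨d, hd0, hd⟩ : ∃ d : ℂ, d ≠ 0 ∧ ∀ s : ℝ, (s : ℂ) * d = 0 ∨ x + s * d ∉ segment ℝ A B := by
    by_cases hAB : A = B
    · refine ⟨1, one_ne_zero, fun s => ?_⟩
      subst hAB
      have hxA := interior_subset hx
      rw [segment_same, mem_singleton_iff] at hxA ⊢
      by_cases hs : (s : ℂ) * 1 = 0
      · exact Or.inl hs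
      · right
        rw [hxA]
        simpa using hs
    · have hBA : B - A ≠ 0 := sub_ne_zero.2 (Ne.symm hAB)
      refine ⟨Complex.I * (B - A), mul_ne_zero Complex.I_ne_zero hBA, fun s => ?_⟩
      have hxA := interior_subset hx
      rw [segment_eq_image'] at hxA ⊢
      obtain ⟨t, -, rfl⟩ := hxA
      by_cases hs : s = 0
      · left; simp [hs]
      · right
        rintro ⟨u, -, hu⟩
        have h3 : ((u : ℂ) - t - s * Complex.I) * (B - A) = 0 := by
          simp only [Complex.real_smul] at hu
          linear_combination hu
        have h4 := congrArg Complex.im ((mul_eq_zero.1 h3).resolve_right hBA)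
        simp at h4
        exact hs h4
  have hnhds : ∀ᶠ s : ℝ in 𝓝 0, x + s * d ∈ segment ℝ A B := by
    have hc : ContinuousAt (fun s : ℝ => x + s * d) 0 := by fun_prop
    have h2 : segment ℝ A B ∈ 𝓝 (x + ((0 : ℝ) : ℂ) * d) := by
      simpa using mem_interior_iff_mem_nhds.1 hx
    exact hc h2
  obtain ⟨ε, hε, hball⟩ := Metric.eventually_nhds_iff.1 hnhds
  have h5 := hball (y := ε / 2) (by rw [Real.dist_eq, sub_zero, abs_of_pos (by linarith)]; linarith)
  rcases hd (ε / 2) with h6 | h6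
  · rcases mul_eq_zero.1 h6 with h7 | h7
    · have : ε / 2 = 0 := by exact_mod_cast h7
      linarith
    · exact hd0 h7
  · exact h6 h5

theorem div_mem_slitPlane {A B w : ℂ} (hw : w ∉ segment ℝ A B) :
    (B - w) / (A - w) ∈ Complex.slitPlane := by
  have hA : A - w ≠ 0 := fun h => hw (by rw [← sub_eq_zero.1 h]; exact left_mem_segment ℝ A B)
  by_contra h
  rw [Complex.mem_slitPlane_iff] at h
  push Not at h
  obtain ⟨h1, h2⟩ := h
  set s : ℝ := -((B - w) / (A - w)).re with hs
  have hs0 : 0 ≤ s := by linarith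
  have h3 : (B - w) / (A - w) = -(s : ℂ) := by
    apply Complex.ext
    · simp [hs]
    · simp [h2]
  rw [div_eq_iff hA] at h3
  refine hw ⟨s / (1 + s), 1 / (1 + s), by positivity, by positivity, ?_, ?_⟩
  · field_simp
    ring
  · have h4 : (1 + s : ℂ) ≠ 0 := by
      have : (1 + s : ℝ) ≠ 0 := by positivity
      exact_mod_cast this
    simp only [Complex.real_smul]
    push_cast
    field_simp
    linear_combination h3

theorem exists_neg_of_mem_openSegment {A B w : ℂ} (hAB : A ≠ B) (hw : w ∈ openSegment ℝ A B) :
    ∃ s : ℝ, 0 < s ∧ (B - w) / (A - w) = -(s : ℂ) := by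
  obtain ⟨a, b, ha, hb, hab, rfl⟩ := hw
  refine ⟨a / b, by positivity, ?_⟩
  have hb' : (b : ℂ) ≠ 0 := by exact_mod_cast hb.ne'
  have hab' : (a : ℂ) + b = 1 := by exact_mod_cast hab
  have h1 : A - (a • A + b • B) = b * (A - B) := by
    simp only [Complex.real_smul]; linear_combination (-A) * hab'
  have h2 : B - (a • A + b • B) = -(a * (A - B)) := by
    simp only [Complex.real_smul]; linear_combination (-B) * hab'
  rw [h1, h2]
  have := sub_ne_zero.2 hAB
  push_cast
  field_simp

/-- The logarithmic variation along a straight segment. -/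
def segLog (A B y : ℂ) : ℂ := Complex.log ((B - y) / (A - y))

theorem tendsto_div_sub_cobounded (a b : ℂ) :
    Tendsto (fun y : ℂ => (b - y) / (a - y)) (cobounded ℂ) (𝓝 1) := by
  have h1 : Tendsto (fun y : ℂ => (a - y)⁻¹) (cobounded ℂ) (𝓝 0) := by
    refine tendsto_inv₀_cobounded.comp ?_
    have h2 : Tendsto (fun y : ℂ => a - y) (cobounded ℂ) (cobounded ℂ) := by
      simpa [Metric.cobounded_eq_cocompact] using (Homeomorph.subLeft a).isClosedEmbedding.tendsto_cocompact
    exact h2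
  have h2 : Tendsto (fun y : ℂ => 1 + (b - a) * (a - y)⁻¹) (cobounded ℂ) (𝓝 1) := by
    simpa using (h1.const_mul (b - a)).const_add 1
  refine h2.congr' ?_
  have h3 : ∀ᶠ y : ℂ in cobounded ℂ, y ≠ a := by
    exact isBounded_def.1 (isBounded_singleton (x := a))
  filter_upwards [h3] with y hy
  have : a - y ≠ 0 := sub_ne_zero.2 (Ne.symm hy)
  field_simp
  ring

theorem isArc_segment (A B : ℂ) : IsArc (segment ℝ A B) A B (segLog A B) where
  compact := by
    rw [segment_eq_image']
    exact isCompact_Icc.image (by fun_prop)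
  interior_eq := interior_segment_eq_empty A B
  left_mem := left_mem_segment ℝ A B
  right_mem := right_mem_segment ℝ A B
  cont := by
    intro y hy
    have hA : A - y ≠ 0 := fun h => hy (by rw [← sub_eq_zero.1 h]; exact left_mem_segment ℝ A B)
    refine ContinuousAt.continuousWithinAt ?_
    refine ContinuousAt.clog ?_ (div_mem_slitPlane hy)
    exact ContinuousAt.div (by fun_prop) (by fun_prop) hA
  exp_eq := by
    intro y hy
    have hA : A - y ≠ 0 := fun h => hy (by rw [← sub_eq_zero.1 h]; exact left_mem_segment ℝ A B)
    have hB : B - y ≠ 0 := fun h => hy (by rw [← sub_eq_zero.1 h]; exact right_mem_segment ℝ A B)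
    exact Complex.exp_log (div_ne_zero hB hA)
  lim := by
    have h1 := (continuousAt_clog Complex.one_mem_slitPlane).tendsto.comp
      (tendsto_div_sub_cobounded A B)
    rw [Complex.log_one] at h1
    exact h1

theorem segLog_swap {A B y : ℂ} (hy : y ∉ segment ℝ A B) : segLog B A y = -segLog A B y := by
  have h := div_mem_slitPlane hy
  rw [segLog, segLog, ← Complex.log_inv _ (Complex.slitPlane_arg_ne_pi h), inv_div]

theorem segLog_add {A B Q y : ℂ} (hQ : Q ∈ segment ℝ A B) (hy : y ∉ segment ℝ A B) :
    segLog A B y = segLog A Q y + segLog Q B y := by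
  have hsub1 : ∀ q ∈ segment ℝ A B, y ∉ segment ℝ A q := fun q hq h =>
    hy ((convex_segment A B).segment_subset (left_mem_segment ℝ A B) hq h)
  have hsub2 : ∀ q ∈ segment ℝ A B, y ∉ segment ℝ q B := fun q hq h =>
    hy ((convex_segment A B).segment_subset hq (right_mem_segment ℝ A B) h)
  have hne : ∀ q ∈ segment ℝ A B, q - y ≠ 0 := fun q hq h => hy (sub_eq_zero.1 h ▸ hq)
  have hA := hne A (left_mem_segment ℝ A B)
  have hB := hne B (right_mem_segment ℝ A B)
  have h := eq_of_exp_eq_one (convex_segment A B).isPreconnected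
    (h := fun q => segLog A B y - segLog A q y - segLog q B y) ?_ ?_ hQ (left_mem_segment ℝ A B)
  · simp only [segLog, div_self hA, Complex.log_one] at h ⊢
    linear_combination h
  · intro q hq
    refine ContinuousAt.continuousWithinAt ?_
    refine (continuousAt_const.sub ?_).sub ?_
    · exact ContinuousAt.clog (by fun_prop) (div_mem_slitPlane (hsub1 q hq))
    · exact ContinuousAt.clog (ContinuousAt.div (by fun_prop) (by fun_prop) (hne q hq))
        (div_mem_slitPlane (hsub2 q hq))
  · intro q hq
    have := hne q hq
    rw [Complex.exp_sub, Complex.exp_sub, (isArc_segment A B).exp_eq y hy,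
      (isArc_segment A q).exp_eq y (hsub1 q hq), (isArc_segment q B).exp_eq y (hsub2 q hq)]
    field_simp

theorem abs_im_segLog_le (A B y : ℂ) : |(segLog A B y).im| ≤ Real.pi := by
  rw [segLog, Complex.log_im]
  exact Complex.abs_arg_le_pi _

theorem abs_im_segLog_lt {A B y : ℂ} (hy : y ∉ segment ℝ A B) : |(segLog A B y).im| < Real.pi := by
  rw [segLog, Complex.log_im]
  exact lt_of_le_of_ne (Complex.abs_arg_le_pi _)
    (fun h => by
      have h1 := Complex.slitPlane_arg_ne_pi (div_mem_slitPlane hy)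
      rcases abs_cases (Complex.arg ((B - y) / (A - y))) with h2 | h2
      · exact h1 (by rw [← h2.1, h])
      · have := Complex.neg_pi_lt_arg ((B - y) / (A - y))
        linarith)

/-- The logarithmic variation along the image of a straight segment. -/
def LogHomeo.segLog (φ : LogHomeo) (A B : ℂ) : ℂ → ℂ := φ.push A B (_root_.segLog A B)

theorem LogHomeo.isArc (φ : LogHomeo) (A B : ℂ) :
    IsArc (φ.map '' segment ℝ A B) (φ.map A) (φ.map B) (φ.segLog A B) :=
  (isArc_segment A B).push φ

theorem LogHomeo.segLog_add (φ : LogHomeo) {A B Q y : ℂ} (hQ : Q ∈ segment ℝ A B)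
    (hy : y ∉ φ.map '' segment ℝ A B) : φ.segLog A B y = φ.segLog A Q y + φ.segLog Q B y := by
  have hw : φ.map.symm y ∉ segment ℝ A B := fun hh => hy ⟨_, hh, by simp⟩
  simp only [LogHomeo.segLog, LogHomeo.push, _root_.segLog_add hQ hw]
  ring

theorem LogHomeo.id_segLog (A B : ℂ) : LogHomeo.id.segLog A B = _root_.segLog A B := by
  ext y
  simp [LogHomeo.segLog, LogHomeo.push, LogHomeo.id]

theorem norm_gt_mem_cobounded (R : ℝ) : {y : ℂ | R < ‖y‖} ∈ cobounded ℂ := by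
  have := (Metric.isBounded_closedBall (x := (0 : ℂ)) (r := R))
  rw [isBounded_def] at this
  filter_upwards [this] with y hy
  simpa using hy

/-- A nondegenerate planar continuum around the origin with connected complement. -/
structure IsHull (K : Set ℂ) : Prop where
  compact : IsCompact K
  conn : IsPreconnected K
  compl : IsPreconnected Kᶜ
  zero : 0 ∈ interior K

theorem IsHull.isOpen_compl {K : Set ℂ} (hK : IsHull K) : IsOpen Kᶜ :=
  hK.compact.isClosed.isOpen_compl

theorem IsHull.zero_mem {K : Set ℂ} (hK : IsHull K) : (0 : ℂ) ∈ K := interior_subset hK.zero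

theorem IsHull.exists_far {K : Set ℂ} (hK : IsHull K) :
    ∃ R : ℝ, 0 < R ∧ {y : ℂ | R < ‖y‖} ⊆ Kᶜ := by
  obtain ⟨R, hR⟩ := hK.compact.isBounded.exists_norm_le
  exact ⟨max R 1, by positivity, fun y hy hyK => not_lt.2 ((hR y hyK).trans (le_max_left _ _)) hy⟩

/-- `h` is the logarithm of `(b - y) / (a - y)` on the complement of `K` that vanishes at
infinity. -/
structure IsEndLog (K : Set ℂ) (a b : ℂ) (h : ℂ → ℂ) : Prop where
  cont : ContinuousOn h Kᶜ
  exp_eq : ∀ y ∉ K, Complex.exp (h y) = (b - y) / (a - y)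
  lim : Tendsto h (cobounded ℂ) (𝓝 0)

theorem exists_log_on_compact {K P : Set ℂ} (hK : IsPreconnected K)
    (hP : IsCompact P) (hPK : P ⊆ Kᶜ) {a b : ℂ} (ha : a ∈ K) (hb : b ∈ K) :
    ∃ l : ℂ → ℂ, ContinuousOn l P ∧ ∀ y ∈ P, Complex.exp (l y) = (b - y) / (a - y) := by
  have hne : ∀ z ∈ K, ∀ y ∈ P, z - y ≠ 0 := fun z hz y hy h => hPK hy (sub_eq_zero.1 h ▸ hz)
  refine hK.induction₂ (fun a b => ∃ l : ℂ → ℂ, ContinuousOn l P ∧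
    ∀ y ∈ P, Complex.exp (l y) = (b - y) / (a - y)) ?_ ?_ ?_ ha hb
  · intro z hz
    have hdisj : Disjoint P K := disjoint_left.2 fun y hy => hPK hy
    obtain ⟨ε, hε, hd⟩ : ∃ ε > 0, ∀ y ∈ P, ε ≤ ‖z - y‖ := by
      rcases P.eq_empty_or_nonempty with rfl | hPn
      · exact ⟨1, one_pos, by simp⟩
      · obtain ⟨y0, hy0, hmin⟩ := hP.exists_isMinOn hPn
          (f := fun y => ‖z - y‖) (by fun_prop)
        exact ⟨‖z - y0‖, norm_pos_iff.2 (hne z hz y0 hy0), fun y hy => hmin hy⟩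
    filter_upwards [mem_nhdsWithin_of_mem_nhds (Metric.ball_mem_nhds z hε)] with w hw
    have hslit : ∀ y ∈ P, (w - y) / (z - y) ∈ Complex.slitPlane := by
      intro y hy
      have h0 := hne z hz y hy
      have h1 : (w - y) / (z - y) = 1 + (w - z) / (z - y) := by
        field_simp; ring
      rw [h1]
      refine Complex.mem_slitPlane_of_norm_lt_one ?_
      rw [norm_div, div_lt_one (norm_pos_iff.2 h0)]
      exact lt_of_lt_of_le (by simpa [dist_eq_norm] using hw) (hd y hy)
    refine ⟨fun y => Complex.log ((w - y) / (z - y)), ?_, fun y hy =>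
      Complex.exp_log (Complex.slitPlane_ne_zero (hslit y hy))⟩
    intro y hy
    refine ContinuousAt.continuousWithinAt (ContinuousAt.clog ?_ (hslit y hy))
    exact ContinuousAt.div (by fun_prop) (by fun_prop) (hne z hz y hy)
  · rintro x y z hx hy hz ⟨l, hl, hle⟩ ⟨l', hl', hle'⟩
    refine ⟨fun t => l t + l' t, hl.add hl', fun t ht => ?_⟩
    have h1 := hne x hx t ht
    have h2 := hne y hy t ht
    rw [Complex.exp_add, hle t ht, hle' t ht]
    field_simp
  · rintro x y hx hy ⟨l, hl, hle⟩
    exact ⟨fun t => -l t, hl.neg, fun t ht => by rw [Complex.exp_neg, hle t ht, inv_div]⟩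

theorem IsHull.exists_endLog {K : Set ℂ} (hK : IsHull K) {a b : ℂ} (ha : a ∈ K) (hb : b ∈ K) :
    ∃ h, IsEndLog K a b h := by
  have hne : ∀ z ∈ K, ∀ y ∉ K, z - y ≠ 0 := fun z hz y hy h => hy (sub_eq_zero.1 h ▸ hz)
  obtain ⟨h, hc, he⟩ := exists_log_of_compact hK.isOpen_compl hK.compl
    (g := fun y => (b - y) / (a - y))
    (fun y hy => (ContinuousAt.div (by fun_prop) (by fun_prop)
      (hne a ha y hy)).continuousWithinAt)
    (fun y hy => div_ne_zero (hne b hb y hy) (hne a ha y hy))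
    (fun P hPK hP => exists_log_on_compact hK.conn hP hPK ha hb)
  obtain ⟨R, hR, hRK⟩ := hK.exists_far
  obtain ⟨R', hR', hs⟩ : ∃ R' : ℝ, R ≤ R' ∧ ∀ y : ℂ, R' < ‖y‖ → y ∉ segment ℝ a b := by
    obtain ⟨R', h'⟩ := (isArc_segment a b).compact.isBounded.exists_norm_le
    exact ⟨max R R', le_max_left _ _, fun y hy hys =>
      not_lt.2 ((h' y hys).trans (le_max_right _ _)) hy⟩
  have hR'0 : 0 < R' := hR.trans_le hR'
  have hfar : {y : ℂ | R' < ‖y‖} ⊆ Kᶜ := fun y hy => hRK (lt_of_le_of_lt hR' hy)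
  obtain ⟨y0, hy0⟩ : ∃ y0 : ℂ, R' < ‖y0‖ := ⟨(R' + 1 : ℝ), by
    rw [Complex.norm_real, Real.norm_of_nonneg (by linarith)]; linarith⟩
  have hdiff : ∀ y : ℂ, R' < ‖y‖ → h y - segLog a b y = h y0 - segLog a b y0 := by
    intro y hy
    refine eq_of_exp_eq_one (isPreconnected_norm_gt hR'0) (h := fun y => h y - segLog a b y)
      ?_ ?_ hy hy0
    · exact (hc.mono hfar).sub ((isArc_segment a b).cont.mono fun y hy => hs y hy)
    · intro y hy
      rw [Complex.exp_sub, he y (hfar hy), (isArc_segment a b).exp_eq y (hs y hy)]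
      exact div_self (div_ne_zero (hne b hb y (hfar hy)) (hne a ha y (hfar hy)))
  have hone : Complex.exp (h y0 - segLog a b y0) = 1 := by
    rw [Complex.exp_sub, he y0 (hfar hy0), (isArc_segment a b).exp_eq y0 (hs y0 hy0)]
    exact div_self (div_ne_zero (hne b hb y0 (hfar hy0)) (hne a ha y0 (hfar hy0)))
  refine ⟨fun y => h y - (h y0 - segLog a b y0), hc.sub continuousOn_const, fun y hy => ?_, ?_⟩
  · rw [Complex.exp_sub, hone, div_one, he y hy]
  · refine (isArc_segment a b).lim.congr' ?_
    filter_upwards [norm_gt_mem_cobounded R'] with y hy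
    linear_combination (-1 : ℂ) * hdiff y hy

theorem IsHull.compl_mem_cobounded {K : Set ℂ} (hK : IsHull K) : Kᶜ ∈ cobounded ℂ :=
  isBounded_def.1 hK.compact.isBounded

theorem IsEndLog.unique {K : Set ℂ} (hK : IsHull K) {a b : ℂ} (ha : a ∈ K) (hb : b ∈ K)
    {h h' : ℂ → ℂ} (hh : IsEndLog K a b h) (hh' : IsEndLog K a b h') : ∀ y ∉ K, h y = h' y := by
  intro y hy
  have hne : ∀ z ∈ K, ∀ y ∉ K, z - y ≠ 0 := fun z hz y hy h => hy (sub_eq_zero.1 h ▸ hz)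
  have h1 : ∀ w ∉ K, h w - h' w = h y - h' y := fun w hw =>
    eq_of_exp_eq_one hK.compl (h := fun y => h y - h' y) (hh.cont.sub hh'.cont) (fun y hy => by
      rw [Complex.exp_sub, hh.exp_eq y hy, hh'.exp_eq y hy]
      exact div_self (div_ne_zero (hne b hb y hy) (hne a ha y hy))) hw hy
  have h2 : Tendsto (fun w => h w - h' w) (cobounded ℂ) (𝓝 (h y - h' y)) := by
    refine tendsto_const_nhds.congr' ?_
    filter_upwards [hK.compl_mem_cobounded] with w hw
    exact (h1 w hw).symm
  have h3 := tendsto_nhds_unique h2 (hh.lim.sub hh'.lim)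
  rw [sub_zero] at h3
  exact sub_eq_zero.1 h3

theorem IsEndLog.refl {K : Set ℂ} {a : ℂ} (ha : a ∈ K) : IsEndLog K a a (fun _ => 0) where
  cont := continuousOn_const
  exp_eq := fun y hy => by
    have : a - y ≠ 0 := fun h => hy (sub_eq_zero.1 h ▸ ha)
    simp [div_self this]
  lim := tendsto_const_nhds

theorem IsEndLog.trans {K : Set ℂ} {a b c : ℂ} (hb : b ∈ K) {h h' : ℂ → ℂ}
    (hh : IsEndLog K a b h) (hh' : IsEndLog K b c h') :
    IsEndLog K a c (fun y => h y + h' y) where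
  cont := hh.cont.add hh'.cont
  exp_eq := fun y hy => by
    have h1 : b - y ≠ 0 := fun h => hy (sub_eq_zero.1 h ▸ hb)
    rw [Complex.exp_add, hh.exp_eq y hy, hh'.exp_eq y hy]
    field_simp
  lim := by simpa using hh.lim.add hh'.lim

theorem IsEndLog.symm {K : Set ℂ} {a b : ℂ} {h : ℂ → ℂ} (hh : IsEndLog K a b h) :
    IsEndLog K b a (fun y => -h y) where
  cont := hh.cont.neg
  exp_eq := fun y hy => by rw [Complex.exp_neg, hh.exp_eq y hy, inv_div]
  lim := by simpa using hh.lim.neg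

theorem IsEndLog.push {K : Set ℂ} {a b : ℂ} (ha : a ∈ K) (hb : b ∈ K) {h : ℂ → ℂ}
    (hh : IsEndLog K a b h) (φ : LogHomeo) :
    IsEndLog (φ.map '' K) (φ.map a) (φ.map b) (φ.push a b h) where
  cont := by
    intro y hy
    have hw : φ.map.symm y ∉ K := fun hh => hy ⟨_, hh, by simp⟩
    have h1 : MapsTo φ.map.symm (φ.map '' K)ᶜ Kᶜ := fun z hz hh => hz ⟨_, hh, by simp⟩
    have h2 : ContinuousWithinAt (fun z => h (φ.map.symm z)) (φ.map '' K)ᶜ y :=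
      ContinuousWithinAt.comp (hh.cont _ hw) φ.map.symm.continuous.continuousWithinAt h1
    refine h2.add (ContinuousAt.continuousWithinAt ?_)
    refine ContinuousAt.comp (g := fun w => φ.quot b w - φ.quot a w) (f := φ.map.symm) ?_
      φ.map.symm.continuous.continuousAt
    exact φ.continuousAt_quot_sub (fun hh => hw (hh ▸ ha)) (fun hh => hw (hh ▸ hb))
  exp_eq := by
    intro y hy
    have hw : φ.map.symm y ∉ K := fun hh => hy ⟨_, hh, by simp⟩
    have ha1 : a ≠ φ.map.symm y := fun hh => hw (hh ▸ ha)
    have hb1 : b ≠ φ.map.symm y := fun hh => hw (hh ▸ hb)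
    have ha' := sub_ne_zero.2 ha1
    have hb' := sub_ne_zero.2 hb1
    rw [LogHomeo.push, Complex.exp_add, hh.exp_eq _ hw, φ.exp_quot_sub ha1 hb1]
    simp only [Homeomorph.apply_symm_apply]
    field_simp
  lim := by
    have h1 := (hh.lim.add (φ.lim a b)).comp φ.tendsto_symm
    rw [add_zero] at h1
    exact h1

/-- An integer valued function on a planar domain which is locally constant off finitely many
thin sets, and takes only two consecutive values near each of them, cannot exceed their number. -/
theorem le_card_of_jumps {ι : Type*} [Fintype ι] {U S C : Set ℂ} {S' : ι → Set ℂ}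
    (hUo : IsOpen U) (hU : IsPreconnected U) (hC : C.Finite) (hS : IsClosed S)
    (hSi : interior S = ∅) (hcover : S ⊆ C ∪ ⋃ i, S' i) {e : ℂ → ℤ}
    (hloc : ∀ x ∈ U \ S, ∀ᶠ y in 𝓝 x, e y = e x)
    (hjump : ∀ i, ∃ a : ℤ, ∀ x ∈ U ∩ S' i, x ∉ C → ∀ᶠ y in 𝓝[Sᶜ] x, e y = a ∨ e y = a + 1)
    {x0 : ℂ} (hx0 : x0 ∈ U \ S) (he0 : e x0 ≤ 0) {x : ℂ} (hx : x ∈ U \ S) :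
    e x ≤ Fintype.card ι := by
  classical
  by_contra! hlt
  have hC' : interior (S ∪ C) = ∅ := by
    rw [interior_union_isClosed_of_interior_empty hS (by
      by_contra hne
      obtain ⟨z, hz⟩ := nonempty_iff_ne_empty.2 hne
      have h1 : C ∈ 𝓝 z := mem_interior_iff_mem_nhds.1 hz
      exact (infinite_of_mem_nhds z h1) hC), hSi]
  -- points where `e` is locally constant and which avoid the corners
  have hmove : ∀ x ∈ U \ S, ∃ z ∈ U \ (S ∪ C), e z = e x := by
    intro x hx
    have h1 : ∀ᶠ y in 𝓝 x, e y = e x ∧ y ∈ U := (hloc x hx).and (hUo.mem_nhds hx.1)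
    have h2 : x ∈ closure (S ∪ C)ᶜ := by
      rw [closure_compl, hC', compl_empty]; exact mem_univ _
    obtain ⟨z, hz1, hz2⟩ := mem_closure_iff_nhds.1 h2 _ h1
    exact ⟨z, ⟨hz1.2, hz2⟩, hz1.1⟩
  choose a ha using hjump
  obtain ⟨w, hw, hwa⟩ : ∃ w : ℤ, (0 ≤ w ∧ w ≤ Fintype.card ι) ∧ ∀ i, a i ≠ w := by
    by_contra! hcon
    have h1 : Finset.Icc (0 : ℤ) (Fintype.card ι) ⊆ Finset.univ.image a := by
      intro w hw
      obtain ⟨i, hi⟩ := hcon w (Finset.mem_Icc.1 hw)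
      exact Finset.mem_image.2 ⟨i, Finset.mem_univ _, hi⟩
    have h2 := (Finset.card_le_card h1).trans Finset.card_image_le
    rw [Int.card_Icc, Finset.card_univ] at h2
    omega
  set V : Set ℂ := U \ C with hV
  have hVo : IsOpen V := hUo.sdiff hC.isClosed
  have hVp : IsPreconnected V := hUo.isPreconnected_diff_finite hU hC
  let A : Set ℂ := {x | ∀ᶠ y in 𝓝 x, y ∈ Sᶜ → e y ≤ w}
  let B : Set ℂ := {x | ∀ᶠ y in 𝓝 x, y ∈ Sᶜ → w + 1 ≤ e y}
  have hAo : IsOpen A := isOpen_setOfPred_eventually_nhds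
  have hBo : IsOpen B := isOpen_setOfPred_eventually_nhds
  have hcov : V ⊆ A ∪ B := by
    rintro x ⟨hxU, hxC⟩
    by_cases hxS : x ∈ S
    · rcases hcover hxS with h | h
      · exact absurd h hxC
      · obtain ⟨i, hi⟩ := mem_iUnion.1 h
        have h1 := eventually_nhdsWithin_iff.1 (ha i x ⟨hxU, hi⟩ hxC)
        have h2 := hwa i
        rcases lt_or_gt_of_ne h2 with h3 | h3
        · left
          filter_upwards [h1] with y hy hyS
          rcases hy hyS with h | h <;> omega
        · right
          filter_upwards [h1] with y hy hyS
          rcases hy hyS with h | h <;> omega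
    · rcases le_or_gt (e x) w with h | h
      · left
        filter_upwards [hloc x ⟨hxU, hxS⟩] with y hy _
        omega
      · right
        filter_upwards [hloc x ⟨hxU, hxS⟩] with y hy _
        omega
  obtain ⟨z0, hz0, hez0⟩ := hmove x0 hx0
  obtain ⟨z1, hz1, hez1⟩ := hmove x hx
  have hz0V : z0 ∈ V := ⟨hz0.1, fun h => hz0.2 (Or.inr h)⟩
  have hz1V : z1 ∈ V := ⟨hz1.1, fun h => hz1.2 (Or.inr h)⟩
  have hz0A : z0 ∈ A := by
    filter_upwards [hloc z0 ⟨hz0.1, fun h => hz0.2 (Or.inl h)⟩] with y hy _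
    omega
  have hz1B : z1 ∈ B := by
    filter_upwards [hloc z1 ⟨hz1.1, fun h => hz1.2 (Or.inl h)⟩] with y hy _
    omega
  obtain ⟨z, -, hzA, hzB⟩ := hVp A B hAo hBo hcov ⟨z0, hz0V, hz0A⟩ ⟨z1, hz1V, hz1B⟩
  have h2 : z ∈ closure Sᶜ := by
    rw [closure_compl, hSi, compl_empty]; exact mem_univ _
  have h3 : ∀ᶠ y in 𝓝 z, (y ∈ Sᶜ → e y ≤ w) ∧ (y ∈ Sᶜ → w + 1 ≤ e y) := Filter.Eventually.and hzA hzB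
  obtain ⟨y, hy, hyS⟩ := mem_closure_iff_nhds.1 h2 _ h3
  have h4 := hy.1 hyS
  have h5 := hy.2 hyS
  omega

/-- The endpoint logarithm of a hull differs from the logarithmic variation along a concatenation
of `n` crosscuts by at most `n` turns. -/
theorem norm_endLog_sub_sum_le {ι : Type*} [Fintype ι] {K : Set ℂ} (hK : IsHull K) {a b : ℂ}
    {h : ℂ → ℂ} (ha : a ∈ K) (hb : b ∈ K) (hh : IsEndLog K a b h) (φ : ι → LogHomeo)
    (A B : ι → ℂ) (hAB : ∀ i, A i ≠ B i)
    (hU : ∀ i, (φ i).map '' openSegment ℝ (A i) (B i) ⊆ Kᶜ)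
    (hdisj : ∀ i j, i ≠ j → Disjoint ((φ i).map '' openSegment ℝ (A i) (B i))
      ((φ j).map '' segment ℝ (A j) (B j)))
    (hexp : ∀ y ∉ K, y ∉ ⋃ i, (φ i).map '' segment ℝ (A i) (B i) →
      Complex.exp (∑ i, (φ i).segLog (A i) (B i) y) = (b - y) / (a - y))
    {y : ℂ} (hyK : y ∉ K) (hyS : y ∉ ⋃ i, (φ i).map '' segment ℝ (A i) (B i)) :
    ‖h y - ∑ i, (φ i).segLog (A i) (B i) y‖ ≤ 2 * Real.pi * Fintype.card ι := by
  classical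
  have hpi := Real.pi_pos
  have hpi' : (2 * Real.pi * Complex.I : ℂ) ≠ 0 := Complex.two_pi_I_ne_zero
  set Si : ι → Set ℂ := fun i => (φ i).map '' segment ℝ (A i) (B i) with hSi
  set S : Set ℂ := ⋃ i, Si i with hS
  set l : ι → ℂ → ℂ := fun i => (φ i).segLog (A i) (B i) with hl
  set L : ℂ → ℂ := fun y => ∑ i, l i y with hL
  have harc : ∀ i, IsArc (Si i) _ _ (l i) := fun i => (φ i).isArc (A i) (B i)
  have hSc : IsClosed S := isClosed_iUnion_of_finite fun i => (harc i).compact.isClosed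
  have hSint : interior S = ∅ := by
    have hd : Dense Sᶜ := by
      rw [hS, compl_iUnion]
      exact dense_iInter_of_isOpen (fun i => (harc i).compact.isClosed.isOpen_compl)
        fun i => interior_eq_empty_iff_dense_compl.1 (harc i).interior_eq
    exact interior_eq_empty_iff_dense_compl.2 hd
  have hne : ∀ z ∈ K, ∀ y ∉ K, z - y ≠ 0 := fun z hz y hy h => hy (sub_eq_zero.1 h ▸ hz)
  have hLc : ∀ x ∉ S, ContinuousAt L x := fun x hx =>
    tendsto_finsetSum _ fun i _ => (harc i).cont.continuousAt
      ((harc i).compact.isClosed.isOpen_compl.mem_nhds fun hxi => hx (mem_iUnion_of_mem i hxi))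
  have hhc : ∀ x ∉ K, ContinuousAt h x := fun x hx => hh.cont.continuousAt
    (hK.isOpen_compl.mem_nhds hx)
  have hone : ∀ x ∈ Kᶜ \ S, Complex.exp (h x - L x) = 1 := by
    rintro x ⟨hx, hxS⟩
    rw [Complex.exp_sub, hh.exp_eq x hx, hexp x hx hxS]
    exact div_self (div_ne_zero (hne b hb x hx) (hne a ha x hx))
  set e : ℂ → ℤ := fun x => round ((h x - L x).im / (2 * Real.pi)) with he
  have hee : ∀ x ∈ Kᶜ \ S, h x - L x = e x * (2 * Real.pi * Complex.I) := by
    intro x hx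
    obtain ⟨n, hn⟩ := Complex.exp_eq_one_iff.1 (hone x hx)
    have h1 : (h x - L x).im / (2 * Real.pi) = n := by
      rw [hn]
      simp
    rw [he]
    simp only [h1, round_intCast]
    exact hn
  have hloc : ∀ x ∈ Kᶜ \ S, ∀ᶠ y in 𝓝 x, e y = e x := by
    intro x hx
    have hc : ContinuousAt (fun y => (h y - L y) - (h x - L x)) x :=
      ((hhc x hx.1).sub (hLc x hx.2)).sub continuousAt_const
    have h1 : ∀ᶠ y in 𝓝 x, ‖(h y - L y) - (h x - L x)‖ < 2 * Real.pi := by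
      refine hc.norm.eventually_lt continuousAt_const ?_
      simpa using hpi
    have h2 : ∀ᶠ y in 𝓝 x, y ∈ Kᶜ \ S :=
      (hK.isOpen_compl.sdiff hSc).mem_nhds hx
    filter_upwards [h1, h2] with y hy hyU
    have h3 := eq_zero_of_exp_eq_one_of_norm_lt
      (by rw [Complex.exp_sub, hone y hyU, hone x hx, div_one]) hy
    rw [hee y hyU, hee x hx, ← sub_mul] at h3
    have h4 := (mul_eq_zero.1 h3).resolve_right hpi'
    exact_mod_cast sub_eq_zero.1 h4
  obtain ⟨x0, hx0, he0⟩ : ∃ x0 ∈ Kᶜ \ S, e x0 = 0 := by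
    have h1 : Tendsto (fun y => h y - L y) (cobounded ℂ) (𝓝 0) := by
      have h2 : Tendsto L (cobounded ℂ) (𝓝 (∑ i : ι, 0)) :=
        tendsto_finsetSum _ fun i _ => (harc i).lim
      simpa using hh.lim.sub h2
    have h2 : ∀ᶠ y in cobounded ℂ, ‖h y - L y‖ < 2 * Real.pi := by
      have := h1.norm
      rw [norm_zero] at this
      exact this.eventually_lt_const (by positivity)
    have h3 : ∀ᶠ y in cobounded ℂ, y ∉ S := isBounded_def.1
      (isCompact_iUnion fun i => (harc i).compact).isBounded
    obtain ⟨x0, h4, h5, h6⟩ := (h2.and (h3.and hK.compl_mem_cobounded)).exists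
    refine ⟨x0, ⟨h6, h5⟩, ?_⟩
    have h7 := eq_zero_of_exp_eq_one_of_norm_lt (hone x0 ⟨h6, h5⟩) h4
    rw [hee x0 ⟨h6, h5⟩] at h7
    exact_mod_cast (mul_eq_zero.1 h7).resolve_right hpi'
  set C : Set ℂ := range (fun i => (φ i).map (A i)) ∪ range (fun i => (φ i).map (B i)) with hC
  have hCf : C.Finite := (finite_range _).union (finite_range _)
  have hcover : S ⊆ C ∪ ⋃ i, (φ i).map '' openSegment ℝ (A i) (B i) := by
    intro x hx
    obtain ⟨i, w, hw, rfl⟩ := mem_iUnion.1 hx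
    rw [← insert_endpoints_openSegment] at hw
    rcases hw with rfl | rfl | hw
    · exact Or.inl (Or.inl ⟨i, rfl⟩)
    · exact Or.inl (Or.inr ⟨i, rfl⟩)
    · exact Or.inr (mem_iUnion_of_mem i ⟨w, hw, rfl⟩)
  have hjump : ∀ i, ∃ c : ℤ, ∀ x ∈ Kᶜ ∩ (φ i).map '' openSegment ℝ (A i) (B i), x ∉ C →
      ∀ᶠ y in 𝓝[Sᶜ] x, e y = c ∨ e y = c + 1 := by
    intro i
    set k : ℂ → ℂ := fun y => h y - ∑ j ∈ Finset.univ.erase i, l j y with hk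
    have hkL : ∀ y, k y = (h y - L y) + l i y := by
      intro y
      have := Finset.add_sum_erase Finset.univ (fun j => l j y) (Finset.mem_univ i)
      simp only [hk, hL, ← this]
      ring
    have hkc : ∀ w ∈ openSegment ℝ (A i) (B i), ContinuousAt k ((φ i).map w) := by
      intro w hw
      refine (hhc _ (hU i ⟨w, hw, rfl⟩)).sub (tendsto_finsetSum _ fun j hj => ?_)
      exact (harc j).cont.continuousAt ((harc j).compact.isClosed.isOpen_compl.mem_nhds
        fun hxj => disjoint_left.1 (hdisj i j (Finset.ne_of_mem_erase hj).symm) ⟨w, hw, rfl⟩ hxj)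
    have hneA : ∀ w ∈ openSegment ℝ (A i) (B i), A i ≠ w := by
      rintro w hw rfl
      exact hAB i (left_mem_openSegment_iff.1 hw)
    have hneB : ∀ w ∈ openSegment ℝ (A i) (B i), B i ≠ w := by
      rintro w hw rfl
      exact hAB i (right_mem_openSegment_iff.1 hw)
    set H : ℂ → ℂ := fun w => k ((φ i).map w) - ((φ i).quot (B i) w - (φ i).quot (A i) w) with hH
    have hHc : ∀ w ∈ openSegment ℝ (A i) (B i), ContinuousAt H w := fun w hw =>
      (ContinuousAt.comp (g := k) (f := (φ i).map) (hkc w hw)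
        (φ i).map.continuous.continuousAt).sub
        ((φ i).continuousAt_quot_sub (hneA w hw) (hneB w hw))
    have hHL : ∀ w, (φ i).map w ∈ Kᶜ \ S →
        H w = e ((φ i).map w) * (2 * Real.pi * Complex.I) + segLog (A i) (B i) w := by
      intro w hw
      simp only [hH, hkL, hee _ hw, hl, LogHomeo.segLog, LogHomeo.push,
        Homeomorph.symm_apply_apply]
      ring
    have hHe : ∀ w ∈ openSegment ℝ (A i) (B i), Complex.exp (H w) = (B i - w) / (A i - w) := by
      intro w hw
      have hdense : Dense ((φ i).map ⁻¹' Sᶜ) := by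
        have := (interior_eq_empty_iff_dense_compl.1 hSint).preimage (φ i).map.isOpenMap
        exact this
      have h1 : ∃ᶠ z in 𝓝 w, z ∈ (φ i).map ⁻¹' Sᶜ := mem_closure_iff_frequently.1 (hdense w)
      have h2 : ∀ᶠ z in 𝓝 w, z ∈ (φ i).map ⁻¹' Kᶜ :=
        (φ i).map.continuous.continuousAt (hK.isOpen_compl.mem_nhds (hU i ⟨w, hw, rfl⟩))
      have hc1 : ContinuousAt (fun z => Complex.exp (H z)) w := (hHc w hw).cexp
      have hc2 : ContinuousAt (fun z => (B i - z) / (A i - z)) w :=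
        ContinuousAt.div (by fun_prop) (by fun_prop) (sub_ne_zero.2 (hneA w hw))
      by_contra hcon
      have h3 : ∀ᶠ z in 𝓝 w, Complex.exp (H z) ≠ (B i - z) / (A i - z) :=
      (hc1.tendsto.sub hc2.tendsto).eventually_ne (sub_ne_zero.2 hcon) |>.mono fun z hz => sub_ne_zero.1 hz
      obtain ⟨z, hz1, hz2, hz3⟩ := (h1.and_eventually (h2.and h3)).exists
      refine hz3 ?_
      have hzs : z ∉ segment ℝ (A i) (B i) := fun hz => hz1 (mem_iUnion_of_mem i ⟨z, hz, rfl⟩)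
      rw [hHL z ⟨hz2, hz1⟩, Complex.exp_add, Complex.exp_int_mul_two_pi_mul_I, one_mul]
      exact (isArc_segment _ _).exp_eq z hzs
    have hlogc : ∀ w ∈ openSegment ℝ (A i) (B i), ContinuousAt
        (fun w => H w - Complex.log (-((B i - w) / (A i - w))) - Real.pi * Complex.I) w := by
      intro w hw
      obtain ⟨s, hs, hsw⟩ := exists_neg_of_mem_openSegment (hAB i) hw
      refine ((hHc w hw).sub (ContinuousAt.clog ?_ ?_)).sub continuousAt_const
      · exact (ContinuousAt.div (by fun_prop) (by fun_prop) (sub_ne_zero.2 (hneA w hw))).neg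
      · rw [hsw, neg_neg]
        exact Complex.ofReal_mem_slitPlane.2 hs
    have hlog1 : ∀ w ∈ openSegment ℝ (A i) (B i), Complex.exp
        (H w - Complex.log (-((B i - w) / (A i - w))) - Real.pi * Complex.I) = 1 := by
      intro w hw
      obtain ⟨s, hs, hsw⟩ := exists_neg_of_mem_openSegment (hAB i) hw
      have hs' : (s : ℂ) ≠ 0 := by exact_mod_cast hs.ne'
      rw [Complex.exp_sub, Complex.exp_sub, hHe w hw, hsw, neg_neg, Complex.exp_log hs',
        Complex.exp_pi_mul_I]
      field_simp
    obtain ⟨w0, hw0⟩ : (openSegment ℝ (A i) (B i)).Nonempty :=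
      ⟨(1 / 2 : ℝ) • A i + (1 / 2 : ℝ) • B i, 1 / 2, 1 / 2, by norm_num, by norm_num, by norm_num,
        rfl⟩
    obtain ⟨c, hc⟩ := Complex.exp_eq_one_iff.1 (hlog1 w0 hw0)
    have himH : ∀ w ∈ openSegment ℝ (A i) (B i), (H w).im = Real.pi + 2 * Real.pi * c := by
      intro w hw
      obtain ⟨s, hs, hsw⟩ := exists_neg_of_mem_openSegment (hAB i) hw
      have h1 := eq_of_exp_eq_one (convex_openSegment (A i) (B i)).isPreconnected
        (fun w hw => (hlogc w hw).continuousWithinAt) hlog1 hw hw0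
      rw [hc, hsw, neg_neg, ← Complex.ofReal_log hs.le] at h1
      have h2 := congrArg Complex.im h1
      simp at h2
      linarith
    refine ⟨c, ?_⟩
    rintro _ ⟨-, w, hw, rfl⟩ -
    have h1 : ∀ᶠ z in 𝓝 w, (H z).im < Real.pi + 2 * Real.pi * c + Real.pi ∧
        Real.pi + 2 * Real.pi * c - Real.pi < (H z).im := by
      have hcim : ContinuousAt (fun z => (H z).im) w :=
        Complex.continuous_im.continuousAt.comp (hHc w hw)
      refine (hcim.eventually_lt continuousAt_const ?_).and
        (continuousAt_const.eventually_lt hcim ?_)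
      · rw [himH w hw]; linarith
      · rw [himH w hw]; linarith
    have h2 : ∀ᶠ y in 𝓝 ((φ i).map w), (H ((φ i).map.symm y)).im <
        Real.pi + 2 * Real.pi * c + Real.pi ∧
        Real.pi + 2 * Real.pi * c - Real.pi < (H ((φ i).map.symm y)).im := by
      have h3 : Tendsto (φ i).map.symm (𝓝 ((φ i).map w)) (𝓝 w) := by
        have := (φ i).map.symm.continuous.tendsto ((φ i).map w)
        rwa [Homeomorph.symm_apply_apply] at this
      exact h3.eventually h1
    have h3 : ∀ᶠ y in 𝓝 ((φ i).map w), y ∉ K := hK.isOpen_compl.mem_nhds (hU i ⟨w, hw, rfl⟩)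
    rw [eventually_nhdsWithin_iff]
    filter_upwards [h2, h3] with y hy hyK hyS
    have h4 : (φ i).map.symm y ∉ segment ℝ (A i) (B i) := fun hz =>
      hyS (mem_iUnion_of_mem i ⟨_, hz, by simp⟩)
    have h5 := hHL ((φ i).map.symm y) (by simpa using ⟨hyK, hyS⟩)
    have h6 := congrArg Complex.im h5
    have h7 := abs_lt.1 (abs_im_segLog_lt h4)
    simp at h6
    have h8 : ((c - 1 : ℤ) : ℝ) < e y := by
      push_cast
      nlinarith [hy.2, h7.1, h7.2]
    have h9 : (e y : ℝ) < ((c + 2 : ℤ) : ℝ) := by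
      push_cast
      nlinarith [hy.1, h7.1, h7.2]
    have h10 : c - 1 < e y := by exact_mod_cast h8
    have h11 : e y < c + 2 := by exact_mod_cast h9
    omega
  have hup := le_card_of_jumps hK.isOpen_compl hK.compl hCf hSc hSint hcover hloc hjump hx0
    he0.le (x := y) ⟨hyK, hyS⟩
  have hdown := le_card_of_jumps (e := fun x => -e x) hK.isOpen_compl hK.compl hCf hSc hSint hcover
    (fun x hx => (hloc x hx).mono fun y hy => by rw [hy])
    (fun i => by
      obtain ⟨c, hc⟩ := hjump i
      refine ⟨-c - 1, fun x hx hxC => (hc x hx hxC).mono fun y hy => ?_⟩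
      rcases hy with hy | hy <;> rw [hy]
      · right; ring
      · left; ring) hx0
    (by rw [he0]; simp) (x := y) ⟨hyK, hyS⟩
  have hf : h y - L y = e y * (2 * Real.pi * Complex.I) := hee y ⟨hyK, hyS⟩
  change ‖h y - L y‖ ≤ _
  rw [hf, norm_mul, norm_two_pi_I, Complex.norm_intCast, mul_comm]
  refine mul_le_mul_of_nonneg_left ?_ (by positivity)
  rw [abs_le]
  constructor
  · have : (-e y : ℝ) ≤ Fintype.card ι := by exact_mod_cast hdown
    linarith
  · exact_mod_cast hup

/-- Points off `K` which tend to `K` while avoiding any given meagre set. -/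
def endFilter (K : Set ℂ) : Filter ℂ := 𝓝ˢ K ⊓ 𝓟 Kᶜ ⊓ residual ℂ

theorem IsHull.neBot_endFilter {K : Set ℂ} (hK : IsHull K) : (endFilter K).NeBot := by
  rw [endFilter, inf_neBot_iff]
  intro s hs t ht
  obtain ⟨u, hu, v, hv, rfl⟩ := mem_inf_iff.1 hs
  obtain ⟨W, hW, hKW, hWu⟩ := mem_nhdsSet_iff_exists.1 hu
  have hne : (W ∩ Kᶜ).Nonempty := by
    by_contra! hcon
    have h1 : W = K := by
      refine Subset.antisymm (fun x hx => ?_) hKW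
      by_contra hxK
      exact (eq_empty_iff_forall_notMem.1 hcon x) ⟨hx, hxK⟩
    have h2 : IsClopen K := ⟨hK.compact.isClosed, h1 ▸ hW⟩
    rcases isClopen_iff.1 h2 with h3 | h3
    · exact (h3 ▸ hK.zero_mem : (0 : ℂ) ∈ (∅ : Set ℂ))
    · obtain ⟨R, hR, hRK⟩ := hK.exists_far
      refine hRK (a := ((R + 1 : ℝ) : ℂ)) ?_ (h3 ▸ mem_univ _)
      simp only [mem_ofPred_eq, Complex.norm_real, Real.norm_eq_abs]
      rw [abs_of_pos (by linarith)]
      linarith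
  obtain ⟨x, hx, hxt⟩ := (dense_of_mem_residual ht).inter_open_nonempty _
    (hW.inter hK.isOpen_compl) hne
  exact ⟨x, ⟨hWu hx.1, hv hx.2⟩, hxt⟩

theorem eventually_endFilter_notMem {K : Set ℂ} : ∀ᶠ y in endFilter K, y ∉ K :=
  (inf_le_left.trans inf_le_right : endFilter K ≤ 𝓟 Kᶜ) (mem_principal_self _)

theorem eventually_endFilter_of_nhdsSet {K : Set ℂ} {p : ℂ → Prop} (h : ∀ᶠ y in 𝓝ˢ K, p y) :
    ∀ᶠ y in endFilter K, p y :=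
  (inf_le_left.trans inf_le_left : endFilter K ≤ 𝓝ˢ K) h

theorem IsArc.eventually_notMem {K S : Set ℂ} {a b : ℂ} {L : ℂ → ℂ} (h : IsArc S a b L) :
    ∀ᶠ y in endFilter K, y ∉ S :=
  (inf_le_right : endFilter K ≤ residual ℂ)
    (residual_of_dense_open h.compact.isClosed.isOpen_compl
      (interior_eq_empty_iff_dense_compl.1 h.interior_eq))

theorem LogHomeo.tendsto_symm_endFilter (φ : LogHomeo) (K : Set ℂ) :
    Tendsto φ.map.symm (endFilter (φ.map '' K)) (endFilter K) := by
  refine tendsto_inf.2 ⟨tendsto_inf.2 ⟨?_, ?_⟩, ?_⟩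
  · have h1 : Tendsto φ.map.symm (𝓝ˢ (φ.map '' K)) (𝓝ˢ K) :=
      φ.map.symm.continuous.tendsto_nhdsSet (by rintro _ ⟨x, hx, rfl⟩; simpa using hx)
    exact h1.mono_left (inf_le_left.trans inf_le_left)
  · refine tendsto_principal.2 (eventually_endFilter_notMem.mono fun y hy hw => hy ⟨_, hw, by simp⟩)
  · exact (tendsto_residual_of_isOpenMap φ.map.symm.continuous φ.map.symm.isOpenMap).mono_left
      inf_le_right

/-- A logarithm of `1` near a hull is constant near it. -/
theorem IsHull.eventually_eq_of_exp_eq_one {K W : Set ℂ} (hK : IsHull K) (hW : IsOpen W)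
    (hKW : K ⊆ W) {f : ℂ → ℂ} (hf : ContinuousOn f W) (he : ∀ y ∈ W, Complex.exp (f y) = 1) :
    ∀ᶠ y in 𝓝ˢ K, f y = f 0 := by
  refine eventually_nhdsSet_iff_forall.2 fun x hx => ?_
  have h0 : f x = f 0 := eq_of_exp_eq_one hK.conn (hf.mono hKW) (fun y hy => he y (hKW hy)) hx
    hK.zero_mem
  have hc : ContinuousAt (fun y => f y - f x) x :=
    (hf.continuousAt (hW.mem_nhds (hKW hx))).sub continuousAt_const
  have h1 : ∀ᶠ y in 𝓝 x, ‖f y - f x‖ < 2 * Real.pi := by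
    refine hc.norm.eventually_lt continuousAt_const ?_
    simpa using Real.pi_pos
  filter_upwards [h1, hW.mem_nhds (hKW hx)] with y hy hyW
  have h2 := eq_zero_of_exp_eq_one_of_norm_lt
    (by rw [Complex.exp_sub, he y hyW, he x (hKW hx), div_one]) hy
  rw [← h0]
  exact sub_eq_zero.1 h2

/-- Two arcs with the same endpoints disjoint from a hull have logarithmic variations differing by
a constant near the hull. -/
theorem IsHull.eventually_sub_eq {K S S' : Set ℂ} (hK : IsHull K) {a b : ℂ} {L L' : ℂ → ℂ}
    (h : IsArc S a b L) (h' : IsArc S' a b L') (hS : S ⊆ Kᶜ) (hS' : S' ⊆ Kᶜ) :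
    Complex.exp (L 0 - L' 0) = 1 ∧ ∀ᶠ y in 𝓝ˢ K, L y - L' y = L 0 - L' 0 := by
  have hW : IsOpen (S ∪ S')ᶜ := (h.compact.union h'.compact).isClosed.isOpen_compl
  have hKW : K ⊆ (S ∪ S')ᶜ := by
    rintro x hx (hxS | hxS)
    · exact hS hxS hx
    · exact hS' hxS hx
  have he : ∀ y ∈ (S ∪ S')ᶜ, Complex.exp (L y - L' y) = 1 := by
    intro y hy
    have h1 : y ∉ S := fun hh => hy (Or.inl hh)
    have h2 : y ∉ S' := fun hh => hy (Or.inr hh)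
    have hb : b - y ≠ 0 := fun hh => h1 (by rw [← sub_eq_zero.1 hh]; exact h.right_mem)
    have ha : a - y ≠ 0 := fun hh => h1 (by rw [← sub_eq_zero.1 hh]; exact h.left_mem)
    rw [Complex.exp_sub, h.exp_eq y h1, h'.exp_eq y h2]
    exact div_self (div_ne_zero hb ha)
  exact ⟨he 0 (hKW hK.zero_mem), hK.eventually_eq_of_exp_eq_one hW hKW
    (f := fun y => L y - L' y)
    ((h.cont.mono (compl_subset_compl.2 subset_union_left)).sub
      (h'.cont.mono (compl_subset_compl.2 subset_union_right))) he⟩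

/-- The curve with logarithmic variation `X` issued from `ζ`, followed by `Γ` and by the reverse of
the curve with variation `X'` issued from `ζ'`, turns around the points near the hull `K` as often
as the complement of the hull does, up to an error of `c` turns. -/
def Linked (K : Set ℂ) (ζ : ℂ) (X : ℂ → ℂ) (ζ' : ℂ) (X' Γ : ℂ → ℂ) (c : ℝ) : Prop :=
  ∃ h, IsEndLog K ζ ζ' h ∧ ∀ᶠ y in endFilter K, ‖h y - (X y + Γ y - X' y)‖ ≤ 2 * Real.pi * c

theorem Linked.mono {K : Set ℂ} {ζ ζ' : ℂ} {X X' Γ : ℂ → ℂ} {c c' : ℝ}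
    (h : Linked K ζ X ζ' X' Γ c) (hc : c ≤ c') : Linked K ζ X ζ' X' Γ c' := by
  obtain ⟨f, hf, hfc⟩ := h
  exact ⟨f, hf, hfc.mono fun y hy => hy.trans
    (mul_le_mul_of_nonneg_left hc Real.two_pi_pos.le)⟩

theorem Linked.refl {K : Set ℂ} {ζ : ℂ} (hζ : ζ ∈ K) (X : ℂ → ℂ) :
    Linked K ζ X ζ X (fun _ => 0) 0 :=
  ⟨_, IsEndLog.refl hζ, .of_forall fun y => by simp⟩

theorem Linked.trans {K : Set ℂ} {ζ ζ' ζ'' : ℂ} (hζ' : ζ' ∈ K) {X X' X'' Γ Γ' : ℂ → ℂ} {c c' : ℝ}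
    (h : Linked K ζ X ζ' X' Γ c) (h' : Linked K ζ' X' ζ'' X'' Γ' c') :
    Linked K ζ X ζ'' X'' (fun y => Γ y + Γ' y) (c + c') := by
  obtain ⟨f, hf, hfc⟩ := h
  obtain ⟨f', hf', hfc'⟩ := h'
  refine ⟨_, hf.trans hζ' hf', ?_⟩
  filter_upwards [hfc, hfc'] with y hy hy'
  calc ‖f y + f' y - (X y + (Γ y + Γ' y) - X'' y)‖
      = ‖(f y - (X y + Γ y - X' y)) + (f' y - (X' y + Γ' y - X'' y))‖ := by congr 1; ring
    _ ≤ _ := norm_add_le _ _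
    _ ≤ _ := by rw [mul_add]; exact add_le_add hy hy'

theorem Linked.trans' {K : Set ℂ} {ζ ζ' ζ'' : ℂ} (hζ' : ζ' ∈ K) {X X' X'' : ℂ → ℂ} {c c' : ℝ}
    (h : Linked K ζ X ζ' X' (fun _ => 0) c) (h' : Linked K ζ' X' ζ'' X'' (fun _ => 0) c') :
    Linked K ζ X ζ'' X'' (fun _ => 0) (c + c') := by
  simpa using h.trans hζ' h'

theorem Linked.push {K : Set ℂ} {ζ ζ' : ℂ} (hζ : ζ ∈ K) (hζ' : ζ' ∈ K) {X X' Γ : ℂ → ℂ} {c : ℝ}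
    (h : Linked K ζ X ζ' X' Γ c) (φ : LogHomeo) (p p' : ℂ) :
    Linked (φ.map '' K) (φ.map ζ) (φ.push ζ p X) (φ.map ζ') (φ.push ζ' p' X') (φ.push p p' Γ) c := by
  obtain ⟨f, hf, hfc⟩ := h
  refine ⟨_, hf.push hζ hζ' φ, ?_⟩
  filter_upwards [(φ.tendsto_symm_endFilter K).eventually hfc] with y hy
  refine le_trans (le_of_eq ?_) hy
  simp only [LogHomeo.push]
  congr 1
  ring

theorem Linked.push' {K : Set ℂ} {ζ ζ' : ℂ} (hζ : ζ ∈ K) (hζ' : ζ' ∈ K) {X X' : ℂ → ℂ} {c : ℝ}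
    (h : Linked K ζ X ζ' X' (fun _ => 0) c) (φ : LogHomeo) (p : ℂ) :
    Linked (φ.map '' K) (φ.map ζ) (φ.push ζ p X) (φ.map ζ') (φ.push ζ' p X') (fun _ => 0) c := by
  have h0 : φ.push p p (fun _ => 0) = fun _ => 0 := by
    ext y
    simp [LogHomeo.push]
  exact h0 ▸ h.push hζ hζ' φ p p

/-- The segment from `ζ` to `p` meets `K` exactly in `ζ`. -/
structure IsSpike (K : Set ℂ) (ζ p : ℂ) : Prop where
  mem : ζ ∈ K
  notMem : p ∉ K
  eq_of_mem : ∀ w ∈ segment ℝ ζ p, w ∈ K → w = ζ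

theorem IsSpike.ne {K : Set ℂ} {ζ p : ℂ} (h : IsSpike K ζ p) : ζ ≠ p := fun hh =>
  h.notMem (hh ▸ h.mem)

/-- The first point of a closed set on a segment. -/
theorem exists_first_mem_segment {S : Set ℂ} (hS : IsClosed S) {a b : ℂ}
    (h : (segment ℝ a b ∩ S).Nonempty) :
    ∃ q ∈ segment ℝ a b, q ∈ S ∧ ∀ w ∈ segment ℝ a q, w ∈ S → w = q := by
  have hc : IsCompact (segment ℝ a b ∩ S) := (isArc_segment a b).compact.inter_right hS
  obtain ⟨q, hq, hmin⟩ := hc.exists_isMinOn h (f := fun w => dist a w) (by fun_prop)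
  refine ⟨q, hq.1, hq.2, fun w hw hwS => ?_⟩
  have h1 : w ∈ segment ℝ a b := (convex_segment a b).segment_subset (left_mem_segment ℝ a b) hq.1 hw
  have h2 := hmin ⟨h1, hwS⟩
  have h3 := dist_add_dist_of_mem_segment hw
  have h4 : dist w q ≤ 0 := by
    simp only [mem_ofPred_eq] at h2
    linarith
  exact dist_le_zero.1 h4

theorem IsHull.exists_isSpike {K : Set ℂ} (hK : IsHull K) {κ p : ℂ} (hκ : κ ∈ K) (hp : p ∉ K) :
    ∃ ζ ∈ segment ℝ p κ, IsSpike K ζ p := by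
  obtain ⟨q, hq, hqK, hqf⟩ := exists_first_mem_segment hK.compact.isClosed
    ⟨κ, right_mem_segment ℝ p κ, hκ⟩
  exact ⟨q, hq, hqK, hp, fun w hw hwK => hqf w (segment_symm ℝ q p ▸ hw) hwK⟩

theorem IsHull.exists_isSpike_ne {K : Set ℂ} (hK : IsHull K) {p : ℂ} (hp : p ∉ K) (ζ : ℂ) :
    ∃ ζ' ≠ ζ, IsSpike K ζ' p := by
  have hp0 : p ≠ 0 := fun h => hp (h ▸ hK.zero_mem)
  obtain ⟨s, hs, hsK⟩ : ∃ s : ℝ, 0 < s ∧ (s : ℂ) * (Complex.I * p) ∈ K := by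
    have hc : ContinuousAt (fun s : ℝ => (s : ℂ) * (Complex.I * p)) 0 := by fun_prop
    have h1 : ∀ᶠ s : ℝ in 𝓝 0, (s : ℂ) * (Complex.I * p) ∈ K := by
      refine hc.eventually_mem ?_
      simpa using mem_interior_iff_mem_nhds.1 hK.zero
    obtain ⟨ε, hε, hb⟩ := Metric.eventually_nhds_iff.1 h1
    exact ⟨ε / 2, by positivity, hb (by rw [Real.dist_eq, sub_zero, abs_of_pos] <;> linarith)⟩
  obtain ⟨ζ₁, h₁, hζ₁⟩ := hK.exists_isSpike hK.zero_mem hp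
  obtain ⟨ζ₂, h₂, hζ₂⟩ := hK.exists_isSpike hsK hp
  by_cases h : ζ₁ = ζ
  · refine ⟨ζ₂, fun h' => ?_, hζ₂⟩
    have h3 : ζ₂ = ζ₁ := h'.trans h.symm
    rw [segment_eq_image'] at h₁ h₂
    obtain ⟨t, -, rfl⟩ := h₁
    obtain ⟨u, -, hu⟩ := h₂
    rw [← hu] at h3
    simp only [Complex.real_smul] at h3 hu
    have h4 : ((t : ℂ) - u + u * s * Complex.I) * p = 0 := by linear_combination h3
    have h5 := (mul_eq_zero.1 h4).resolve_right hp0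
    have h6 := congrArg Complex.im h5
    simp at h6
    have h7 := h6.resolve_right hs.ne'
    rw [h7] at hu
    exact hp (by have := hζ₂.mem; rw [← hu] at this; simpa using this)
  · exact ⟨ζ₁, h, hζ₁⟩

theorem norm_le_of_exp_eq_one_of_abs_im_lt {z : ℂ} (he : Complex.exp z = 1) {m : ℕ}
    (hz : |z.im| < 2 * Real.pi * (m + 1)) : ‖z‖ ≤ 2 * Real.pi * m := by
  obtain ⟨n, hn⟩ := Complex.exp_eq_one_iff.1 he
  have hpi := Real.pi_pos
  have h1 : |z.im| = 2 * Real.pi * |(n : ℝ)| := by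
    rw [hn]
    simp [abs_mul, abs_of_pos hpi]
    ring
  have h2 : ‖z‖ = 2 * Real.pi * |(n : ℝ)| := by
    rw [hn, norm_mul, norm_two_pi_I, Complex.norm_intCast, mul_comm]
  rw [h1] at hz
  rw [h2]
  refine mul_le_mul_of_nonneg_left ?_ (by positivity)
  have h3 : |(n : ℝ)| < m + 1 := lt_of_mul_lt_mul_left hz (by positivity)
  have h4 : |n| < m + 1 := by exact_mod_cast h3
  have h5 : |n| ≤ m := by omega
  exact_mod_cast h5

/-- A curved spike and a straight one with the same tip and distinct roots. -/
theorem IsHull.linked_segLog_of_ne {K : Set ℂ} (hK : IsHull K) (φ : LogHomeo) {A B ζ' : ℂ}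
    (hA : φ.map A ∈ K) (hJ : ∀ w ∈ segment ℝ A B, φ.map w ∈ K → w = A)
    (hZ : IsSpike K ζ' (φ.map B)) (hne : φ.map A ≠ ζ') {m : ℕ}
    (hm : ∀ Q ∈ segment ℝ A B, Q ≠ A → |(φ.segLog Q B 0).im| < Real.pi + 2 * Real.pi * m) :
    Linked K (φ.map A) (φ.segLog A B) ζ' (segLog ζ' (φ.map B)) (fun _ => 0) (2 + m) := by
  have hJc := (φ.isArc A B).compact
  obtain ⟨q, hq, ⟨Q, hQ, rfl⟩, hfirst⟩ := exists_first_mem_segment (a := ζ') (b := φ.map B)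
    hJc.isClosed ⟨_, right_mem_segment ℝ _ _, B, right_mem_segment ℝ A B, rfl⟩
  have hQK : φ.map Q ∉ K := by
    intro hQK
    have h1 := hZ.eq_of_mem _ hq hQK
    rw [hJ Q hQ hQK] at h1
    exact hne h1
  have hQA : Q ≠ A := fun h => hQK (h ▸ hA)
  have hqζ : φ.map Q ≠ ζ' := fun h => hQK (h ▸ hZ.mem)
  have hsubJ : segment ℝ A Q ⊆ segment ℝ A B :=
    (convex_segment A B).segment_subset (left_mem_segment ℝ A B) hQ
  have hsubJ' : segment ℝ Q B ⊆ segment ℝ A B :=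
    (convex_segment A B).segment_subset hQ (right_mem_segment ℝ A B)
  have hsubZ : segment ℝ ζ' (φ.map Q) ⊆ segment ℝ ζ' (φ.map B) :=
    (convex_segment _ _).segment_subset (left_mem_segment ℝ _ _) hq
  have hsubZ' : segment ℝ (φ.map Q) (φ.map B) ⊆ segment ℝ ζ' (φ.map B) :=
    (convex_segment _ _).segment_subset hq (right_mem_segment ℝ _ _)
  obtain ⟨h, hh⟩ := hK.exists_endLog hA hZ.mem
  have hopenA : ∀ w ∈ openSegment ℝ A Q, w ≠ A := by
    rintro w hw rfl
    exact hQA (left_mem_openSegment_iff.1 hw).symm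
  have hopenQ : ∀ w ∈ openSegment ℝ A Q, w ≠ Q := by
    rintro w hw rfl
    exact hQA (right_mem_openSegment_iff.1 hw).symm
  have hopenζ : ∀ w ∈ openSegment ℝ (φ.map Q) ζ', w ≠ ζ' := by
    rintro w hw rfl
    exact hqζ (right_mem_openSegment_iff.1 hw)
  have hopenq : ∀ w ∈ openSegment ℝ (φ.map Q) ζ', w ≠ φ.map Q := by
    rintro w hw rfl
    exact hqζ (left_mem_openSegment_iff.1 hw)
  have hZseg : segment ℝ (φ.map Q) ζ' = segment ℝ ζ' (φ.map Q) := segment_symm ℝ _ _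
  have hmain := fun y hyK hyS => norm_endLog_sub_sum_le hK hA hZ.mem hh ![φ, LogHomeo.id]
    ![A, φ.map Q] ![Q, ζ'] ?_ ?_ ?_ ?_ (y := y) hyK hyS
  rotate_left
  · simp [Fin.forall_fin_two, hQA.symm, hqζ]
  · simp only [Fin.forall_fin_two, Matrix.cons_val_zero, Matrix.cons_val_one]
    constructor
    · rintro _ ⟨w, hw, rfl⟩ hwK
      exact hopenA w hw (hJ w (hsubJ (openSegment_subset_segment ℝ _ _ hw)) hwK)
    · rintro _ ⟨w, hw, rfl⟩ hwK
      refine hopenζ w hw (hZ.eq_of_mem w (hsubZ ?_) hwK)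
      exact hZseg ▸ openSegment_subset_segment ℝ _ _ hw
  · simp only [Fin.forall_fin_two, Matrix.cons_val_zero, Matrix.cons_val_one]
    refine ⟨⟨fun h => absurd rfl h, fun _ => ?_⟩, ⟨fun _ => ?_, fun h => absurd rfl h⟩⟩
    · rw [disjoint_left]
      rintro _ ⟨w, hw, rfl⟩ ⟨z, hz, hzw⟩
      refine hopenQ w hw (φ.map.injective (hfirst _ ?_
        ⟨w, hsubJ (openSegment_subset_segment ℝ _ _ hw), rfl⟩))
      rw [← hzw, ← hZseg]
      exact hz
    · rw [disjoint_left]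
      rintro _ ⟨w, hw, rfl⟩ ⟨z, hz, hzw⟩
      refine hopenq w hw (hfirst w (hZseg ▸ openSegment_subset_segment ℝ _ _ hw) ?_)
      exact ⟨z, hsubJ hz, hzw⟩
  · intro y hyK hyS
    simp only [mem_iUnion, Fin.exists_fin_two, Matrix.cons_val_zero, Matrix.cons_val_one,
      not_or] at hyS
    have hy1 : φ.map A - y ≠ 0 := fun hh => hyK (sub_eq_zero.1 hh ▸ hA)
    have hy2 : φ.map Q - y ≠ 0 := fun hh => hyS.1
      ⟨Q, right_mem_segment ℝ _ _, sub_eq_zero.1 hh⟩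
    simp only [Fin.sum_univ_two, Matrix.cons_val_zero, Matrix.cons_val_one]
    rw [Complex.exp_add, (φ.isArc A Q).exp_eq y hyS.1, (LogHomeo.id.isArc _ _).exp_eq y hyS.2]
    simp only [LogHomeo.id, Homeomorph.refl_apply, _root_.id]
    field_simp
  refine ⟨h, hh, ?_⟩
  have hloop := hK.eventually_sub_eq (φ.isArc Q B) (isArc_segment (φ.map Q) (φ.map B)) ?_ ?_
  rotate_left
  · rintro _ ⟨w, hw, rfl⟩ hwK
    have hwA := hJ w (hsubJ' hw) hwK
    subst hwA
    rcases eq_or_ne B w with hBw | hBw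
    · exact hZ.notMem (hBw ▸ hA)
    have h1 : dist w Q + dist Q B = dist w B := dist_add_dist_of_mem_segment hQ
    have h2 : dist Q w + dist w B = dist Q B := dist_add_dist_of_mem_segment hw
    have h3 : dist w Q = 0 := by
      have := dist_comm Q w
      linarith [dist_nonneg (x := w) (y := Q)]
    exact hQA (dist_eq_zero.1 h3).symm
  · intro w hw hwK
    have hwζ := hZ.eq_of_mem w (hsubZ' hw) hwK
    subst hwζ
    have h1 := dist_add_dist_of_mem_segment hq
    have h2 := dist_add_dist_of_mem_segment hw
    have h3 : dist w (φ.map Q) = 0 := by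
      have := dist_comm (φ.map Q) w
      linarith [dist_nonneg (x := w) (y := φ.map Q)]
    exact hqζ (dist_eq_zero.1 h3).symm
  have hloop0 : ‖φ.segLog Q B 0 - segLog (φ.map Q) (φ.map B) 0‖ ≤ 2 * Real.pi * m := by
    refine norm_le_of_exp_eq_one_of_abs_im_lt hloop.1 ?_
    have h1 := hm Q hQ hQA
    have h2 := abs_im_segLog_le (φ.map Q) (φ.map B) 0
    rw [Complex.sub_im]
    have h3 := abs_sub (φ.segLog Q B 0).im (segLog (φ.map Q) (φ.map B) 0).im
    linarith
  filter_upwards [eventually_endFilter_notMem, (φ.isArc A B).eventually_notMem,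
    (isArc_segment ζ' (φ.map B)).eventually_notMem,
    eventually_endFilter_of_nhdsSet hloop.2] with y hyK hyJ hyZ hyloop
  have hyS : y ∉ ⋃ i, ((![φ, LogHomeo.id] : Fin 2 → LogHomeo) i).map ''
      segment ℝ ((![A, φ.map Q] : Fin 2 → ℂ) i) ((![Q, ζ'] : Fin 2 → ℂ) i) := by
    simp only [mem_iUnion, Fin.exists_fin_two, Matrix.cons_val_zero, Matrix.cons_val_one]
    rintro (hyS | ⟨w, hw, rfl⟩)
    · exact hyJ (image_mono hsubJ hyS)
    · exact hyZ (hsubZ (hZseg ▸ hw))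
  have h1 := hmain y hyK hyS
  simp only [Fin.sum_univ_two, Matrix.cons_val_zero, Matrix.cons_val_one, LogHomeo.id_segLog,
    Fintype.card_fin] at h1
  have hyZ' : y ∉ segment ℝ ζ' (φ.map Q) := fun hh => hyZ (hsubZ hh)
  rw [segLog_swap hyZ'] at h1
  rw [φ.segLog_add hQ hyJ, segLog_add hq hyZ]
  calc _ = ‖(h y - (φ.segLog A Q y + -segLog ζ' (φ.map Q) y)) -
        (φ.segLog Q B y - segLog (φ.map Q) (φ.map B) y)‖ := by congr 1; ring
    _ ≤ _ := norm_sub_le _ _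
    _ ≤ 2 * Real.pi * (2 : ℕ) + 2 * Real.pi * m := add_le_add h1 (hyloop ▸ hloop0)
    _ = _ := by push_cast; ring

/-- Two straight spikes with the same tip. -/
theorem IsHull.linked_isSpike {K : Set ℂ} (hK : IsHull K) {ζ ζ' p : ℂ} (h : IsSpike K ζ p)
    (h' : IsSpike K ζ' p) : Linked K ζ (segLog ζ p) ζ' (segLog ζ' p) (fun _ => 0) 2 := by
  rcases eq_or_ne ζ ζ' with rfl | hne
  · exact (Linked.refl h.mem _).mono (by norm_num)
  have h1 := hK.linked_segLog_of_ne LogHomeo.id (A := ζ) (B := p) (ζ' := ζ') h.mem h.eq_of_mem h'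
    hne (m := 0) ?_
  · rw [LogHomeo.id_segLog] at h1
    exact h1.mono (by norm_num)
  · intro Q hQ hQζ
    rw [LogHomeo.id_segLog]
    have h0 : (0 : ℂ) ∉ segment ℝ Q p := by
      intro h0
      have h2 : (0 : ℂ) ∈ segment ℝ ζ p :=
        (convex_segment ζ p).segment_subset hQ (right_mem_segment ℝ ζ p) h0
      have h3 := h.eq_of_mem 0 h2 hK.zero_mem
      rw [← h3] at hQ
      have h4 := dist_add_dist_of_mem_segment hQ
      have h5 := dist_add_dist_of_mem_segment h0
      have h6 : dist 0 Q = 0 := by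
        have := dist_comm Q 0
        linarith [dist_nonneg (x := (0 : ℂ)) (y := Q)]
      exact hQζ (by rw [← h3, dist_eq_zero.1 h6])
    simpa using abs_im_segLog_lt h0

/-- A curved spike and a straight one with the same tip. -/
theorem IsHull.linked_segLog {K : Set ℂ} (hK : IsHull K) (φ : LogHomeo) {A B ζ' : ℂ}
    (hA : φ.map A ∈ K) (hJ : ∀ w ∈ segment ℝ A B, φ.map w ∈ K → w = A)
    (hZ : IsSpike K ζ' (φ.map B)) {m : ℕ}
    (hm : ∀ Q ∈ segment ℝ A B, Q ≠ A → |(φ.segLog Q B 0).im| < Real.pi + 2 * Real.pi * m) :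
    Linked K (φ.map A) (φ.segLog A B) ζ' (segLog ζ' (φ.map B)) (fun _ => 0) (4 + m) := by
  obtain ⟨ζ'', hne, hζ''⟩ := hK.exists_isSpike_ne hZ.notMem (φ.map A)
  exact ((hK.linked_segLog_of_ne φ hA hJ hζ'' hne.symm hm).trans' hζ''.mem
    (hK.linked_isSpike hζ'' hZ)).mono (by linarith)

theorem Linked.symm {K : Set ℂ} {ζ ζ' : ℂ} {X X' Γ : ℂ → ℂ} {c : ℝ}
    (h : Linked K ζ X ζ' X' Γ c) : Linked K ζ' X' ζ X (fun y => -Γ y) c := by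
  obtain ⟨f, hf, hfc⟩ := h
  refine ⟨_, hf.symm, hfc.mono fun y hy => ?_⟩
  rw [← norm_neg]
  refine le_trans (le_of_eq ?_) hy
  congr 1
  ring

theorem Linked.congr {K : Set ℂ} {ζ ζ' : ℂ} {X X' Γ Γ' : ℂ → ℂ} {c : ℝ}
    (h : Linked K ζ X ζ' X' Γ c) (hΓ : ∀ᶠ y in endFilter K, Γ y = Γ' y) :
    Linked K ζ X ζ' X' Γ' c := by
  obtain ⟨f, hf, hfc⟩ := h
  refine ⟨f, hf, ?_⟩
  filter_upwards [hfc, hΓ] with y hy hy'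
  rwa [← hy']

theorem exists_smul_of_mem_segment {τ : ℝ} (hτ : τ ≤ 1) {p w : ℂ}
    (hw : w ∈ segment ℝ ((τ : ℂ) * p) p) : ∃ x : ℝ, τ ≤ x ∧ x ≤ 1 ∧ w = x * p := by
  obtain ⟨a, b, ha, hb, hab, rfl⟩ := hw
  refine ⟨a * τ + b, by nlinarith, by nlinarith, ?_⟩
  simp only [Complex.real_smul]
  push_cast
  ring

theorem exists_smul_of_mem_openSegment {τ : ℝ} (hτ : τ < 1) {p w : ℂ}
    (hw : w ∈ openSegment ℝ ((τ : ℂ) * p) p) : ∃ x : ℝ, τ < x ∧ x < 1 ∧ w = x * p := by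
  obtain ⟨a, b, ha, hb, hab, rfl⟩ := hw
  refine ⟨a * τ + b, by nlinarith, by nlinarith, ?_⟩
  simp only [Complex.real_smul]
  push_cast
  ring

theorem smul_mem_segment {τ x t : ℝ} (h1 : τ ≤ x) (h2 : x ≤ t) (p : ℂ) :
    (x : ℂ) * p ∈ segment ℝ ((τ : ℂ) * p) ((t : ℂ) * p) := by
  have h3 : x ∈ segment ℝ τ t := by rw [segment_eq_Icc (h1.trans h2)]; exact ⟨h1, h2⟩
  obtain ⟨a, b, ha, hb, hab, rfl⟩ := h3
  refine ⟨a, b, ha, hb, hab, ?_⟩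
  simp only [Complex.real_smul, smul_eq_mul]
  push_cast
  ring

/-- A straight spike directed towards the origin. -/
structure IsRadial (K : Set ℂ) (ζ p : ℂ) : Prop extends IsSpike K ζ p where
  exists_eq : ∃ τ : ℝ, τ ≤ 1 ∧ ζ = τ * p

theorem IsHull.exists_isRadial {K : Set ℂ} (hK : IsHull K) {p : ℂ} (hp : p ∉ K) :
    ∃ ζ, IsRadial K ζ p := by
  obtain ⟨ζ, hζ, h⟩ := hK.exists_isSpike hK.zero_mem hp
  obtain ⟨a, b, ha, hb, hab, rfl⟩ := hζ
  exact ⟨_, h, a, by linarith, by simp⟩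

theorem IsRadial.ne_zero {K : Set ℂ} (hK : IsHull K) {ζ p : ℂ} (h : IsRadial K ζ p) : ζ ≠ 0 := by
  rintro rfl
  have hp0 : p ≠ 0 := fun h' => h.notMem (h' ▸ h.mem)
  have hc : ContinuousAt (fun s : ℝ => (s : ℂ) * p) 0 := by fun_prop
  have h1 : ∀ᶠ s : ℝ in 𝓝 0, (s : ℂ) * p ∈ K := by
    refine hc.eventually_mem ?_
    simpa using mem_interior_iff_mem_nhds.1 hK.zero
  obtain ⟨ε, hε, hb⟩ := Metric.eventually_nhds_iff.1 h1
  have hs : 0 < min (ε / 2) 1 := by positivity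
  have h2 := hb (y := min (ε / 2) 1) (by
    rw [Real.dist_eq, sub_zero, abs_of_pos hs]
    exact (min_le_left _ _).trans_lt (by linarith))
  have h3 := h.eq_of_mem _ (by
    have := smul_mem_segment hs.le (min_le_right (ε / 2) 1) p
    simpa using this) h2
  rcases mul_eq_zero.1 h3 with h4 | h4
  · have : min (ε / 2) 1 = 0 := by exact_mod_cast h4
    linarith
  · exact hp0 h4

theorem IsHull.linked_chord_of_linearIndependent {K : Set ℂ} (hK : IsHull K) {ζ ζ' p p' : ℂ}
    (h : IsRadial K ζ p) (h' : IsRadial K ζ' p') (hc : segment ℝ p p' ⊆ Kᶜ)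
    (hli : ∀ x y : ℝ, (x : ℂ) * p + y * p' = 0 → x = 0 ∧ y = 0) :
    Linked K ζ (segLog ζ p) ζ' (segLog ζ' p') (segLog p p') 3 := by
  have hζ0 := h.ne_zero hK
  have hζ0' := h'.ne_zero hK
  obtain ⟨τ, hτ, hζ⟩ := h.exists_eq
  obtain ⟨τ', hτ', hζ'⟩ := h'.exists_eq
  have hτ1 : τ < 1 := lt_of_le_of_ne hτ fun hh => h.ne (by rw [hζ, hh]; simp)
  have hτ1' : τ' < 1 := lt_of_le_of_ne hτ' fun hh => h'.ne (by rw [hζ', hh]; simp)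
  have huniq : ∀ x y x' y' : ℝ, (x : ℂ) * p + y * p' = x' * p + y' * p' → x = x' ∧ y = y' := by
    intro x y x' y' hh
    obtain ⟨h1, h2⟩ := hli (x - x') (y - y') (by push_cast; linear_combination hh)
    exact ⟨by linarith, by linarith⟩
  have hpp : p ≠ p' := fun hh => by
    have := (huniq 1 0 0 1 (by simp [hh])).1
    norm_num at this
  have hs1 : ∀ w ∈ segment ℝ ζ p, ∃ x : ℝ, τ ≤ x ∧ x ≤ 1 ∧ w = x * p := by
    rw [hζ]; exact fun w hw => exists_smul_of_mem_segment hτ hw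
  have ho1 : ∀ w ∈ openSegment ℝ ζ p, ∃ x : ℝ, τ < x ∧ x < 1 ∧ w = x * p := by
    rw [hζ]; exact fun w hw => exists_smul_of_mem_openSegment hτ1 hw
  have hs3 : ∀ w ∈ segment ℝ p' ζ', ∃ x : ℝ, τ' ≤ x ∧ x ≤ 1 ∧ w = x * p' := by
    rw [hζ', segment_symm]; exact fun w hw => exists_smul_of_mem_segment hτ' hw
  have ho3 : ∀ w ∈ openSegment ℝ p' ζ', ∃ x : ℝ, τ' < x ∧ x < 1 ∧ w = x * p' := by
    rw [hζ', openSegment_symm]; exact fun w hw => exists_smul_of_mem_openSegment hτ1' hw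
  have hs2 : ∀ w ∈ segment ℝ p p', ∃ a b : ℝ, a + b = 1 ∧ w = a * p + b * p' := by
    rintro w ⟨a, b, -, -, hab, rfl⟩
    exact ⟨a, b, hab, by simp⟩
  have ho2 : ∀ w ∈ openSegment ℝ p p', ∃ a b : ℝ, 0 < a ∧ 0 < b ∧ w = a * p + b * p' := by
    rintro w ⟨a, b, ha, hb, hab, rfl⟩
    exact ⟨a, b, ha, hb, by simp⟩
  have h12 : ∀ w ∈ openSegment ℝ ζ p, w ∉ segment ℝ p p' := by
    intro w hw hw'
    obtain ⟨x, hx, hx1, rfl⟩ := ho1 w hw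
    obtain ⟨a, b, hab, hh⟩ := hs2 _ hw'
    obtain ⟨h1, h2⟩ := huniq x 0 a b (by rw [← hh]; simp)
    linarith
  have h13 : ∀ w ∈ segment ℝ ζ p, w ∉ segment ℝ p' ζ' := by
    intro w hw hw'
    obtain ⟨x, hx, hx1, rfl⟩ := hs1 w hw
    obtain ⟨x', hx', hx1', hh⟩ := hs3 _ hw'
    obtain ⟨h1, h2⟩ := huniq x 0 0 x' (by rw [hh]; simp)
    rw [h1, Complex.ofReal_zero, zero_mul] at hw
    exact hζ0 (h.eq_of_mem 0 hw hK.zero_mem).symm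
  have h21 : ∀ w ∈ openSegment ℝ p p', w ∉ segment ℝ ζ p := by
    intro w hw hw'
    obtain ⟨a, b, ha, hb, rfl⟩ := ho2 w hw
    obtain ⟨x, -, -, hh⟩ := hs1 _ hw'
    obtain ⟨h1, h2⟩ := huniq a b x 0 (by rw [hh]; simp)
    linarith
  have h23 : ∀ w ∈ openSegment ℝ p p', w ∉ segment ℝ p' ζ' := by
    intro w hw hw'
    obtain ⟨a, b, ha, hb, rfl⟩ := ho2 w hw
    obtain ⟨x, -, -, hh⟩ := hs3 _ hw'
    obtain ⟨h1, h2⟩ := huniq a b 0 x (by rw [hh]; simp)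
    linarith
  have h32 : ∀ w ∈ openSegment ℝ p' ζ', w ∉ segment ℝ p p' := by
    intro w hw hw'
    obtain ⟨x, hx, hx1, rfl⟩ := ho3 w hw
    obtain ⟨a, b, hab, hh⟩ := hs2 _ hw'
    obtain ⟨h1, h2⟩ := huniq 0 x a b (by rw [← hh]; simp)
    linarith
  obtain ⟨f, hf⟩ := hK.exists_endLog h.mem h'.mem
  have himg : ∀ s : Set ℂ, LogHomeo.id.map '' s = s := fun s => by
    simp [LogHomeo.id]
  refine ⟨f, hf, ?_⟩
  filter_upwards [eventually_endFilter_notMem, (isArc_segment ζ p).eventually_notMem,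
    (isArc_segment p p').eventually_notMem, (isArc_segment p' ζ').eventually_notMem]
    with y hyK hy1 hy2 hy3
  have hmain := norm_endLog_sub_sum_le hK h.mem h'.mem hf (fun _ : Fin 3 => LogHomeo.id)
    ![ζ, p, p'] ![p, p', ζ'] ?_ ?_ ?_ ?_ (y := y) hyK ?_
  · simp only [Fin.sum_univ_three, Matrix.cons_val_zero, Matrix.cons_val_one, Matrix.cons_val,
      LogHomeo.id_segLog, Fintype.card_fin] at hmain
    rw [segLog_swap (A := ζ') (B := p') (by rwa [segment_symm] at hy3)] at hmain
    refine le_trans (le_of_eq ?_) (hmain.trans (by norm_num))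
    congr 1
  · simp [Fin.forall_fin_succ, h.ne, h'.ne.symm, hpp]
  · simp only [Fin.forall_fin_succ, himg, Matrix.cons_val_zero, Matrix.cons_val_one,
      Matrix.cons_val, Fin.succ_zero_eq_one, Fin.succ_one_eq_two, IsEmpty.forall_iff, and_true]
    refine ⟨fun w hw hwK => ?_, fun w hw => hc (openSegment_subset_segment ℝ _ _ hw),
      fun w hw hwK => ?_⟩
    · have := h.eq_of_mem w (openSegment_subset_segment ℝ _ _ hw) hwK
      subst this
      exact h.ne (left_mem_openSegment_iff.1 hw)
    · have := h'.eq_of_mem w (segment_symm ℝ p' ζ' ▸ openSegment_subset_segment ℝ _ _ hw) hwK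
      subst this
      exact h'.ne.symm (right_mem_openSegment_iff.1 hw)
  · simp only [himg, disjoint_left]
    have ho := openSegment_subset_segment (𝕜 := ℝ) (E := ℂ)
    intro i j hij w hw hw'
    fin_cases i <;> fin_cases j <;> simp at hij hw hw'
    · exact h12 w hw hw'
    · exact h13 w (ho _ _ hw) hw'
    · exact h21 w hw hw'
    · exact h23 w hw hw'
    · exact h13 w hw' (ho _ _ hw)
    · exact h32 w hw hw'
  · intro y hyK hyS
    simp only [himg, mem_iUnion, Fin.exists_fin_succ, Matrix.cons_val_zero, Matrix.cons_val_one,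
      Matrix.cons_val, Fin.succ_zero_eq_one, Fin.succ_one_eq_two, not_or, not_exists] at hyS
    have hy1 : ζ - y ≠ 0 := fun hh => hyK (sub_eq_zero.1 hh ▸ h.mem)
    have hy2 : p - y ≠ 0 := fun hh => hyS.1 (sub_eq_zero.1 hh ▸ right_mem_segment ℝ _ _)
    have hy3 : p' - y ≠ 0 := fun hh => hyS.2.1 (sub_eq_zero.1 hh ▸ right_mem_segment ℝ _ _)
    simp only [Fin.sum_univ_three, Matrix.cons_val_zero, Matrix.cons_val_one, Matrix.cons_val,
      LogHomeo.id_segLog]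
    rw [Complex.exp_add, Complex.exp_add, (isArc_segment ζ p).exp_eq y hyS.1,
      (isArc_segment p p').exp_eq y hyS.2.1, (isArc_segment p' ζ').exp_eq y hyS.2.2.1]
    field_simp
  · simp only [himg, mem_iUnion, Fin.exists_fin_succ, Matrix.cons_val_zero, Matrix.cons_val_one,
      Matrix.cons_val, Fin.succ_zero_eq_one, Fin.succ_one_eq_two]
    rintro (h1 | h1 | h1 | ⟨i, -⟩)
    · exact hy1 h1
    · exact hy2 h1
    · exact hy3 h1
    · exact i.elim0

theorem IsHull.linked_chord_of_smul {K : Set ℂ} {ζ ζ' p p' : ℂ}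
    (h : IsRadial K ζ p) (h' : IsRadial K ζ' p') (hc : segment ℝ p p' ⊆ Kᶜ) {t : ℝ} (ht : 1 ≤ t)
    (hp : p' = t * p) : Linked K ζ (segLog ζ p) ζ' (segLog ζ' p') (segLog p p') 0 := by
  obtain ⟨τ, hτ, hζ⟩ := h.exists_eq
  obtain ⟨τ', hτ', hζ'⟩ := h'.exists_eq
  have hζ'' : ζ' = ((τ' * t : ℝ) : ℂ) * p := by rw [hζ', hp]; push_cast; ring
  have hp1 : p = ((1 : ℝ) : ℂ) * p := by simp
  have heq : ζ = ζ' := by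
    rcases le_or_gt (τ' * t) τ with h1 | h1
    · refine h'.eq_of_mem ζ ?_ h.mem
      rw [hζ'', hp, hζ]
      exact smul_mem_segment h1 (hτ.trans ht) p
    · rcases le_or_gt (τ' * t) 1 with h2 | h2
      · refine (h.eq_of_mem ζ' ?_ h'.mem).symm
        have := smul_mem_segment h1.le h2 p
        rwa [← hp1, ← hζ, ← hζ''] at this
      · exfalso
        refine hc ?_ h'.mem
        have := smul_mem_segment h2.le (by nlinarith : τ' * t ≤ t) p
        rwa [← hp1, ← hp, ← hζ''] at this
  subst heq
  refine ⟨_, IsEndLog.refl h.mem, ?_⟩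
  filter_upwards [(isArc_segment ζ p').eventually_notMem] with y hy
  have hmem : p ∈ segment ℝ ζ p' := by
    have := smul_mem_segment hτ ht p
    rwa [← hp1, ← hp, ← hζ] at this
  rw [segLog_add hmem hy]
  simp

/-- Radial spikes whose tips are joined by a segment off the hull. -/
theorem IsHull.linked_chord {K : Set ℂ} (hK : IsHull K) {ζ ζ' p p' : ℂ}
    (h : IsRadial K ζ p) (h' : IsRadial K ζ' p') (hc : segment ℝ p p' ⊆ Kᶜ) :
    Linked K ζ (segLog ζ p) ζ' (segLog ζ' p') (segLog p p') 3 := by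
  have hp0 : p ≠ 0 := fun hh => h.notMem (hh ▸ hK.zero_mem)
  have hp0' : p' ≠ 0 := fun hh => h'.notMem (hh ▸ hK.zero_mem)
  by_cases hli : ∀ x y : ℝ, (x : ℂ) * p + y * p' = 0 → x = 0 ∧ y = 0
  · exact hK.linked_chord_of_linearIndependent h h' hc hli
  push Not at hli
  obtain ⟨x, y, hxy, hne⟩ := hli
  have hy : y ≠ 0 := by
    rintro rfl
    refine hne ?_ rfl
    have : (x : ℂ) * p = 0 := by simpa using hxy
    exact_mod_cast (mul_eq_zero.1 this).resolve_right hp0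
  set t : ℝ := -x / y with ht
  have hpt : p' = t * p := by
    have : (y : ℂ) ≠ 0 := by exact_mod_cast hy
    rw [ht]
    push_cast
    field_simp
    linear_combination hxy
  have ht0 : 0 < t := by
    by_contra! ht0
    refine hc ?_ hK.zero_mem
    rw [segment_symm]
    have := smul_mem_segment ht0 zero_le_one p
    simpa [← hpt] using this
  rcases le_or_gt 1 t with h1 | h1
  · exact (IsHull.linked_chord_of_smul h h' hc h1 hpt).mono (by norm_num)
  · have hpt' : p = (t⁻¹ : ℝ) * p' := by
      have : (t : ℂ) ≠ 0 := by exact_mod_cast ht0.ne'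
      rw [hpt]
      push_cast
      field_simp
    have h2 := (IsHull.linked_chord_of_smul h' h (segment_symm ℝ p p' ▸ hc)
      ((one_le_inv₀ ht0).2 h1.le) hpt').symm
    refine (h2.congr ?_).mono (by norm_num)
    filter_upwards [(isArc_segment p p').eventually_notMem] with y hy
    rw [segLog_swap hy, neg_neg]

/-- Two points joined by a polygonal line with `n` edges contained in `U`. -/
def PolyReach (U : Set ℂ) : ℕ → ℂ → ℂ → Prop
  | 0, p, q => p = q
  | n + 1, p, q => ∃ r, PolyReach U n p r ∧ segment ℝ r q ⊆ U

theorem IsHull.linked_of_polyReach {K : Set ℂ} (hK : IsHull K) {ζ p : ℂ} (h : IsRadial K ζ p)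
    {n : ℕ} {q ζ' : ℂ} (hr : PolyReach Kᶜ n p q) (h' : IsRadial K ζ' q) :
    ∃ T Γ, IsArc T p q Γ ∧ T ⊆ Kᶜ ∧ |(Γ 0).im| ≤ Real.pi * n ∧
      Linked K ζ (segLog ζ p) ζ' (segLog ζ' q) Γ (3 * n + 2) := by
  induction n generalizing q ζ' with
  | zero =>
    obtain rfl : p = q := hr
    have hp0 : p ≠ 0 := fun hh => h.notMem (hh ▸ hK.zero_mem)
    refine ⟨_, _, isArc_segment p p, ?_, ?_, ?_⟩
    · rw [segment_same, singleton_subset_iff]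
      exact h.notMem
    · simp [segLog, div_self hp0]
    · refine ((hK.linked_isSpike h.toIsSpike h'.toIsSpike).congr ?_).mono (by simp)
      filter_upwards [(isArc_segment p p).eventually_notMem] with y hy
      have : p - y ≠ 0 := fun hh => hy (by rw [sub_eq_zero.1 hh]; exact left_mem_segment ℝ y y)
      simp [segLog, div_self this]
  | succ n ih =>
    obtain ⟨r, hr, hseg⟩ := hr
    obtain ⟨ζr, hζr⟩ := hK.exists_isRadial (hseg (left_mem_segment ℝ r q))
    obtain ⟨T, Γ, hT, hTK, hΓ, hl⟩ := ih hr hζr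
    refine ⟨_, _, hT.trans (isArc_segment r q), union_subset hTK hseg, ?_, ?_⟩
    · rw [Complex.add_im]
      have h1 := abs_add_le (Γ 0).im (segLog r q 0).im
      have h2 := abs_im_segLog_le r q 0
      push_cast
      linarith
    · refine (hl.trans hζr.mem (hK.linked_chord hζr h' hseg)).mono ?_
      push_cast
      linarith

/-- Composition of `LogHomeo`s. -/
def LogHomeo.comp (ψ φ : LogHomeo) : LogHomeo where
  map := φ.map.trans ψ.map
  quot := fun u v => ψ.quot (φ.map u) (φ.map v) + φ.quot u v
  map_zero := by simp [φ.map_zero, ψ.map_zero]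
  cont := fun u v h => by
    refine ContinuousAt.add ?_ (φ.cont u v h)
    exact ContinuousAt.comp (g := fun p : ℂ × ℂ => ψ.quot p.1 p.2)
      (f := fun p : ℂ × ℂ => (φ.map p.1, φ.map p.2))
      (ψ.cont _ _ fun hh => h (φ.map.injective hh)) (by fun_prop)
  exp_quot := fun u v h => by
    have h1 : φ.map u ≠ φ.map v := fun hh => h (φ.map.injective hh)
    have h2 := sub_ne_zero.2 h1
    rw [Complex.exp_add, ψ.exp_quot _ _ h1, φ.exp_quot _ _ h]
    simp only [Homeomorph.trans_apply]
    field_simp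
  lim := fun a b => by
    have h1 : Tendsto φ.map (cobounded ℂ) (cobounded ℂ) := by
      rw [Metric.cobounded_eq_cocompact]
      exact φ.map.isClosedEmbedding.tendsto_cocompact
    have h2 := ((ψ.lim (φ.map a) (φ.map b)).comp h1).add (φ.lim a b)
    rw [add_zero] at h2
    refine h2.congr fun y => ?_
    simp only [Function.comp_apply]
    ring

theorem LogHomeo.comp_push (ψ φ : LogHomeo) (a b : ℂ) (L : ℂ → ℂ) :
    (ψ.comp φ).push a b L = ψ.push (φ.map a) (φ.map b) (φ.push a b L) := by
  ext y
  simp [LogHomeo.push, LogHomeo.comp]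
  ring

/-- Iterates of a `LogHomeo`. -/
def LogHomeo.iter (g : LogHomeo) : ℕ → LogHomeo
  | 0 => LogHomeo.id
  | k + 1 => g.comp (g.iter k)

theorem LogHomeo.id_push (a b : ℂ) (L : ℂ → ℂ) : LogHomeo.id.push a b L = L := by
  ext y
  simp [LogHomeo.push, LogHomeo.id]

theorem LogHomeo.push_zero (φ : LogHomeo) (a b : ℂ) (L : ℂ → ℂ) :
    φ.push a b L 0 = L 0 + (φ.quot b 0 - φ.quot a 0) := by
  have h : φ.map.symm 0 = 0 := by rw [Homeomorph.symm_apply_eq, φ.map_zero]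
  rw [LogHomeo.push, h]

theorem LogHomeo.iter_apply (g : LogHomeo) {p : ℕ → ℂ} (hp : ∀ j, p (j + 1) = g.map (p j)) (k : ℕ) :
    (g.iter k).map (p 0) = p k := by
  induction k with
  | zero => simp [LogHomeo.iter, LogHomeo.id]
  | succ k ih => rw [hp, ← ih]; simp [LogHomeo.iter, LogHomeo.comp]

theorem LogHomeo.iter_image (g : LogHomeo) {K : ℕ → Set ℂ}
    (hK : ∀ j, g.map '' K j = K (j + 1)) (k : ℕ) : (g.iter k).map '' K 0 = K k := by
  induction k with
  | zero => simp [LogHomeo.iter, LogHomeo.id]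
  | succ k ih =>
    rw [← hK, ← ih, image_image]
    rfl

theorem linked_iter {g : LogHomeo} {K : ℕ → Set ℂ} (hK : ∀ j, g.map '' K j = K (j + 1))
    {p ζ : ℕ → ℂ} (hp : ∀ j, p (j + 1) = g.map (p j)) (hζ : ∀ j, ζ j ∈ K j) {b : ℕ → ℝ}
    (hb : ∀ j, Linked (K (j + 1)) (g.map (ζ j)) (g.segLog (ζ j) (p j)) (ζ (j + 1))
      (_root_.segLog (ζ (j + 1)) (p (j + 1))) (fun _ => 0) (b j)) (k : ℕ) :
    Linked (K k) ((g.iter k).map (ζ 0)) ((g.iter k).segLog (ζ 0) (p 0)) (ζ k)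
      (segLog (ζ k) (p k)) (fun _ => 0) (∑ j ∈ Finset.range k, b j) := by
  induction k with
  | zero =>
    rw [Finset.sum_range_zero]
    change Linked _ _ (LogHomeo.id.push _ _ _) _ _ _ _
    rw [LogHomeo.id_push]
    exact Linked.refl (hζ 0) (_root_.segLog (ζ 0) (p 0))
  | succ k ih =>
    have hmem : (g.iter k).map (ζ 0) ∈ K k := g.iter_image hK k ▸ mem_image_of_mem _ (hζ 0)
    have h1 := ih.push' hmem (hζ k) g (p k)
    rw [hK] at h1
    have h2 := h1.trans' (hK k ▸ mem_image_of_mem _ (hζ k)) (hb k)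
    rw [Finset.sum_range_succ]
    rw [← g.iter_apply hp k, LogHomeo.segLog, ← LogHomeo.comp_push] at h2
    exact h2

theorem Linked.eventually_norm_sub_le {K : Set ℂ} (hK : IsHull K) {ζ ζ' : ℂ} (hζ : ζ ∈ K)
    (hζ' : ζ' ∈ K) {X X' Γ Γ' : ℂ → ℂ} {c c' : ℝ} (h : Linked K ζ X ζ' X' Γ c)
    (h' : Linked K ζ X ζ' X' Γ' c') :
    ∀ᶠ y in endFilter K, ‖Γ y - Γ' y‖ ≤ 2 * Real.pi * (c + c') := by
  obtain ⟨f, hf, hfc⟩ := h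
  obtain ⟨f', hf', hfc'⟩ := h'
  filter_upwards [hfc, hfc', eventually_endFilter_notMem] with y hy hy' hyK
  rw [hf.unique hK hζ hζ' hf' y hyK] at hy
  calc ‖Γ y - Γ' y‖ = ‖(f' y - (X y + Γ' y - X' y)) - (f' y - (X y + Γ y - X' y))‖ := by
        congr 1; ring
    _ ≤ _ := norm_sub_le _ _
    _ ≤ _ := by rw [mul_add, add_comm]; exact add_le_add hy hy'

theorem IsHull.norm_sub_le_of_linked {K T T' : Set ℂ} (hK : IsHull K) {ζ ζ' p p' : ℂ} (hζ : ζ ∈ K)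
    (hζ' : ζ' ∈ K) {X X' Γ Γ' : ℂ → ℂ} {c c' : ℝ} (h : Linked K ζ X ζ' X' Γ c)
    (h' : Linked K ζ X ζ' X' Γ' c') (hT : IsArc T p p' Γ) (hT' : IsArc T' p p' Γ')
    (hTK : T ⊆ Kᶜ) (hTK' : T' ⊆ Kᶜ) : ‖Γ 0 - Γ' 0‖ ≤ 2 * Real.pi * (c + c') := by
  have := hK.neBot_endFilter
  obtain ⟨y, hy1, hy2⟩ := ((h.eventually_norm_sub_le hK hζ hζ' h').and
    (eventually_endFilter_of_nhdsSet (hK.eventually_sub_eq hT hT' hTK hTK').2)).exists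
  rwa [← hy2]

theorem norm_iter_quot_sub_le {g : LogHomeo} {K : ℕ → Set ℂ} (hH : ∀ j, IsHull (K j))
    (hK : ∀ j, g.map '' K j = K (j + 1)) {p q ζ η : ℕ → ℂ} (hp : ∀ j, p (j + 1) = g.map (p j))
    (hq : ∀ j, q (j + 1) = g.map (q j)) (hζ : ∀ j, IsRadial (K j) (ζ j) (p j))
    (hη : ∀ j, IsRadial (K j) (η j) (q j)) {b b' : ℕ → ℝ}
    (hb : ∀ j, Linked (K (j + 1)) (g.map (ζ j)) (g.segLog (ζ j) (p j)) (ζ (j + 1))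
      (_root_.segLog (ζ (j + 1)) (p (j + 1))) (fun _ => 0) (b j))
    (hb' : ∀ j, Linked (K (j + 1)) (g.map (η j)) (g.segLog (η j) (q j)) (η (j + 1))
      (_root_.segLog (η (j + 1)) (q (j + 1))) (fun _ => 0) (b' j)) {E E' k : ℕ}
    (hE : PolyReach (K 0)ᶜ E (p 0) (q 0)) (hE' : PolyReach (K k)ᶜ E' (p k) (q k)) :
    |((g.iter k).quot (q 0) 0 - (g.iter k).quot (p 0) 0).im| ≤
      2 * Real.pi * ((∑ j ∈ Finset.range k, b j) + (∑ j ∈ Finset.range k, b' j)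
        + 3 * E + 3 * E' + 4) + Real.pi * (E + E') := by
  obtain ⟨T, Γ, hT, hTK, hΓ, hl⟩ := (hH 0).linked_of_polyReach (hζ 0) hE (hη 0)
  obtain ⟨T', Γ', hT', hTK', hΓ', hl'⟩ := (hH k).linked_of_polyReach (hζ k) hE' (hη k)
  have himg := g.iter_image hK k
  have hζk : (g.iter k).map (ζ 0) ∈ K k := himg ▸ mem_image_of_mem _ (hζ 0).mem
  have hηk : (g.iter k).map (η 0) ∈ K k := himg ▸ mem_image_of_mem _ (hη 0).mem
  have h1 := linked_iter hK hp (fun j => (hζ j).mem) hb k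
  have h2 := linked_iter hK hq (fun j => (hη j).mem) hb' k
  have h3 := ((h1.trans (hζ k).mem hl').trans (hη k).mem h2.symm)
  have h4 := hl.push (hζ 0).mem (hη 0).mem (g.iter k) (p 0) (q 0)
  rw [himg] at h4
  have hT2 := hT.push (g.iter k)
  rw [g.iter_apply hp, g.iter_apply hq] at hT2
  have hT2K : (g.iter k).map '' T ⊆ (K k)ᶜ := by
    rw [← himg, ← image_compl_eq (g.iter k).map.bijective]
    exact image_mono hTK
  have h5 := (hH k).norm_sub_le_of_linked hζk hηk h4 (h3.congr (Γ' := Γ') (.of_forall fun y => by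
    simp)) hT2 hT' hT2K hTK'
  rw [LogHomeo.push_zero] at h5
  have h6 := (Complex.abs_im_le_norm _).trans h5
  simp only [Complex.sub_im, Complex.add_im] at h6 ⊢
  rw [abs_le] at *
  have hpi := Real.pi_pos
  constructor <;> nlinarith [h6.1, h6.2, hΓ.1, hΓ.2, hΓ'.1, hΓ'.2]

/-- Quantitative control of a `LogHomeo` as seen from the origin. -/
structure LogHomeo.Bound (g : LogHomeo) (r : ℝ) (m : ℕ) : Prop where
  far : ∀ Q p : ℂ, Q ≠ 0 → p ≠ 0 → |(g.quot p 0 - g.quot Q 0).im| < 2 * Real.pi * m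
  near : ∀ Q p : ℂ, Q ≠ 0 → p ≠ 0 → ‖Q - p‖ ≤ r * ‖p‖ → |(g.segLog Q p 0).im| < Real.pi

theorem IsHull.linked_step {K K' : Set ℂ} (hK' : IsHull K') {g : LogHomeo}
    (hg : g.map '' K = K') {A p ζ' : ℂ} (hA : IsSpike K A p) (hζ' : IsSpike K' ζ' (g.map p)) {m : ℕ}
    (hm : ∀ Q ∈ segment ℝ A p, Q ∉ K → |(g.segLog Q p 0).im| < Real.pi + 2 * Real.pi * m) :
    Linked K' (g.map A) (g.segLog A p) ζ' (segLog ζ' (g.map p)) (fun _ => 0) (4 + m) := by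
  have hmem : ∀ w, g.map w ∈ K' → w ∈ K := by
    intro w hw
    rw [← hg] at hw
    exact (g.map.injective.mem_set_image).1 hw
  exact hK'.linked_segLog g (hg ▸ mem_image_of_mem _ hA.mem)
    (fun w hw hwK => hA.eq_of_mem w hw (hmem w hwK)) hζ'
    (fun Q hQ hQA => hm Q hQ fun hQK => hQA (hA.eq_of_mem Q hQ hQK))

theorem IsHull.linked_step_far {K K' : Set ℂ} (hK : IsHull K) (hK' : IsHull K') {g : LogHomeo}
    {r : ℝ} {m : ℕ} (hb : g.Bound r m) (hg : g.map '' K = K') {ζ p ζ' : ℂ} (hζ : IsSpike K ζ p)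
    (hζ' : IsSpike K' ζ' (g.map p)) :
    Linked K' (g.map ζ) (g.segLog ζ p) ζ' (segLog ζ' (g.map p)) (fun _ => 0) (4 + m) := by
  refine hK'.linked_step hg hζ hζ' fun Q hQ hQK => ?_
  have hQ0 : Q ≠ 0 := fun hh => hQK (hh ▸ hK.zero_mem)
  have hp0 : p ≠ 0 := fun hh => hζ.notMem (hh ▸ hK.zero_mem)
  rw [LogHomeo.segLog, LogHomeo.push_zero, Complex.add_im]
  have h1 := abs_im_segLog_le Q p 0
  have h2 := hb.far Q p hQ0 hp0
  have h3 := abs_add_le (_root_.segLog Q p 0).im (g.quot p 0 - g.quot Q 0).im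
  linarith

theorem IsHull.linked_step_near {K K' : Set ℂ} (hK : IsHull K) (hK' : IsHull K') {g : LogHomeo}
    {r : ℝ} {m : ℕ} (hb : g.Bound r m) (hg : g.map '' K = K') {ζ p ζ' : ℂ} (hζ : IsSpike K ζ p)
    (hζ' : IsSpike K' ζ' (g.map p)) (hd : infDist p K ≤ r * ‖p‖) :
    Linked K' (g.map ζ) (g.segLog ζ p) ζ' (segLog ζ' (g.map p)) (fun _ => 0) 6 := by
  obtain ⟨X, hX, hXd⟩ := hK.compact.exists_infDist_eq_dist ⟨ζ, hζ.mem⟩ p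
  have hXs : IsSpike K X p := by
    refine ⟨hX, hζ.notMem, fun w hw hwK => ?_⟩
    have h1 := infDist_le_dist_of_mem (x := p) hwK
    have h2 := dist_add_dist_of_mem_segment hw
    have h3 : dist X w ≤ 0 := by
      rw [hXd, dist_comm p X, dist_comm p w] at h1
      linarith
    exact (dist_le_zero.1 h3).symm
  have h1 := (hK.linked_isSpike hζ hXs).push' hζ.mem hX g p
  rw [hg] at h1
  have h2 := hK'.linked_step hg hXs hζ' (m := 0) fun Q hQ hQK => by
    have hQ0 : Q ≠ 0 := fun hh => hQK (hh ▸ hK.zero_mem)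
    have hp0 : p ≠ 0 := fun hh => hζ.notMem (hh ▸ hK.zero_mem)
    have h3 := dist_add_dist_of_mem_segment hQ
    have h4 := hb.near Q p hQ0 hp0 (by
      rw [← dist_eq_norm]
      rw [hXd, dist_comm p X] at hd
      linarith [dist_nonneg (x := X) (y := Q)])
    simpa using h4
  exact (h1.trans' (hg ▸ mem_image_of_mem _ hX) h2).mono (by norm_num)

/-- Two orbits which start and end near each other off an equivariant family of hulls, and stay
mostly close to it, turn around the origin almost as much. -/
theorem abs_iter_quot_sub_le {g : LogHomeo} {r : ℝ} {m : ℕ} (hg : g.Bound r m) {K : ℕ → Set ℂ}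
    (hH : ∀ j, IsHull (K j)) (hK : ∀ j, g.map '' K j = K (j + 1)) {p q : ℕ → ℂ}
    (hp : ∀ j, p (j + 1) = g.map (p j)) (hq : ∀ j, q (j + 1) = g.map (q j))
    (hpK : ∀ j, p j ∉ K j) (hqK : ∀ j, q j ∉ K j) {k N E E' : ℕ}
    (hpN : Set.ncard {j | j < k ∧ r * ‖p j‖ < infDist (p j) (K j)} ≤ N)
    (hqN : Set.ncard {j | j < k ∧ r * ‖q j‖ < infDist (q j) (K j)} ≤ N)
    (hE : PolyReach (K 0)ᶜ E (p 0) (q 0)) (hE' : PolyReach (K k)ᶜ E' (p k) (q k)) :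
    |((g.iter k).quot (q 0) 0 - (g.iter k).quot (p 0) 0).im| ≤
      2 * Real.pi * (2 * (6 * k + (4 + m) * N) + 3 * E + 3 * E' + 4) + Real.pi * (E + E') := by
  classical
  choose ζ hζ using fun j => (hH j).exists_isRadial (hpK j)
  choose η hη using fun j => (hH j).exists_isRadial (hqK j)
  have hstep : ∀ (p ζ : ℕ → ℂ), (∀ j, p (j + 1) = g.map (p j)) →
      (∀ j, IsRadial (K j) (ζ j) (p j)) → ∀ j,
      Linked (K (j + 1)) (g.map (ζ j)) (g.segLog (ζ j) (p j)) (ζ (j + 1))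
      (_root_.segLog (ζ (j + 1)) (p (j + 1))) (fun _ => 0)
      (6 + if r * ‖p j‖ < infDist (p j) (K j) then (4 + m : ℝ) else 0) := by
    intro p ζ hp hζ j
    have h1 := (hζ (j + 1)).toIsSpike
    rw [hp] at h1 ⊢
    split_ifs with h
    · exact ((hH j).linked_step_far (hH (j + 1)) hg (hK j) (hζ j).toIsSpike h1).mono (by linarith)
    · exact ((hH j).linked_step_near (hH (j + 1)) hg (hK j) (hζ j).toIsSpike h1
        (not_lt.1 h)).mono (by linarith)
  have hsum : ∀ p : ℕ → ℂ, Set.ncard {j | j < k ∧ r * ‖p j‖ < infDist (p j) (K j)} ≤ N →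
      ∑ j ∈ Finset.range k, (6 + if r * ‖p j‖ < infDist (p j) (K j) then (4 + m : ℝ) else 0) ≤
        6 * k + (4 + m) * N := by
    intro p hN
    rw [Finset.sum_add_distrib, ← Finset.sum_filter]
    have h1 : ((Finset.range k).filter fun j => r * ‖p j‖ < infDist (p j) (K j)).card ≤ N := by
      rw [← Set.ncard_coe_finset]
      simpa using hN
    have h2 : (((Finset.range k).filter fun j => r * ‖p j‖ < infDist (p j) (K j)).card : ℝ) ≤ N := by
      exact_mod_cast h1
    simp only [Finset.sum_const, Finset.card_range, nsmul_eq_mul]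
    nlinarith [(Nat.cast_nonneg m : (0 : ℝ) ≤ m)]
  refine (norm_iter_quot_sub_le hH hK hp hq hζ hη (hstep p ζ hp hζ) (hstep q η hq hη) hE hE').trans ?_
  have h1 := hsum p hpN
  have h2 := hsum q hqN
  have hpi := Real.pi_pos
  gcongr
  linarith

/-- The map of the punctured plane induced through the exponential, extended by `0 ↦ 0`. -/
def expMap (G : ℂ → ℂ) (w : ℂ) : ℂ :=
  if w = 0 then 0 else Complex.exp (G (Complex.log w))

theorem expMap_zero (G : ℂ → ℂ) : expMap G 0 = 0 := by simp [expMap]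

theorem expMap_exp {G : ℂ → ℂ}
    (hG : ∀ z, ∀ n : ℤ, G (z + n * (2 * Real.pi * Complex.I)) = G z + n * (2 * Real.pi * Complex.I))
    (z : ℂ) : expMap G (Complex.exp z) = Complex.exp (G z) := by
  rw [expMap, if_neg (Complex.exp_ne_zero z)]
  obtain ⟨n, hn⟩ := Complex.exp_eq_exp_iff_exists_int.1 (Complex.exp_log (Complex.exp_ne_zero z))
  rw [hn, hG, Complex.exp_eq_exp_iff_exists_int]
  exact ⟨n, rfl⟩

theorem Complex.map_exp_nhds_eq (z : ℂ) : map Complex.exp (𝓝 z) = 𝓝 (Complex.exp z) :=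
  (Complex.hasStrictDerivAt_exp z).map_nhds_eq (Complex.exp_ne_zero z)

theorem continuous_expMap {G : ℂ → ℂ} (hc : Continuous G)
    (hG : ∀ z, ∀ n : ℤ, G (z + n * (2 * Real.pi * Complex.I)) = G z + n * (2 * Real.pi * Complex.I))
    {B : ℝ} (hB : ∀ z, ‖G z - z‖ ≤ B) : Continuous (expMap G) := by
  rw [continuous_iff_continuousAt]
  intro w
  by_cases hw : w = 0
  · subst hw
    rw [ContinuousAt, expMap_zero]
    refine squeeze_zero_norm (a := fun w => Real.exp B * ‖w‖) (fun w => ?_) ?_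
    · by_cases hw : w = 0
      · simp [hw, expMap_zero]
      · obtain ⟨z, rfl⟩ : ∃ z, Complex.exp z = w := ⟨_, Complex.exp_log hw⟩
        rw [expMap_exp hG, Complex.norm_exp, Complex.norm_exp, ← Real.exp_add]
        have h1 := (Complex.abs_re_le_norm (G z - z)).trans (hB z)
        rw [Complex.sub_re] at h1
        exact Real.exp_le_exp.2 (by linarith [(abs_le.1 h1).2])
    · have : Continuous fun w : ℂ => Real.exp B * ‖w‖ := by fun_prop
      simpa using this.tendsto 0
  · obtain ⟨z, rfl⟩ : ∃ z, Complex.exp z = w := ⟨_, Complex.exp_log hw⟩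
    rw [ContinuousAt, ← Complex.map_exp_nhds_eq, tendsto_map'_iff]
    have h1 : expMap G ∘ Complex.exp = fun z => Complex.exp (G z) := funext (expMap_exp hG)
    rw [h1, expMap_exp hG]
    exact (Complex.continuous_exp.comp hc).tendsto z

/-- A homeomorphism of the plane commuting with `z ↦ z + 2πi`, at bounded distance from the
identity. -/
structure AnnularLift where
  /-- the homeomorphism -/
  map : ℂ ≃ₜ ℂ
  map_add : ∀ z, ∀ n : ℤ,
    map (z + n * (2 * Real.pi * Complex.I)) = map z + n * (2 * Real.pi * Complex.I)
  /-- the distance to the identity -/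
  bound : ℝ
  norm_le : ∀ z, ‖map z - z‖ ≤ bound

theorem AnnularLift.symm_add (G : AnnularLift) (z : ℂ) (n : ℤ) :
    G.map.symm (z + n * (2 * Real.pi * Complex.I)) =
      G.map.symm z + n * (2 * Real.pi * Complex.I) := by
  rw [Homeomorph.symm_apply_eq, G.map_add, Homeomorph.apply_symm_apply]

theorem AnnularLift.norm_symm_le (G : AnnularLift) (z : ℂ) : ‖G.map.symm z - z‖ ≤ G.bound := by
  have := G.norm_le (G.map.symm z)
  rwa [Homeomorph.apply_symm_apply, norm_sub_rev] at this

theorem expMap_leftInverse {G H : ℂ → ℂ}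
    (hG : ∀ z, ∀ n : ℤ, G (z + n * (2 * Real.pi * Complex.I)) = G z + n * (2 * Real.pi * Complex.I))
    (hH : ∀ z, ∀ n : ℤ, H (z + n * (2 * Real.pi * Complex.I)) = H z + n * (2 * Real.pi * Complex.I))
    (h : Function.LeftInverse H G) : Function.LeftInverse (expMap H) (expMap G) := by
  intro w
  by_cases hw : w = 0
  · simp [hw, expMap_zero]
  · obtain ⟨z, rfl⟩ : ∃ z, Complex.exp z = w := ⟨_, Complex.exp_log hw⟩
    rw [expMap_exp hG, expMap_exp hH, h]

/-- The homeomorphism of the plane induced by an annular lift through the exponential. -/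
def AnnularLift.expHomeo (G : AnnularLift) : ℂ ≃ₜ ℂ where
  toFun := expMap G.map
  invFun := expMap G.map.symm
  left_inv := expMap_leftInverse G.map_add G.symm_add G.map.left_inv
  right_inv := expMap_leftInverse G.symm_add G.map_add G.map.right_inv
  continuous_toFun := continuous_expMap G.map.continuous G.map_add G.norm_le
  continuous_invFun := continuous_expMap G.map.symm.continuous G.symm_add G.norm_symm_le

theorem AnnularLift.expHomeo_zero (G : AnnularLift) : G.expHomeo 0 = 0 := expMap_zero _

theorem AnnularLift.expHomeo_exp (G : AnnularLift) (z : ℂ) :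
    G.expHomeo (Complex.exp z) = Complex.exp (G.map z) := expMap_exp G.map_add z

/-- A homeomorphism of the plane fixing the origin has a continuous branch of the logarithm of its
difference quotient in logarithmic coordinates. -/
theorem exists_log_quot (φ : ℂ ≃ₜ ℂ) : ∃ L : ℂ × ℂ → ℂ, Continuous L ∧ ∀ v ζ : ℂ,
    Complex.exp (L (v, ζ)) = (φ (v + Complex.exp ζ) - φ v) / Complex.exp ζ := by
  have hc : Continuous fun p : ℂ × ℂ => (φ (p.1 + Complex.exp p.2) - φ p.1) / Complex.exp p.2 := by
    have := φ.continuous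
    exact Continuous.div (by fun_prop) (by fun_prop) fun p => Complex.exp_ne_zero _
  have hne : ∀ p : ℂ × ℂ, (φ (p.1 + Complex.exp p.2) - φ p.1) / Complex.exp p.2 ≠ 0 := fun p =>
    div_ne_zero (sub_ne_zero.2 fun h => Complex.exp_ne_zero p.2 (by simpa using φ.injective h))
      (Complex.exp_ne_zero _)
  obtain ⟨L, ⟨-, hL⟩, -⟩ := Complex.isCoveringMapOn_exp.existsUnique_continuousMap_lifts
    ⟨_, hc⟩ (a₀ := 0) (Complex.exp_log (hne 0)) hne
  exact ⟨L, L.continuous, fun v ζ => congrFun hL (v, ζ)⟩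

theorem AnnularLift.exists_quot (G : AnnularLift) : ∃ (Q : ℂ → ℂ → ℂ) (c : ℂ),
    (∀ u v : ℂ, u ≠ v → ContinuousAt (fun p : ℂ × ℂ => Q p.1 p.2) (u, v)) ∧
    (∀ u v : ℂ, u ≠ v → Complex.exp (Q u v) = (G.expHomeo u - G.expHomeo v) / (u - v)) ∧
    ∀ z, Q (Complex.exp z) 0 = G.map z - z + c := by
  obtain ⟨L, hLc, hL⟩ := exists_log_quot G.expHomeo
  have h0 : ∀ ζ, L (0, ζ) = G.map ζ - ζ + (L (0, 0) - G.map 0) := by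
    have hGc := G.map.continuous
    intro ζ
    have := eq_of_exp_eq_one isPreconnected_univ (h := fun ζ => L (0, ζ) - (G.map ζ - ζ))
      (by fun_prop) (fun ζ _ => by
        rw [Complex.exp_sub, hL, Complex.exp_sub, zero_add, G.expHomeo_exp, G.expHomeo_zero,
          sub_zero, div_self]
        exact div_ne_zero (Complex.exp_ne_zero _) (Complex.exp_ne_zero _))
      (mem_univ ζ) (mem_univ 0)
    linear_combination this
  have hper : ∀ (n : ℤ) v ζ, L (v, ζ + n * (2 * Real.pi * Complex.I)) = L (v, ζ) := by
    intro n v ζ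
    have := eq_of_exp_eq_one isPreconnected_univ
      (h := fun v => L (v, ζ + n * (2 * Real.pi * Complex.I)) - L (v, ζ))
      (by fun_prop) (fun v _ => by
        rw [Complex.exp_sub, hL, Complex.exp_add, Complex.exp_int_mul_two_pi_mul_I, mul_one, ← hL,
          div_self (Complex.exp_ne_zero _)])
      (mem_univ v) (mem_univ 0)
    rw [h0 (ζ + _), h0 ζ, G.map_add] at this
    linear_combination this
  have hex : ∀ ζ ζ' v, Complex.exp ζ = Complex.exp ζ' → L (v, ζ) = L (v, ζ') := by
    intro ζ ζ' v h
    obtain ⟨n, rfl⟩ := Complex.exp_eq_exp_iff_exists_int.1 h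
    exact hper n v ζ'
  refine ⟨fun u v => L (v, Complex.log (u - v)), L (0, 0) - G.map 0, fun u v huv => ?_,
    fun u v huv => ?_, fun z => ?_⟩
  · have h1 := sub_ne_zero.2 huv
    have h2 : ContinuousAt (fun p : ℂ × ℂ =>
        L (p.2, Complex.log (u - v) + Complex.log ((p.1 - p.2) / (u - v)))) (u, v) := by
      refine hLc.continuousAt.comp (f := fun p : ℂ × ℂ =>
        (p.2, Complex.log (u - v) + Complex.log ((p.1 - p.2) / (u - v)))) ?_
      refine ContinuousAt.prodMk continuousAt_snd (continuousAt_const.add ?_)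
      refine ContinuousAt.clog (by fun_prop) ?_
      simp [div_self h1]
    refine h2.congr ?_
    have h3 : ∀ᶠ p : ℂ × ℂ in 𝓝 (u, v), p.1 - p.2 ≠ 0 :=
      ContinuousAt.eventually_ne (g := fun p : ℂ × ℂ => p.1 - p.2) (by fun_prop) h1
    filter_upwards [h3] with p hp
    refine hex _ _ _ ?_
    rw [Complex.exp_add, Complex.exp_log h1, Complex.exp_log (div_ne_zero hp h1),
      Complex.exp_log hp]
    field_simp
  · rw [hL, Complex.exp_log (sub_ne_zero.2 huv), add_sub_cancel]
  · rw [← h0]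
    refine hex _ _ _ ?_
    rw [sub_zero, Complex.exp_log (Complex.exp_ne_zero _)]

theorem tendsto_quot_sub (φ : ℂ ≃ₜ ℂ) {Q : ℂ → ℂ → ℂ}
    (hc : ∀ u v : ℂ, u ≠ v → ContinuousAt (fun p : ℂ × ℂ => Q p.1 p.2) (u, v))
    (he : ∀ u v : ℂ, u ≠ v → Complex.exp (Q u v) = (φ u - φ v) / (u - v)) (a b : ℂ) :
    Tendsto (fun y => Q b y - Q a y) (cobounded ℂ) (𝓝 0) := by
  have hφ : Tendsto φ (cobounded ℂ) (cobounded ℂ) := by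
    rw [Metric.cobounded_eq_cocompact]
    exact φ.isClosedEmbedding.tendsto_cocompact
  have hinv : ∀ {f : ℂ → ℂ}, Tendsto f (cobounded ℂ) (cobounded ℂ) → ∀ a C : ℝ, 0 < a →
      ∀ᶠ y in cobounded ℂ, C < a * ‖f y‖ := by
    intro f hf a C ha
    have h1 := (tendsto_norm_cobounded_atTop.comp hf).eventually_gt_atTop (C / a)
    filter_upwards [h1] with y hy
    rwa [Function.comp_apply, div_lt_iff₀' ha] at hy
  have hcpt : IsCompact (segment ℝ a b) := by
    rw [← convexHull_pair]
    exact Set.Finite.isCompact_convexHull (𝕜 := ℝ) (Set.toFinite {a, b})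
  obtain ⟨C₁, hC₁⟩ := hcpt.isBounded.exists_norm_le
  obtain ⟨C₂, hC₂⟩ := (hcpt.image φ.continuous).isBounded.exists_norm_le
  have key : ∀ ε : ℝ, 0 < ε → ε ≤ 1 / 4 → ∀ᶠ y in cobounded ℂ, y ∉ segment ℝ a b ∧
      ∀ x ∈ segment ℝ a b, ‖Complex.exp (Q x y - Q a y) - 1‖ ≤ 3 * ε := by
    intro ε hε hε1
    filter_upwards [hinv tendsto_id ε (2 * C₁ + ε * C₁ + 1) hε,
      hinv hφ ε (2 * C₂ + ε * C₂ + 1) hε] with y hy1 hy2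
    have ha : a ∈ segment ℝ a b := left_mem_segment ℝ a b
    have hC1 : 0 ≤ C₁ := (norm_nonneg _).trans (hC₁ a ha)
    have hC2 : 0 ≤ C₂ := (norm_nonneg _).trans (hC₂ _ (mem_image_of_mem _ ha))
    simp only [id] at hy1
    have hyn : y ∉ segment ℝ a b := fun h => by
      have := hC₁ y h
      nlinarith [norm_nonneg y]
    refine ⟨hyn, fun x hx => ?_⟩
    have hxy : x ≠ y := fun h => hyn (h ▸ hx)
    have hay : a ≠ y := fun h => hyn (h ▸ ha)
    have e1 : ∀ u v w : ℂ, ∀ C : ℝ, ‖u‖ ≤ C → ‖v‖ ≤ C → 2 * C + ε * C + 1 < ε * ‖w‖ →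
        ∃ δ : ℂ, ‖δ‖ ≤ ε ∧ v - w ≠ 0 ∧ u - w = (v - w) * (1 + δ) := by
      intro u v w C hu hv hw
      have h1 : ‖w‖ - C ≤ ‖v - w‖ := by
        have := norm_sub_norm_le w v
        rw [norm_sub_rev] at this
        linarith
      have h2 : ‖u - v‖ ≤ 2 * C := (norm_sub_le u v).trans (by linarith)
      have h3 : 2 * C ≤ ε * ‖v - w‖ := by nlinarith
      have h4 : 0 < ‖v - w‖ := by nlinarith [norm_nonneg u]
      have h5 : v - w ≠ 0 := norm_pos_iff.1 h4
      refine ⟨(u - v) / (v - w), ?_, h5, by field_simp; ring⟩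
      rw [norm_div, div_le_iff₀ h4]
      linarith
    obtain ⟨δ, hδ, hn, hδe⟩ := e1 (φ x) (φ a) (φ y) C₂ (hC₂ _ (mem_image_of_mem _ hx))
      (hC₂ _ (mem_image_of_mem _ ha)) hy2
    obtain ⟨η, hη, hn', hηe⟩ := e1 a x y C₁ (hC₁ _ ha) (hC₁ _ hx) hy1
    have h6 : Complex.exp (Q x y - Q a y) = (1 + δ) * (1 + η) := by
      rw [Complex.exp_sub, he _ _ hxy, he _ _ hay, hδe, hηe]
      have : (1 + η) ≠ 0 := by
        intro h
        rw [h, mul_zero] at hηe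
        exact hay (sub_eq_zero.1 hηe)
      field_simp
    rw [h6, show (1 + δ) * (1 + η) - 1 = δ + η + δ * η by ring]
    have h7 : ‖δ * η‖ ≤ ε * ε := by
      rw [norm_mul]
      exact mul_le_mul hδ hη (norm_nonneg _) hε.le
    have h8 := norm_add₃_le (a := δ) (b := η) (c := δ * η)
    nlinarith
  have hlog : ∀ᶠ y in cobounded ℂ, Complex.log (Complex.exp (Q b y - Q a y)) = Q b y - Q a y := by
    filter_upwards [key (1 / 4) (by norm_num) le_rfl] with y hy
    obtain ⟨hyn, hy⟩ := hy
    have hslit : ∀ x ∈ segment ℝ a b, Complex.exp (Q x y - Q a y) ∈ Complex.slitPlane := by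
      intro x hx
      have h := Complex.mem_slitPlane_of_norm_lt_one (z := Complex.exp (Q x y - Q a y) - 1)
        ((hy x hx).trans_lt (by norm_num))
      simpa using h
    have hcont : ContinuousOn (fun x => Q x y - Q a y) (segment ℝ a b) := by
      intro x hx
      have hxy : x ≠ y := fun h => hyn (h ▸ hx)
      have : ContinuousAt (fun x => Q x y) x :=
        ContinuousAt.comp (f := fun x => (x, y)) (hc x y hxy) (by fun_prop)
      exact (this.sub continuousAt_const).continuousWithinAt
    have h1 := eq_of_exp_eq_one (convex_segment a b).isPreconnected
      (h := fun x => Complex.log (Complex.exp (Q x y - Q a y)) - (Q x y - Q a y))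
      ((hcont.cexp.clog hslit).sub hcont) (fun x hx => by
        rw [Complex.exp_sub, Complex.exp_log (Complex.exp_ne_zero _),
          div_self (Complex.exp_ne_zero _)]) (right_mem_segment ℝ a b) (left_mem_segment ℝ a b)
    simp only [sub_self, Complex.exp_zero, Complex.log_one] at h1
    exact sub_eq_zero.1 h1
  have hexp : Tendsto (fun y => Complex.exp (Q b y - Q a y)) (cobounded ℂ) (𝓝 1) := by
    rw [Metric.tendsto_nhds]
    intro ε hε
    filter_upwards [key (min (ε / 4) (1 / 4)) (by positivity) (min_le_right _ _)] with y hy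
    rw [dist_eq_norm]
    refine (hy.2 b (right_mem_segment ℝ a b)).trans_lt ?_
    have := min_le_left (ε / 4) (1 / 4 : ℝ)
    linarith
  have h2 := hexp.clog Complex.one_mem_slitPlane
  rw [Complex.log_one] at h2
  exact h2.congr' hlog

/-- The `LogHomeo` induced by an annular lift through the exponential. -/
def AnnularLift.logHomeo (G : AnnularLift) : LogHomeo where
  map := G.expHomeo
  quot := G.exists_quot.choose
  map_zero := G.expHomeo_zero
  cont := G.exists_quot.choose_spec.choose_spec.1
  exp_quot := G.exists_quot.choose_spec.choose_spec.2.1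
  lim := tendsto_quot_sub G.expHomeo G.exists_quot.choose_spec.choose_spec.1
    G.exists_quot.choose_spec.choose_spec.2.1

theorem AnnularLift.logHomeo_exp (G : AnnularLift) (z : ℂ) :
    G.logHomeo.map (Complex.exp z) = Complex.exp (G.map z) := G.expHomeo_exp z

theorem AnnularLift.exists_logHomeo_quot (G : AnnularLift) :
    ∃ c, ∀ z, G.logHomeo.quot (Complex.exp z) 0 = G.map z - z + c :=
  ⟨_, G.exists_quot.choose_spec.choose_spec.2.2⟩

theorem AnnularLift.exists_iter_quot (G : AnnularLift) (k : ℕ) : ∃ c, ∀ z,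
    (G.logHomeo.iter k).map (Complex.exp z) = Complex.exp (G.map^[k] z) ∧
    (G.logHomeo.iter k).quot (Complex.exp z) 0 = G.map^[k] z - z + c := by
  induction k with
  | zero => exact ⟨0, fun z => by simp [LogHomeo.iter, LogHomeo.id]⟩
  | succ k ih =>
    obtain ⟨c, hc⟩ := ih
    obtain ⟨d, hd⟩ := G.exists_logHomeo_quot
    refine ⟨c + d, fun z => ⟨?_, ?_⟩⟩
    · rw [Function.iterate_succ_apply', ← G.logHomeo_exp, ← (hc z).1]
      rfl
    · change G.logHomeo.quot ((G.logHomeo.iter k).map (Complex.exp z)) ((G.logHomeo.iter k).map 0) +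
        (G.logHomeo.iter k).quot (Complex.exp z) 0 = _
      rw [(hc z).1, (hc z).2, (G.logHomeo.iter k).map_zero, hd, Function.iterate_succ_apply']
      ring

theorem AnnularLift.exists_bound (G : AnnularLift)
    (hu : UniformContinuous fun z => G.map z - z) : ∃ r > 0, ∃ m, G.logHomeo.Bound r m := by
  obtain ⟨c, hc⟩ := G.exists_logHomeo_quot
  obtain ⟨m, hm⟩ := exists_nat_gt G.bound
  obtain ⟨δ, hδ, hδu⟩ := Metric.uniformContinuous_iff.1 hu 1 one_pos
  have hlog : ∀ᶠ t : ℂ in 𝓝 1, ‖Complex.log t‖ < min δ 1 := by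
    have : ContinuousAt (fun t => ‖Complex.log t‖) 1 :=
      (continuousAt_clog Complex.one_mem_slitPlane).norm
    refine this.eventually_lt continuousAt_const ?_
    simp [hδ]
  have hlog' : ∀ᶠ t : ℂ in 𝓝 1, ‖Complex.log t⁻¹‖ < 1 := by
    have : ContinuousAt (fun t : ℂ => ‖Complex.log t⁻¹‖) 1 := by
      refine (ContinuousAt.clog (continuousAt_inv₀ one_ne_zero) ?_).norm
      simp
    refine this.eventually_lt continuousAt_const ?_
    simp
  obtain ⟨r, hr, hrb⟩ := Metric.eventually_nhds_iff.1 (hlog.and hlog')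
  refine ⟨r / 2, by positivity, m, ⟨fun Q p hQ hp => ?_, fun Q p hQ hp hQp => ?_⟩⟩
  · obtain ⟨z, rfl⟩ : ∃ z, Complex.exp z = p := ⟨_, Complex.exp_log hp⟩
    obtain ⟨w, rfl⟩ : ∃ w, Complex.exp w = Q := ⟨_, Complex.exp_log hQ⟩
    rw [hc, hc]
    have h1 : ‖(G.map z - z + c - (G.map w - w + c))‖ ≤ G.bound + G.bound := by
      rw [add_sub_add_right_eq_sub]
      exact (norm_sub_le _ _).trans (add_le_add (G.norm_le z) (G.norm_le w))
    have h2 := Complex.abs_im_le_norm (G.map z - z + c - (G.map w - w + c))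
    have h3 := Real.pi_gt_three
    have h4 : (0 : ℝ) ≤ G.bound := (norm_nonneg _).trans (G.norm_le 0)
    nlinarith
  · obtain ⟨z, rfl⟩ : ∃ z, Complex.exp z = p := ⟨_, Complex.exp_log hp⟩
    set t := Q / Complex.exp z with ht
    have ht0 : t ≠ 0 := div_ne_zero hQ hp
    have hQe : Q = Complex.exp (z + Complex.log t) := by
      rw [Complex.exp_add, Complex.exp_log ht0, ht]
      field_simp
    have ht1 : dist t 1 < r := by
      have h0 : 0 < ‖Complex.exp z‖ := norm_pos_iff.2 hp
      rw [dist_eq_norm, ht, ← div_self hp, ← sub_div, norm_div, div_lt_iff₀ h0]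
      nlinarith
    obtain ⟨h1, h2⟩ := hrb ht1
    rw [LogHomeo.segLog, LogHomeo.push_zero]
    nth_rewrite 2 [hQe]
    rw [hc, hc, _root_.segLog, sub_zero, sub_zero, ← inv_div, ← ht]
    have h3 := hδu (a := z) (b := z + Complex.log t) (by
      rw [dist_eq_norm]
      simpa using h1.trans_le (min_le_left _ _))
    rw [dist_eq_norm] at h3
    have h4 := Complex.abs_im_le_norm (Complex.log t⁻¹ + (G.map z - z + c -
      (G.map (z + Complex.log t) - (z + Complex.log t) + c)))
    have h5 := norm_add_le (Complex.log t⁻¹) (G.map z - z + c -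
      (G.map (z + Complex.log t) - (z + Complex.log t) + c))
    rw [add_sub_add_right_eq_sub] at h4 h5
    have h6 := Real.pi_gt_three
    rw [add_sub_add_right_eq_sub]
    linarith

/-- The union of a planar set with the bounded components of its complement. -/
def fillIn (C : Set ℂ) : Set ℂ := {x | IsBounded (connectedComponentIn Cᶜ x)}

theorem subset_fillIn (C : Set ℂ) : C ⊆ fillIn C := fun x hx => by
  rw [fillIn, mem_ofPred_eq, connectedComponentIn_eq_empty (by simpa using hx)]
  exact isBounded_empty

theorem fillIn_mono {C C' : Set ℂ} (h : C ⊆ C') : fillIn C ⊆ fillIn C' := fun x (hx : IsBounded _) =>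
  hx.subset (connectedComponentIn_mono x (compl_subset_compl.2 h))

theorem image_fillIn_subset (φ : ℂ ≃ₜ ℂ) (C : Set ℂ) : φ '' fillIn C ⊆ fillIn (φ '' C) := by
  rintro _ ⟨x, hx, rfl⟩
  by_cases hxC : x ∈ C
  · exact subset_fillIn _ (mem_image_of_mem _ hxC)
  rw [fillIn, mem_ofPred_eq, ← image_compl_eq φ.bijective, ← φ.image_connectedComponentIn hxC]
  have h1 : IsCompact (closure (connectedComponentIn Cᶜ x)) := by
    have hx' : IsBounded (connectedComponentIn Cᶜ x) := hx
    exact hx'.isCompact_closure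
  exact (h1.image φ.continuous).isBounded.subset (image_mono subset_closure)

theorem image_fillIn (φ : ℂ ≃ₜ ℂ) (C : Set ℂ) : φ '' fillIn C = fillIn (φ '' C) := by
  refine (image_fillIn_subset φ C).antisymm ?_
  have := image_fillIn_subset φ.symm (φ '' C)
  rw [← image_comp, φ.symm_comp_self, image_id] at this
  rw [← φ.symm.preimage_image (fillIn _)]
  intro x hx
  exact ⟨φ.symm x, this ⟨x, by simpa using hx, rfl⟩, by simp⟩

theorem fillIn_subset_closedBall {C : Set ℂ} {R : ℝ} (hR : 0 < R) (hC : C ⊆ closedBall 0 R) :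
    fillIn C ⊆ closedBall 0 R := by
  intro x hx
  by_contra h
  have hsub : {y : ℂ | R < ‖y‖} ⊆ connectedComponentIn Cᶜ x := by
    refine (isPreconnected_norm_gt hR).subset_connectedComponentIn (by simpa using h) ?_
    intro y hy hyC
    have := hC hyC
    rw [mem_closedBall_zero_iff] at this
    exact absurd hy (not_lt.2 this)
  have h1 : {y : ℂ | R < ‖y‖} ∈ cobounded ℂ := norm_gt_mem_cobounded R
  have h2 : ({y : ℂ | R < ‖y‖}ᶜ) ∈ cobounded ℂ := by
    have h4 : IsBounded {y : ℂ | R < ‖y‖} := IsBounded.subset hx hsub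
    exact isBounded_def.1 h4
  have h3 := Filter.inter_mem h1 h2
  rw [inter_compl_self, empty_mem_iff_bot] at h3
  exact NeBot.ne inferInstance h3

theorem isHull_fillIn {C : Set ℂ} (hC : IsCompact C) (hconn : IsPreconnected C)
    (h0 : 0 ∈ interior C) : IsHull (fillIn C) := by
  obtain ⟨R, hR, hCR⟩ : ∃ R : ℝ, 0 < R ∧ C ⊆ closedBall 0 R := by
    obtain ⟨R, hR⟩ := hC.isBounded.subset_closedBall 0
    exact ⟨max R 1, by positivity, hR.trans (closedBall_subset_closedBall (le_max_left _ _))⟩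
  have hopen : IsOpen Cᶜ := hC.isClosed.isOpen_compl
  have hcomp : ∀ x y, y ∈ connectedComponentIn Cᶜ x → (x ∈ fillIn C ↔ y ∈ fillIn C) := by
    intro x y hy
    rw [fillIn, mem_ofPred_eq, mem_ofPred_eq, connectedComponentIn_eq hy]
  have hself : ∀ x, x ∉ C → x ∈ connectedComponentIn Cᶜ x := fun x hx => mem_connectedComponentIn hx
  have hopen' : IsOpen (fillIn C)ᶜ := by
    rw [isOpen_iff_mem_nhds]
    intro x hx
    filter_upwards [hopen.connectedComponentIn.mem_nhds (hself x fun h => hx (subset_fillIn C h))]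
      with y hy
    rwa [mem_compl_iff, ← hcomp x y hy]
  refine ⟨?_, ?_, ?_, ?_⟩
  · exact (isCompact_closedBall 0 R).of_isClosed_subset (isOpen_compl_iff.1 hopen')
      (fillIn_subset_closedBall hR hCR)
  · have h0C := interior_subset h0
    refine isPreconnected_of_forall 0 fun x hx => ?_
    by_cases hxC : x ∈ C
    · exact ⟨C, subset_fillIn C, h0C, hxC, hconn⟩
    set U := connectedComponentIn Cᶜ x with hU
    have hUne : U.Nonempty := ⟨x, hself x hxC⟩
    have hUuniv : U ≠ univ := fun h => by
      have : (0 : ℂ) ∈ U := h ▸ mem_univ 0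
      exact connectedComponentIn_subset _ _ this h0C
    obtain ⟨f, hf⟩ := nonempty_frontier_iff.2 ⟨hUne, hUuniv⟩
    have hfU : f ∉ U := by
      rw [hopen.connectedComponentIn.frontier_eq] at hf
      exact hf.2
    have hfC : f ∈ C := by
      by_contra hfC
      have h1 := hopen.connectedComponentIn.mem_nhds (hself f hfC)
      obtain ⟨y, hy1, hy2⟩ := mem_closure_iff_nhds.1 (frontier_subset_closure hf) _ h1
      rw [hU, connectedComponentIn_eq hy2, ← connectedComponentIn_eq hy1] at hfU
      exact hfU (hself f hfC)
    have h1 : IsPreconnected (insert f U) :=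
      isPreconnected_connectedComponentIn.subset_closure (subset_insert _ _)
        (insert_subset (frontier_subset_closure hf) subset_closure)
    refine ⟨insert f U ∪ C, ?_, Or.inr h0C, Or.inl (Or.inr (hself x hxC)),
      h1.union f (mem_insert _ _) hfC hconn⟩
    refine union_subset (insert_subset (subset_fillIn C hfC) fun y hy => ?_) (subset_fillIn C)
    rwa [← hcomp x y hy]
  · have hy0 : {y : ℂ | R < ‖y‖} ⊆ (fillIn C)ᶜ := fun y hy hyK => by
      have := fillIn_subset_closedBall hR hCR hyK
      rw [mem_closedBall_zero_iff] at this
      exact absurd hy (not_lt.2 this)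
    have hp := isPreconnected_norm_gt hR
    have hfar : ((R + 1 : ℝ) : ℂ) ∈ {y : ℂ | R < ‖y‖} := by
      rw [mem_ofPred_eq, Complex.norm_real, Real.norm_of_nonneg (by linarith)]
      linarith
    refine isPreconnected_of_forall ((R + 1 : ℝ) : ℂ) fun x hx => ?_
    have hxC : x ∉ C := fun h => hx (subset_fillIn C h)
    refine ⟨connectedComponentIn Cᶜ x, fun y hy => ?_, ?_, hself x hxC,
      isPreconnected_connectedComponentIn⟩
    · rwa [mem_compl_iff, ← hcomp x y hy]
    · have h1 : ¬ connectedComponentIn Cᶜ x ⊆ closedBall 0 R := fun h =>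
        hx (isBounded_closedBall.subset h)
      obtain ⟨y, hy, hyR⟩ := not_subset.1 h1
      rw [connectedComponentIn_eq hy]
      refine hp.subset_connectedComponentIn (by simpa using hyR) ?_ hfar
      exact hy0.trans (compl_subset_compl.2 (subset_fillIn C))
  · exact interior_mono (subset_fillIn C) h0

/-- The filled component of the origin. -/
def coreHull (A : Set ℂ) : Set ℂ := fillIn (connectedComponentIn A 0)

theorem coreHull_mono {A A' : Set ℂ} (h : A ⊆ A') : coreHull A ⊆ coreHull A' :=
  fillIn_mono (connectedComponentIn_mono 0 h)

theorem image_coreHull (φ : ℂ ≃ₜ ℂ) (h : φ 0 = 0) {A : Set ℂ} (hA : 0 ∈ A) :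
    φ '' coreHull A = coreHull (φ '' A) := by
  rw [coreHull, image_fillIn, φ.image_connectedComponentIn hA, h, coreHull]

theorem ball_subset_connectedComponentIn {A : Set ℂ} {r : ℝ} (hr : 0 < r) (h : ball 0 r ⊆ A) :
    ball 0 r ⊆ connectedComponentIn A 0 :=
  (convex_ball 0 r).isPreconnected.subset_connectedComponentIn (mem_ball_self hr) h

theorem ball_subset_coreHull {A : Set ℂ} {r : ℝ} (hr : 0 < r) (h : ball 0 r ⊆ A) :
    ball 0 r ⊆ coreHull A :=
  (ball_subset_connectedComponentIn hr h).trans (subset_fillIn _)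

theorem isHull_coreHull {A : Set ℂ} (hA : IsCompact A) {r : ℝ} (hr : 0 < r) (h : ball 0 r ⊆ A) :
    IsHull (coreHull A) := by
  refine isHull_fillIn (hA.of_isClosed_subset ?_ (connectedComponentIn_subset _ _))
    isPreconnected_connectedComponentIn ?_
  · have h1 : connectedComponentIn A 0 ⊆ closure (connectedComponentIn A 0) := subset_closure
    have h2 : closure (connectedComponentIn A 0) ⊆ connectedComponentIn A 0 :=
      isPreconnected_connectedComponentIn.closure.subset_connectedComponentIn
        (h1 (mem_connectedComponentIn (h (mem_ball_self hr))))
        (closure_minimal (connectedComponentIn_subset _ _) hA.isClosed)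
    exact isClosed_of_closure_subset h2
  · exact interior_mono (ball_subset_connectedComponentIn hr h)
      (mem_interior_iff_mem_nhds.2 (ball_mem_nhds 0 hr))

/-- An increasing family of hulls which is equivariant under a homeomorphism of the plane and under
dilations. -/
structure LevelFamily (g : ℂ ≃ₜ ℂ) (β M : ℝ) where
  /-- the hulls -/
  hull : ℝ → Set ℂ
  isHull : ∀ t, IsHull (hull t)
  mono : Monotone hull
  image : ∀ t, g '' hull t = hull (t + β)
  scale : ∀ (b : ℤ) (t : ℝ) (ξ : ℂ),
    (Real.exp (2 * Real.pi * b) : ℝ) * ξ ∈ hull (t + b) ↔ ξ ∈ hull t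
  norm_le : ∀ t, ∀ ξ ∈ hull t, ‖ξ‖ ≤ Real.exp (2 * Real.pi * t)
  mem : ∀ (t : ℝ) (ξ : ℂ), ‖ξ‖ < Real.exp (2 * Real.pi * (t - M)) → ξ ∈ hull t

/-- The points whose whole orbit stays below an orbit of the translation by `β`. -/
def orbitBound (g : ℂ ≃ₜ ℂ) (β t : ℝ) : Set ℂ :=
  ⋂ n : ℤ, {ξ | ‖(g ^ n) ξ‖ ≤ Real.exp (2 * Real.pi * (t + n * β))}

theorem mem_orbitBound {g : ℂ ≃ₜ ℂ} {β t : ℝ} {ξ : ℂ} : ξ ∈ orbitBound g β t ↔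
    ∀ n : ℤ, ‖(g ^ n) ξ‖ ≤ Real.exp (2 * Real.pi * (t + n * β)) := by
  simp [orbitBound]

theorem image_orbitBound (g : ℂ ≃ₜ ℂ) (β t : ℝ) :
    g '' orbitBound g β t = orbitBound g β (t + β) := by
  have h : ∀ ξ, g ξ ∈ orbitBound g β (t + β) ↔ ξ ∈ orbitBound g β t := by
    intro ξ
    rw [mem_orbitBound, mem_orbitBound]
    refine (Equiv.addRight (1 : ℤ)).forall_congr fun n => ?_
    rw [Equiv.coe_addRight]
    dsimp only
    rw [zpow_add_one]
    change ‖(g ^ n) (g ξ)‖ ≤ _ ↔ ‖(g ^ n) (g ξ)‖ ≤ _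
    push_cast
    rw [show t + β + n * β = t + (n + 1) * β by ring]
  ext ξ
  obtain ⟨η, rfl⟩ := g.surjective ξ
  rw [g.injective.mem_set_image, h]

theorem zpow_apply_mul {g : ℂ ≃ₜ ℂ} {s : ℂ} (h : ∀ ξ, g (s * ξ) = s * g ξ) (n : ℤ) (ξ : ℂ) :
    (g ^ n) (s * ξ) = s * (g ^ n) ξ := by
  have h' : ∀ ξ, g⁻¹ (s * ξ) = s * g⁻¹ ξ := by
    intro ξ
    refine g.injective ?_
    rw [h]
    change g (g.symm _) = s * g (g.symm _)
    simp
  induction n generalizing ξ with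
  | zero => rfl
  | succ n ih =>
    rw [zpow_add_one]
    change (g ^ (n : ℤ)) (g _) = s * (g ^ (n : ℤ)) (g _)
    rw [h, ih]
  | pred n ih =>
    rw [zpow_sub_one]
    change (g ^ (-n : ℤ)) (g⁻¹ _) = s * (g ^ (-n : ℤ)) (g⁻¹ _)
    rw [h', ih]

/-- The level family of a homeomorphism whose orbits stay close to orbits of a translation. -/
def levelFamily (g : ℂ ≃ₜ ℂ) (β M : ℝ) (h0 : g 0 = 0)
    (hs : ∀ (b : ℤ) (ξ : ℂ), g ((Real.exp (2 * Real.pi * b) : ℝ) * ξ) =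
      (Real.exp (2 * Real.pi * b) : ℝ) * g ξ)
    (hM : ∀ (n : ℤ) (ξ : ℂ), ‖(g ^ n) ξ‖ ≤ Real.exp (2 * Real.pi * (M + n * β)) * ‖ξ‖) :
    LevelFamily g β M :=
  have hball : ∀ t, ball 0 (Real.exp (2 * Real.pi * (t - M))) ⊆ orbitBound g β t := by
    intro t ξ hξ
    rw [mem_ball_zero_iff] at hξ
    refine mem_orbitBound.2 fun n => (hM n ξ).trans ?_
    refine (mul_le_mul_of_nonneg_left hξ.le (Real.exp_pos _).le).trans ?_
    rw [← Real.exp_add]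
    exact Real.exp_le_exp.2 (le_of_eq (by ring))
  have hle : ∀ t, orbitBound g β t ⊆ closedBall 0 (Real.exp (2 * Real.pi * t)) := by
    intro t ξ hξ
    have := mem_orbitBound.1 hξ 0
    rw [mem_closedBall_zero_iff]
    simpa using this
  have hcpt : ∀ t, IsCompact (orbitBound g β t) := fun t => by
    refine (isCompact_closedBall 0 _).of_isClosed_subset ?_ (hle t)
    exact isClosed_iInter fun n => isClosed_le (g ^ n).continuous.norm continuous_const
  have h0mem : ∀ t, 0 ∈ orbitBound g β t := fun t => hball t (mem_ball_self (Real.exp_pos _))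
  { hull := fun t => coreHull (orbitBound g β t)
    isHull := fun t => isHull_coreHull (hcpt t) (Real.exp_pos _) (hball t)
    mono := fun t t' h => coreHull_mono fun ξ hξ => mem_orbitBound.2 fun n =>
      (mem_orbitBound.1 hξ n).trans (Real.exp_le_exp.2 (by
        have := Real.pi_pos
        gcongr))
    image := fun t => by rw [image_coreHull g h0 (h0mem t), image_orbitBound]
    scale := fun b t ξ => by
      have hne : ((Real.exp (2 * Real.pi * b) : ℝ) : ℂ) ≠ 0 := by
        exact_mod_cast (Real.exp_pos _).ne'
      set φ := Homeomorph.mulLeft₀ ((Real.exp (2 * Real.pi * b) : ℝ) : ℂ) hne with hφ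
      have hmem : ∀ ξ, φ ξ ∈ orbitBound g β (t + b) ↔ ξ ∈ orbitBound g β t := by
        intro ξ
        rw [mem_orbitBound, mem_orbitBound]
        refine forall_congr' fun n => ?_
        rw [show φ ξ = ((Real.exp (2 * Real.pi * b) : ℝ) : ℂ) * ξ from rfl]
        rw [zpow_apply_mul (hs b), norm_mul, Complex.norm_real, Real.norm_of_nonneg
          (Real.exp_pos _).le, show 2 * Real.pi * (t + b + n * β) = 2 * Real.pi * b +
          2 * Real.pi * (t + n * β) by ring, Real.exp_add, mul_le_mul_iff_right₀ (Real.exp_pos _)]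
      have himg : φ '' orbitBound g β t = orbitBound g β (t + b) := by
        ext ξ
        obtain ⟨η, rfl⟩ := φ.surjective ξ
        rw [φ.injective.mem_set_image, hmem]
      rw [← himg, ← image_coreHull φ (mul_zero _) (h0mem t)]
      exact φ.injective.mem_set_image (a := ξ)
    norm_le := fun t ξ hξ => by
      have := fillIn_subset_closedBall (Real.exp_pos _)
        ((connectedComponentIn_subset _ 0).trans (hle t)) hξ
      rwa [mem_closedBall_zero_iff] at this
    mem := fun t ξ hξ => ball_subset_coreHull (Real.exp_pos _) (hball t)
      (by rwa [mem_ball_zero_iff]) }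

theorem PolyReach.mono_set {U V : Set ℂ} (h : U ⊆ V) {n : ℕ} {p q : ℂ} (hp : PolyReach U n p q) :
    PolyReach V n p q := by
  induction n generalizing q with
  | zero => exact hp
  | succ n ih =>
    obtain ⟨r, hr, hs⟩ := hp
    exact ⟨r, ih hr, hs.trans h⟩

theorem PolyReach.of_segment {U : Set ℂ} {p q : ℂ} (h : segment ℝ p q ⊆ U) : PolyReach U 1 p q :=
  ⟨p, rfl, h⟩

theorem PolyReach.trans {U : Set ℂ} {m n : ℕ} {p q r : ℂ} (h : PolyReach U m p q)
    (h' : PolyReach U n q r) : PolyReach U (m + n) p r := by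
  induction n generalizing r with
  | zero =>
    obtain rfl : q = r := h'
    exact h
  | succ n ih =>
    obtain ⟨s, hs, hsr⟩ := h'
    exact ⟨s, ih hs, hsr⟩

theorem PolyReach.symm {U : Set ℂ} {n : ℕ} {p q : ℂ} (h : PolyReach U n p q) :
    PolyReach U n q p := by
  induction n generalizing q with
  | zero => exact Eq.symm h
  | succ n ih =>
    obtain ⟨r, hr, hs⟩ := h
    rw [add_comm]
    exact (PolyReach.of_segment (segment_symm ℝ r q ▸ hs)).trans (ih hr)

theorem PolyReach.mono {U : Set ℂ} {p : ℂ} (hp : p ∈ U) {m n : ℕ} (hmn : m ≤ n) {q : ℂ}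
    (h : PolyReach U m p q) : PolyReach U n p q := by
  induction n, hmn using Nat.le_induction with
  | base => exact h
  | succ n _ ih =>
    rw [add_comm]
    exact (PolyReach.of_segment (by simpa using hp)).trans ih

theorem PolyReach.mul {U V : Set ℂ} {s : ℂ} (hUV : ∀ x ∈ U, s * x ∈ V) {n : ℕ} {p q : ℂ}
    (h : PolyReach U n p q) : PolyReach V n (s * p) (s * q) := by
  induction n generalizing q with
  | zero => exact congrArg (s * ·) h
  | succ n ih =>
    obtain ⟨r, hr, hs⟩ := h
    refine ⟨s * r, ih hr, ?_⟩
    have : segment ℝ (s * r) (s * q) = (fun x => s * x) '' segment ℝ r q :=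
      (image_segment ℝ (LinearMap.mulLeft ℝ s).toAffineMap r q).symm
    rw [this]
    rintro _ ⟨x, hx, rfl⟩
    exact hUV x (hs hx)

theorem isOpen_setOf_segment_subset {U : Set ℂ} (hU : IsOpen U) (p : ℂ) :
    IsOpen {q | segment ℝ p q ⊆ U} := by
  rw [Metric.isOpen_iff]
  intro q hq
  have hcpt : IsCompact (segment ℝ p q) := by
    rw [← convexHull_pair]
    exact Set.Finite.isCompact_convexHull (𝕜 := ℝ) (Set.toFinite {p, q})
  obtain ⟨δ, hδ, hδU⟩ := hcpt.exists_thickening_subset_open hU hq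
  refine ⟨δ, hδ, fun q' hq' x hx => hδU ?_⟩
  obtain ⟨a, b, ha, hb, hab, rfl⟩ := hx
  rw [mem_thickening_iff]
  refine ⟨a • p + b • q, ⟨a, b, ha, hb, hab, rfl⟩, ?_⟩
  rw [dist_add_left, dist_smul₀, Real.norm_of_nonneg hb]
  have h1 : b ≤ 1 := by linarith
  have h2 := mem_ball.1 hq'
  nlinarith [dist_nonneg (x := q') (y := q)]

theorem measurableSet_polyReach {U : Set ℂ} (hU : IsOpen U) (n : ℕ) (p : ℂ) :
    MeasurableSet {q | PolyReach U n p q} := by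
  cases n with
  | zero => exact (measurableSet_singleton p).congr (by ext q; exact eq_comm)
  | succ n =>
    have : {q | PolyReach U (n + 1) p q} =
        ⋃ r ∈ {r | PolyReach U n p r}, {q | segment ℝ r q ⊆ U} := by
      ext q
      simp [PolyReach]
    rw [this]
    exact (isOpen_biUnion fun r _ => isOpen_setOf_segment_subset hU r).measurableSet

theorem exists_polyReach {U : Set ℂ} (hU : IsOpen U) (hc : IsPreconnected U) {p q : ℂ}
    (hp : p ∈ U) (hq : q ∈ U) : ∃ n, PolyReach U n p q := by
  refine hc.induction₂ (fun p q => ∃ n, PolyReach U n p q) (fun x hx => ?_) ?_ ?_ hp hq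
  · obtain ⟨δ, hδ, hb⟩ := isOpen_iff.1 hU x hx
    filter_upwards [mem_nhdsWithin_of_mem_nhds (ball_mem_nhds x hδ)] with y hy
    exact ⟨1, PolyReach.of_segment
      (((convex_ball x δ).segment_subset (mem_ball_self hδ) hy).trans hb)⟩
  · rintro x y z - - - ⟨m, hm⟩ ⟨n, hn⟩
    exact ⟨_, hm.trans hn⟩
  · rintro x y - - ⟨m, hm⟩
    exact ⟨_, hm.symm⟩

namespace LevelFamily

variable {g : ℂ ≃ₜ ℂ} {β M : ℝ} (S : LevelFamily g β M)

/-- The level at which a point enters the family. -/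
def level (ξ : ℂ) : ℝ := sInf {t | ξ ∈ S.hull t}

theorem log_le_of_mem {ξ : ℂ} (hξ : ξ ≠ 0) {t : ℝ} (h : ξ ∈ S.hull t) :
    Real.log ‖ξ‖ ≤ 2 * Real.pi * t :=
  (Real.log_le_iff_le_exp (norm_pos_iff.2 hξ)).2 (S.norm_le t ξ h)

theorem bddBelow {ξ : ℂ} (hξ : ξ ≠ 0) : BddBelow {t | ξ ∈ S.hull t} := by
  refine ⟨Real.log ‖ξ‖ / (2 * Real.pi), fun t ht => ?_⟩
  rw [div_le_iff₀' Real.two_pi_pos]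
  exact S.log_le_of_mem hξ ht

theorem exists_mem (ξ : ℂ) : ∃ t, ξ ∈ S.hull t := by
  by_cases hξ : ξ = 0
  · exact ⟨0, hξ ▸ (S.isHull 0).zero_mem⟩
  refine ⟨M + Real.log ‖ξ‖ / (2 * Real.pi) + 1, S.mem _ _ ?_⟩
  rw [← Real.log_lt_iff_lt_exp (norm_pos_iff.2 hξ)]
  have := Real.two_pi_pos
  field_simp
  nlinarith

theorem level_le {ξ : ℂ} (hξ : ξ ≠ 0) {t : ℝ} (h : ξ ∈ S.hull t) : S.level ξ ≤ t :=
  csInf_le (S.bddBelow hξ) h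

theorem mem_of_level_lt {ξ : ℂ} {t : ℝ} (h : S.level ξ < t) : ξ ∈ S.hull t := by
  obtain ⟨s, hs, hst⟩ := exists_lt_of_csInf_lt (S.exists_mem ξ) h
  exact S.mono hst.le hs

theorem notMem_of_lt_level {ξ : ℂ} (hξ : ξ ≠ 0) {t : ℝ} (h : t < S.level ξ) : ξ ∉ S.hull t :=
  fun h' => not_lt.2 (S.level_le hξ h') h

theorem level_eq_add {ξ η : ℂ} (hξ : ξ ≠ 0) (hη : η ≠ 0) {s : ℝ}
    (h : ∀ t, η ∈ S.hull (t + s) ↔ ξ ∈ S.hull t) : S.level η = S.level ξ + s := by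
  refine le_antisymm (le_of_forall_gt_imp_ge_of_dense fun t ht => ?_)
    (le_of_forall_gt_imp_ge_of_dense fun t ht => ?_)
  · refine S.level_le hη ?_
    rw [← sub_add_cancel t s, h]
    exact S.mem_of_level_lt (by linarith)
  · have h1 := S.mem_of_level_lt ht
    rw [← sub_add_cancel t s, h] at h1
    linarith [S.level_le hξ h1]

theorem map_mem {ξ : ℂ} {t : ℝ} : g ξ ∈ S.hull (t + β) ↔ ξ ∈ S.hull t := by
  rw [← S.image, g.injective.mem_set_image]

theorem map_ne_zero {ξ : ℂ} (h0 : g 0 = 0) (hξ : ξ ≠ 0) : g ξ ≠ 0 :=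
  fun h => hξ (g.injective (h.trans h0.symm))

theorem level_map (h0 : g 0 = 0) {ξ : ℂ} (hξ : ξ ≠ 0) : S.level (g ξ) = S.level ξ + β :=
  S.level_eq_add hξ (map_ne_zero h0 hξ) fun _ => S.map_mem

theorem level_scale {ξ : ℂ} (hξ : ξ ≠ 0) (b : ℤ) :
    S.level ((Real.exp (2 * Real.pi * b) : ℝ) * ξ) = S.level ξ + b :=
  S.level_eq_add hξ (mul_ne_zero (by exact_mod_cast (Real.exp_pos _).ne') hξ)
    fun t => S.scale b t ξ

theorem level_orbit (h0 : g 0 = 0) {p : ℕ → ℂ} (hp : ∀ j, p (j + 1) = g (p j)) (hp0 : p 0 ≠ 0)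
    (k : ℕ) : p k ≠ 0 ∧ S.level (p k) = S.level (p 0) + k * β := by
  induction k with
  | zero => simpa using hp0
  | succ k ih =>
    rw [hp]
    refine ⟨map_ne_zero h0 ih.1, ?_⟩
    rw [S.level_map h0 ih.1, ih.2]
    push_cast
    ring

/-- Points reached by a polygonal path of bounded complexity outside the hull of the preceding
level. -/
def good (L E : ℕ) : Set ℂ := ⋃ i : ℤ, S.hull ((i + 1) / L) ∩
  {ξ | PolyReach (S.hull (i / L))ᶜ E (2 * Real.exp (2 * Real.pi * (i / L)) : ℝ) ξ}

theorem mem_good {L E : ℕ} {ξ : ℂ} : ξ ∈ S.good L E ↔ ∃ i : ℤ, ξ ∈ S.hull ((i + 1) / L) ∧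
    PolyReach (S.hull (i / L))ᶜ E (2 * Real.exp (2 * Real.pi * (i / L)) : ℝ) ξ := by
  simp [good]

theorem measurableSet_good (L E : ℕ) : MeasurableSet (S.good L E) :=
  MeasurableSet.iUnion fun _ => (S.isHull _).compact.isClosed.measurableSet.inter
    (measurableSet_polyReach (S.isHull _).isOpen_compl _ _)

theorem real_notMem {t x : ℝ} (h : Real.exp (2 * Real.pi * t) < x) : (x : ℂ) ∈ (S.hull t)ᶜ := by
  intro hh
  have h1 := S.norm_le t _ hh
  rw [Complex.norm_real] at h1
  linarith [le_abs_self x, Real.norm_eq_abs x]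

theorem base_notMem (t : ℝ) :
    ((2 * Real.exp (2 * Real.pi * t) : ℝ) : ℂ) ∈ (S.hull t)ᶜ :=
  S.real_notMem (by linarith [Real.exp_pos (2 * Real.pi * t)])

theorem good_mono {L E E' : ℕ} (h : E ≤ E') : S.good L E ⊆ S.good L E' := by
  intro ξ hξ
  obtain ⟨i, hi, hr⟩ := S.mem_good.1 hξ
  exact S.mem_good.2 ⟨i, hi, hr.mono (S.base_notMem _) h⟩

theorem exists_mem_good {L : ℕ} (hL : 0 < L) {ξ : ℂ} (hξ : ξ ≠ 0) : ∃ E, ξ ∈ S.good L E := by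
  have hL' : (0 : ℝ) < L := Nat.cast_pos.2 hL
  have h1 : ∃ i : ℤ, ξ ∈ S.hull (i / L) ∧ ∀ j : ℤ, ξ ∈ S.hull (j / L) → i ≤ j := by
    refine Int.exists_least_of_bdd (P := fun i : ℤ => ξ ∈ S.hull (i / L))
      ⟨⌊S.level ξ * L⌋, fun j hj => ?_⟩ ⟨⌊S.level ξ * L⌋ + 1, S.mem_of_level_lt ?_⟩
    · have h := S.level_le hξ hj
      rw [le_div_iff₀ hL'] at h
      exact_mod_cast (Int.floor_le _).trans h
    · rw [lt_div_iff₀ hL']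
      push_cast
      exact Int.lt_floor_add_one _
  obtain ⟨i, hi, hmin⟩ := h1
  have h2 : ξ ∈ (S.hull ((i - 1 : ℤ) / L))ᶜ := fun h => by
    have := hmin _ h
    omega
  obtain ⟨E, hE⟩ := exists_polyReach (S.isHull _).isOpen_compl (S.isHull _).compl
    (S.base_notMem ((i - 1 : ℤ) / L)) h2
  refine ⟨E, S.mem_good.2 ⟨i - 1, ?_, hE⟩⟩
  push_cast
  rwa [sub_add_cancel]

theorem scale_mem_good {L : ℕ} (hL : 0 < L) {E : ℕ} {ξ : ℂ} (h : ξ ∈ S.good L E) (b : ℤ) :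
    (Real.exp (2 * Real.pi * b) : ℝ) * ξ ∈ S.good L E := by
  have hL' : (L : ℝ) ≠ 0 := (Nat.cast_pos.2 hL).ne'
  obtain ⟨i, hi, hr⟩ := S.mem_good.1 h
  refine S.mem_good.2 ⟨i + b * L, ?_, ?_⟩
  · have e1 : (((i + b * L : ℤ) : ℝ) + 1) / L = (i + 1) / L + b := by
      push_cast
      field_simp
      ring
    rw [e1, S.scale]
    exact hi
  · have e1 : ((i + b * L : ℤ) : ℝ) / L = i / L + b := by
      push_cast
      field_simp
    have e2 : ((2 * Real.exp (2 * Real.pi * (i / L + b)) : ℝ) : ℂ) =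
        (Real.exp (2 * Real.pi * b) : ℝ) * (2 * Real.exp (2 * Real.pi * (i / L)) : ℝ) := by
      rw [mul_add, Real.exp_add]
      push_cast
      ring
    rw [e1, e2]
    have h1 : ∀ x ∈ (S.hull (i / L))ᶜ,
        (Real.exp (2 * Real.pi * b) : ℝ) * x ∈ (S.hull (i / L + b))ᶜ :=
      fun x hx hxb => hx ((S.scale b _ x).1 hxb)
    exact hr.mul h1

theorem polyReach_of_mem_good {L E : ℕ} {θ : ℝ} {ξ η : ℂ} (hξ0 : ξ ≠ 0) (hη0 : η ≠ 0)
    (hξ : ξ ∈ S.good L E) (hη : η ∈ S.good L E) (hθξ : θ + 1 / L ≤ S.level ξ)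
    (hθη : θ + 1 / L ≤ S.level η) : PolyReach (S.hull θ)ᶜ (2 * E + 1) ξ η := by
  have hpi := Real.pi_pos
  have key : ∀ ξ ≠ 0, ξ ∈ S.good L E → θ + 1 / L ≤ S.level ξ → ∃ x : ℝ,
      Real.exp (2 * Real.pi * θ) < x ∧ PolyReach (S.hull θ)ᶜ E x ξ := by
    intro ξ hξ0 hξ hθ
    obtain ⟨i, hi, hr⟩ := S.mem_good.1 hξ
    have h1 := S.level_le hξ0 hi
    have h2 : θ ≤ i / L := by
      rw [add_div] at h1
      linarith
    refine ⟨_, ?_, hr.mono_set (compl_subset_compl.2 (S.mono h2))⟩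
    have h3 : Real.exp (2 * Real.pi * θ) ≤ Real.exp (2 * Real.pi * (i / L)) :=
      Real.exp_le_exp.2 (by gcongr)
    linarith [Real.exp_pos (2 * Real.pi * (i / L))]
  obtain ⟨x, hx, hxr⟩ := key ξ hξ0 hξ hθξ
  obtain ⟨y, hy, hyr⟩ := key η hη0 hη hθη
  have hseg : segment ℝ (x : ℂ) y ⊆ (S.hull θ)ᶜ := by
    rintro _ ⟨a, b, ha, hb, hab, rfl⟩
    have h1 : a • (x : ℂ) + b • (y : ℂ) = ((a * x + b * y : ℝ) : ℂ) := by
      simp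
    rw [h1]
    refine S.real_notMem ?_
    obtain rfl : b = 1 - a := by linarith
    rcases ha.eq_or_lt with rfl | ha
    · simpa using hy
    · nlinarith
  have := (hxr.symm.trans (PolyReach.of_segment hseg)).trans hyr
  rwa [show E + 1 + E = 2 * E + 1 by ring] at this

end LevelFamily

theorem Irrational.exists_le_abs_sub {β : ℝ} (hβ : Irrational β) (τ : ℕ) :
    ∃ c > 0, ∀ i : ℕ, 0 < i → i < τ → ∀ b : ℤ, c ≤ |i * β - b| := by
  induction τ with
  | zero => exact ⟨1, one_pos, fun i _ hi => absurd hi (Nat.not_lt_zero i)⟩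
  | succ τ ih =>
    obtain ⟨c, hc, h⟩ := ih
    rcases Nat.eq_zero_or_pos τ with rfl | hτ
    · exact ⟨1, one_pos, fun i hi hi' => by omega⟩
    have hpos : 0 < |τ * β - round (τ * β)| := by
      rw [abs_pos, sub_ne_zero]
      exact (hβ.natCast_mul hτ.ne').ne_int _
    refine ⟨min c |τ * β - round (τ * β)|, lt_min hc hpos, fun i hi hi' b => ?_⟩
    rcases (Nat.lt_succ_iff.1 hi').eq_or_lt with rfl | hlt
    · exact (min_le_right _ _).trans (round_le _ _)
    · exact (min_le_left _ _).trans (h i hi hlt b)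

theorem exists_finset_cover (r R : ℝ) (hr : 0 < r) :
    ∃ t : Finset ℂ, ∀ s : ℂ, ‖s‖ ≤ R → ∃ y ∈ t, ‖s - y‖ < r := by
  obtain ⟨t, -, ht, hcov⟩ :=
    Metric.totallyBounded_iff.1 (isCompact_closedBall (0 : ℂ) R).totallyBounded r hr |>.imp
      fun t h => (⟨trivial, h⟩ : True ∧ _)
  refine ⟨ht.toFinset, fun s hs => ?_⟩
  obtain ⟨y, hy, hsy⟩ := mem_iUnion₂.1 (hcov (mem_closedBall_zero_iff.2 hs))
  exact ⟨y, ht.mem_toFinset.2 hy, by rwa [← dist_eq_norm]⟩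

theorem exists_exp_mul_norm_le {ξ : ℂ} (hξ : ξ ≠ 0) : ∃ (b : ℤ) (s : ℂ),
    ξ = (Real.exp (2 * Real.pi * b) : ℝ) * s ∧ ‖s‖ ≤ Real.exp (2 * Real.pi) ∧
    Real.exp (2 * Real.pi * b) ≤ ‖ξ‖ := by
  have hpi := Real.two_pi_pos
  have hn := norm_pos_iff.2 hξ
  set b := ⌊Real.log ‖ξ‖ / (2 * Real.pi)⌋ with hb
  have h1 : (b : ℝ) ≤ Real.log ‖ξ‖ / (2 * Real.pi) := Int.floor_le _
  have h2 : Real.log ‖ξ‖ / (2 * Real.pi) < b + 1 := Int.lt_floor_add_one _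
  rw [le_div_iff₀' hpi] at h1
  rw [div_lt_iff₀' hpi] at h2
  have hpos := Real.exp_pos (2 * Real.pi * b)
  refine ⟨b, ξ / (Real.exp (2 * Real.pi * b) : ℝ), ?_, ?_, ?_⟩
  · have : ((Real.exp (2 * Real.pi * b) : ℝ) : ℂ) ≠ 0 := by exact_mod_cast hpos.ne'
    field_simp
  · rw [norm_div, Complex.norm_real, Real.norm_of_nonneg hpos.le, div_le_iff₀ hpos, ← Real.exp_add,
      ← Real.log_le_iff_le_exp hn]
    linarith
  · rwa [← Real.le_log_iff_exp_le hn]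

namespace LevelFamily

variable {g : ℂ ≃ₜ ℂ} {β M : ℝ} (S : LevelFamily g β M)

theorem add_le_of_notMem_of_mem {s t : ℝ} {ξ : ℂ} (h : ξ ∉ S.hull s) (h' : ξ ∈ S.hull t) : s < t :=
  not_le.1 fun hh => h (S.mono hh h')

/-- An orbit which lies just outside an equivariant family of hulls is rarely far away from it. -/
theorem exists_ncard_far_le (hβ : Irrational β) {r : ℝ} (hr : 0 < r) : ∃ P : ℕ, ∀ τ : ℕ, 0 < τ →
    ∃ c > 0, ∀ (θ : ℝ) (p : ℕ → ℂ), (∀ j, p (j + 1) = g (p j)) → (∀ j, p j ≠ 0) →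
      p 0 ∈ S.hull (θ + c) → ∀ k : ℕ,
      Set.ncard {j | j < k ∧ r * ‖p j‖ < infDist (p j) (S.hull (θ + j * β))} ≤ P * (k / τ + 1) := by
  classical
  obtain ⟨t, ht⟩ := exists_finset_cover (r / 2) (Real.exp (2 * Real.pi)) (by positivity)
  refine ⟨t.card, fun τ hτ => ?_⟩
  obtain ⟨c, hc, hsep⟩ := hβ.exists_le_abs_sub τ
  refine ⟨c, hc, fun θ p hp hp0 hpc k => ?_⟩
  have hmem : ∀ j : ℕ, p j ∈ S.hull (θ + c + j * β) := by
    intro j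
    induction j with
    | zero => simpa using hpc
    | succ j ih =>
      rw [hp, show θ + c + ((j + 1 : ℕ) : ℝ) * β = θ + c + j * β + β by push_cast; ring]
      exact S.map_mem.2 ih
  choose b s hps hs hbp using fun j => exists_exp_mul_norm_le (hp0 j)
  choose y hyt hy using fun j => ht (s j) (hs j)
  have key : ∀ i j : ℕ, r * ‖p j‖ < infDist (p j) (S.hull (θ + j * β)) → y i = y j →
      θ + j * β < θ + c + i * β + (b j - b i : ℤ) := by
    intro i j hj hij
    refine S.add_le_of_notMem_of_mem (ξ := (Real.exp (2 * Real.pi * (b j - b i : ℤ)) : ℝ) * p i)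
      (fun hh => ?_) ((S.scale _ _ _).2 (hmem i))
    have h1 : ((Real.exp (2 * Real.pi * (b j - b i : ℤ)) : ℝ) : ℂ) * p i =
        (Real.exp (2 * Real.pi * b j) : ℝ) * s i := by
      rw [hps i, ← mul_assoc, ← Complex.ofReal_mul, ← Real.exp_add]
      congr 3
      push_cast
      ring
    have h2 := infDist_le_dist_of_mem (x := p j) hh
    rw [h1, dist_eq_norm] at h2
    nth_rewrite 2 [hps j] at h2
    rw [← mul_sub, norm_mul, Complex.norm_real, Real.norm_of_nonneg (Real.exp_pos _).le] at h2
    have h3 : ‖s j - s i‖ ≤ r := by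
      have h4 := hy i
      rw [hij] at h4
      have h5 : s j - s i = (s j - y j) - (s i - y j) := by ring
      rw [h5]
      linarith [norm_sub_le (s j - y j) (s i - y j), hy j]
    nlinarith [hbp j, Real.exp_pos (2 * Real.pi * b j)]
  have hfin : ((t ×ˢ Finset.range (k / τ + 1) : Finset (ℂ × ℕ)) : Set (ℂ × ℕ)).Finite :=
    Finset.finite_toSet _
  have hcard : Set.ncard ((t ×ˢ Finset.range (k / τ + 1) : Finset (ℂ × ℕ)) : Set (ℂ × ℕ)) =
      t.card * (k / τ + 1) := by
    rw [Set.ncard_coe_finset, Finset.card_product, Finset.card_range]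
  rw [← hcard]
  refine Set.ncard_le_ncard_of_injOn (fun j => (y j, j / τ)) ?_ ?_ hfin
  · rintro j ⟨hjk, -⟩
    simp only [Finset.coe_product, mem_prod, Finset.mem_coe, Finset.mem_range]
    exact ⟨hyt j, Nat.lt_succ_of_le (Nat.div_le_div_right hjk.le)⟩
  · have hlt : ∀ i j : ℕ, i < j → r * ‖p i‖ < infDist (p i) (S.hull (θ + i * β)) →
        r * ‖p j‖ < infDist (p j) (S.hull (θ + j * β)) → y i = y j → i / τ = j / τ → False := by
      intro i j hij hi hj hyij hdiv
      have h1 := key i j hj hyij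
      have h2 := key j i hi hyij.symm
      have h3 : j - i < τ := by
        have e1 := Nat.div_add_mod i τ
        have e2 := Nat.div_add_mod j τ
        have e3 := Nat.mod_lt j hτ
        rw [hdiv] at e1
        omega
      have h4 := hsep (j - i) (by omega) h3 (b j - b i)
      rw [Nat.cast_sub hij.le] at h4
      push_cast at h1 h2 h4
      have h5 : |((j : ℝ) - i) * β - (b j - b i)| < c := by
        rw [abs_lt]
        constructor <;> linarith
      linarith
    rintro i ⟨-, hi⟩ j ⟨-, hj⟩ hij
    simp only [Prod.mk.injEq] at hij
    rcases lt_trichotomy i j with h | h | h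
    · exact (hlt i j h hi hj hij.1 hij.2).elim
    · exact h
    · exact (hlt j i h hj hi hij.1.symm hij.2.symm).elim

end LevelFamily

/-- Two points at nearly the same level which are good now and after `k` iterations turn around the
origin almost as much. -/
theorem LevelFamily.exists_abs_iter_quot_sub_le {ψ : LogHomeo} {β M : ℝ}
    (S : LevelFamily ψ.map β M) (hβ : Irrational β) {r : ℝ} (hr : 0 < r) {m : ℕ}
    (hψ : ψ.Bound r m) : ∃ P : ℕ, ∀ τ : ℕ, 0 < τ → ∃ L : ℕ, 0 < L ∧ ∀ (E k : ℕ) (ξ η : ℂ),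
      ξ ≠ 0 → η ≠ 0 → |S.level ξ - S.level η| < 1 / L → ξ ∈ S.good L E → η ∈ S.good L E →
      (ψ.iter k).map ξ ∈ S.good L E → (ψ.iter k).map η ∈ S.good L E →
      |((ψ.iter k).quot η 0 - (ψ.iter k).quot ξ 0).im| ≤
        2 * Real.pi * (2 * (6 * k + (4 + m) * (P * (k / τ + 1))) + 14 * E + 12) := by
  obtain ⟨P, hP⟩ := S.exists_ncard_far_le hβ hr
  refine ⟨P, fun τ hτ => ?_⟩
  obtain ⟨c, hc, hbad⟩ := hP τ hτ
  obtain ⟨L, hL⟩ := exists_nat_gt (2 / c)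
  have hL0 : (0 : ℝ) < L := (div_pos two_pos hc).trans hL
  have hLc : 2 / L < c := by rwa [div_lt_comm₀ hL0 hc]
  refine ⟨L, Nat.cast_pos.1 hL0, fun E k ξ η hξ hη hlev hgξ hgη hgξk hgηk => ?_⟩
  have hL1 : 2 / (L : ℝ) = 1 / L + 1 / L := by ring
  have hL2 : 0 < 1 / (L : ℝ) := by positivity
  rw [abs_lt] at hlev
  set θ := min (S.level ξ) (S.level η) - 1 / L with hθ
  have hθξ : θ + 1 / L ≤ S.level ξ := by rw [hθ, sub_add_cancel]; exact min_le_left _ _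
  have hθη : θ + 1 / L ≤ S.level η := by rw [hθ, sub_add_cancel]; exact min_le_right _ _
  have hξθ : S.level ξ < θ + c := by
    rcases min_choice (S.level ξ) (S.level η) with h | h <;> rw [hθ, h] <;> linarith
  have hηθ : S.level η < θ + c := by
    rcases min_choice (S.level ξ) (S.level η) with h | h <;> rw [hθ, h] <;> linarith
  have h0 := ψ.map_zero
  have horb : ∀ x : ℂ, ∀ j, (ψ.iter (j + 1)).map x = ψ.map ((ψ.iter j).map x) := fun _ _ => rfl
  have hlevel : ∀ x : ℂ, x ≠ 0 → ∀ j, (ψ.iter j).map x ≠ 0 ∧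
      S.level ((ψ.iter j).map x) = S.level x + j * β := fun x hx j =>
    S.level_orbit h0 (p := fun j => (ψ.iter j).map x) (horb x) hx j
  have hout : ∀ x : ℂ, x ≠ 0 → θ + 1 / L ≤ S.level x → ∀ j : ℕ,
      (ψ.iter j).map x ∉ S.hull (θ + j * β) := by
    intro x hx hθx j
    obtain ⟨h1, h2⟩ := hlevel x hx j
    exact S.notMem_of_lt_level h1 (by rw [h2]; linarith)
  have hcount : ∀ x : ℂ, x ≠ 0 → S.level x < θ + c → Set.ncard {j | j < k ∧
      r * ‖(ψ.iter j).map x‖ < infDist ((ψ.iter j).map x) (S.hull (θ + j * β))} ≤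
      P * (k / τ + 1) := fun x hx hxc =>
    hbad θ (fun j => (ψ.iter j).map x) (horb x) (fun j => (hlevel x hx j).1)
      (S.mem_of_level_lt hxc) k
  have hE : PolyReach (S.hull (θ + (0 : ℕ) * β))ᶜ (2 * E + 1) ξ η := by
    rw [Nat.cast_zero, zero_mul, add_zero]
    exact S.polyReach_of_mem_good hξ hη hgξ hgη hθξ hθη
  have hE' := S.polyReach_of_mem_good (hlevel ξ hξ k).1 (hlevel η hη k).1 hgξk hgηk
    (θ := θ + k * β) (by rw [(hlevel ξ hξ k).2]; linarith) (by rw [(hlevel η hη k).2]; linarith)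
  have := abs_iter_quot_sub_le hψ (K := fun j => S.hull (θ + j * β)) (fun j => S.isHull _)
    (fun j => by rw [S.image]; congr 1; push_cast; ring)
    (p := fun j => (ψ.iter j).map ξ) (q := fun j => (ψ.iter j).map η) (horb ξ) (horb η)
    (hout ξ hξ hθξ) (hout η hη hθη) (hcount ξ hξ hξθ) (hcount η hη hηθ) hE hE'
  refine this.trans ?_
  have h1 : (((P * (k / τ + 1) : ℕ)) : ℝ) ≤ P * (k / τ + 1) := by
    push_cast
    have := Nat.cast_div_le (α := ℝ) (m := k) (n := τ)
    gcongr
  have h2 : (4 + (m : ℝ)) * ((P * (k / τ + 1) : ℕ) : ℝ) ≤ (4 + m) * (P * (k / τ + 1)) := by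
    gcongr
  have hpi := Real.pi_pos
  push_cast at h2 ⊢
  nlinarith

/-- A continuous function on the plane invariant under integer translations is bounded. -/
theorem exists_norm_le_of_periodic {H : ℝ × ℝ → ℝ × ℝ} (hc : Continuous H)
    (hp : ∀ (x : ℝ × ℝ) (v : ℤ × ℤ), H (x + ((v.1 : ℝ), (v.2 : ℝ))) = H x) :
    ∃ B, ∀ x, ‖H x‖ ≤ B := by
  obtain ⟨B, hB⟩ := ((isCompact_Icc (a := ((0 : ℝ), (0 : ℝ)))
    (b := (1, 1))).image hc).isBounded.exists_norm_le
  refine ⟨B, fun x => ?_⟩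
  have hx : H x = H (Int.fract x.1, Int.fract x.2) := by
    rw [← hp (Int.fract x.1, Int.fract x.2) (⌊x.1⌋, ⌊x.2⌋)]
    simp
  rw [hx]
  refine hB _ (mem_image_of_mem _ ⟨⟨Int.fract_nonneg _, Int.fract_nonneg _⟩,
    ⟨(Int.fract_lt_one _).le, (Int.fract_lt_one _).le⟩⟩)

/-- A continuous function on the plane invariant under integer translations is uniformly
continuous. -/
theorem uniformContinuous_of_periodic {H : ℝ × ℝ → ℝ × ℝ} (hc : Continuous H)
    (hp : ∀ (x : ℝ × ℝ) (v : ℤ × ℤ), H (x + ((v.1 : ℝ), (v.2 : ℝ))) = H x) :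
    UniformContinuous H := by
  have hu := (isCompact_Icc (a := ((-1 : ℝ), (-1 : ℝ)))
    (b := (2, 2))).uniformContinuousOn_of_continuous hc.continuousOn
  rw [Metric.uniformContinuousOn_iff] at hu
  rw [Metric.uniformContinuous_iff]
  intro ε hε
  obtain ⟨δ, hδ, h⟩ := hu ε hε
  refine ⟨min δ 1, by positivity, fun x y hxy => ?_⟩
  have e : ∀ z : ℝ × ℝ, H z = H (z.1 - ⌊x.1⌋, z.2 - ⌊x.2⌋) := by
    intro z
    rw [← hp (z.1 - ⌊x.1⌋, z.2 - ⌊x.2⌋) (⌊x.1⌋, ⌊x.2⌋)]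
    simp
  have hx1 := Int.floor_le x.1
  have hx2 := Int.lt_floor_add_one x.1
  have hx3 := Int.floor_le x.2
  have hx4 := Int.lt_floor_add_one x.2
  rw [lt_min_iff] at hxy
  have h12 : |x.1 - y.1| < 1 ∧ |x.2 - y.2| < 1 := by
    have := hxy.2
    rwa [Prod.dist_eq, max_lt_iff, Real.dist_eq, Real.dist_eq] at this
  rw [abs_lt, abs_lt] at h12
  rw [e x, e y]
  refine h _ ⟨⟨?_, ?_⟩, ?_, ?_⟩ _ ⟨⟨?_, ?_⟩, ?_, ?_⟩ ?_
  any_goals simp only; linarith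
  have := hxy.1
  rw [Prod.dist_eq, Real.dist_eq, Real.dist_eq] at this ⊢
  simpa only [sub_sub_sub_cancel_right] using this

/-- The plane with coordinates multiplied by `2π`, as the complex plane. -/
def planeEquiv : (ℝ × ℝ) ≃L[ℝ] ℂ :=
  Complex.equivRealProdCLM.symm.trans
    (ContinuousLinearEquiv.smulLeft (Units.mk0 (2 * Real.pi : ℝ) (by positivity)))

theorem planeEquiv_apply (x : ℝ × ℝ) :
    planeEquiv x = 2 * Real.pi * (x.1 + x.2 * Complex.I) := by
  change (2 * Real.pi : ℝ) • Complex.equivRealProdCLM.symm x = _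
  rw [Complex.equivRealProdCLM_symm_apply, Complex.real_smul]
  push_cast
  ring

theorem planeEquiv_re (x : ℝ × ℝ) : (planeEquiv x).re = 2 * Real.pi * x.1 := by
  simp [planeEquiv_apply]

theorem planeEquiv_im (x : ℝ × ℝ) : (planeEquiv x).im = 2 * Real.pi * x.2 := by
  simp [planeEquiv_apply]

section TorusLift

variable (G : (ℝ × ℝ) ≃ₜ (ℝ × ℝ))
  (hG : ∀ (x : ℝ × ℝ) (v : ℤ × ℤ), G (x + ((v.1 : ℝ), (v.2 : ℝ))) = G x + ((v.1 : ℝ), (v.2 : ℝ)))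

include hG

theorem sub_periodic (x : ℝ × ℝ) (v : ℤ × ℤ) :
    G (x + ((v.1 : ℝ), (v.2 : ℝ))) - (x + ((v.1 : ℝ), (v.2 : ℝ))) = G x - x := by
  rw [hG, add_sub_add_right_eq_sub]

theorem exists_annularLift : ∃ Γ : AnnularLift,
    (∀ x, Γ.map (planeEquiv x) = planeEquiv (G x)) ∧
    UniformContinuous fun z => Γ.map z - z := by
  have hc : Continuous fun x => G x - x := G.continuous.sub continuous_id
  obtain ⟨B, hB⟩ := exists_norm_le_of_periodic hc (sub_periodic G hG)
  have e : ∀ z, ((planeEquiv.symm.toHomeomorph.trans G).trans planeEquiv.toHomeomorph) z - z =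
      planeEquiv (G (planeEquiv.symm z) - planeEquiv.symm z) := by
    intro z
    simp
  refine ⟨⟨(planeEquiv.symm.toHomeomorph.trans G).trans planeEquiv.toHomeomorph, fun z n => ?_,
    ‖(planeEquiv : (ℝ × ℝ) →L[ℝ] ℂ)‖ * B, fun z => ?_⟩, fun x => ?_, ?_⟩
  · obtain ⟨x, rfl⟩ := planeEquiv.surjective z
    have h1 : (n : ℂ) * (2 * Real.pi * Complex.I) = planeEquiv (((0 : ℤ) : ℝ), (n : ℝ)) := by
      rw [planeEquiv_apply]
      push_cast
      ring
    rw [h1, ← map_add]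
    simp only [Homeomorph.trans_apply, ContinuousLinearEquiv.coe_toHomeomorph,
      ContinuousLinearEquiv.symm_apply_apply]
    rw [hG _ (0, n), map_add]
  · rw [e]
    exact ((planeEquiv : (ℝ × ℝ) →L[ℝ] ℂ).le_opNorm _).trans
      (mul_le_mul_of_nonneg_left (hB _) (norm_nonneg _))
  · simp
  · simp only [e]
    exact (planeEquiv : (ℝ × ℝ) →L[ℝ] ℂ).uniformContinuous.comp
      ((uniformContinuous_of_periodic hc (sub_periodic G hG)).comp
        (planeEquiv.symm : ℂ →L[ℝ] (ℝ × ℝ)).uniformContinuous)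

/-- If the horizontal deviations of a lift of a torus homeomorphism from an irrational translation
are bounded, then there is an equivariant function `ℓ`, and an exhausting sequence of sets `W`, such
that the vertical displacements of points of `W` are controlled by their values of `ℓ`. -/
theorem exists_level_estimate {β M : ℝ} (hβ : Irrational β)
    (hM : ∀ (x : ℝ × ℝ) (n : ℕ), |(G^[n] x - x).1 - n * β| ≤ M) :
    ∃ (L : ℕ) (C : ℝ) (ℓ : ℝ × ℝ → ℝ) (W : ℕ → Set (ℝ × ℝ)), 0 < L ∧
      (∀ E, MeasurableSet (W E)) ∧ Monotone W ∧ (∀ x, ∃ E, x ∈ W E) ∧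
      (∀ E x, ∀ v : ℤ × ℤ, x ∈ W E → x + ((v.1 : ℝ), (v.2 : ℝ)) ∈ W E) ∧
      (∀ x, ℓ (G x) = ℓ x + β) ∧
      (∀ x, ∀ b : ℤ, ℓ (x + ((b : ℝ), 0)) = ℓ x + b) ∧
      ∀ (E k : ℕ) (x y : ℝ × ℝ), |ℓ x - ℓ y| < 1 / L → x ∈ W E → y ∈ W E → G^[k] x ∈ W E →
        G^[k] y ∈ W E → |(G^[k] y - y).2 - (G^[k] x - x).2| ≤ 13 * k + 14 * E + C := by
  obtain ⟨Γ, hΓ, hu⟩ := exists_annularLift G hG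
  obtain ⟨r, hr, m, hm⟩ := Γ.exists_bound hu
  set p : ℝ × ℝ → ℂ := fun x => Complex.exp (planeEquiv x) with hpdef
  have hp0 : ∀ x, p x ≠ 0 := fun x => Complex.exp_ne_zero _
  have hpc : Continuous p := Complex.continuous_exp.comp planeEquiv.continuous
  have hps : ∀ ξ : ℂ, ξ ≠ 0 → ∃ x, p x = ξ := fun ξ hξ => by
    refine ⟨planeEquiv.symm (Complex.log ξ), ?_⟩
    simp [hpdef, Complex.exp_log hξ]
  have hpn : ∀ x, ‖p x‖ = Real.exp (2 * Real.pi * x.1) := fun x => by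
    rw [hpdef, Complex.norm_exp, planeEquiv_re]
  have hpg : ∀ x, Γ.expHomeo (p x) = p (G x) := fun x => by
    rw [hpdef, Γ.expHomeo_exp, hΓ]
  have hpv : ∀ x, ∀ v : ℤ × ℤ, p (x + ((v.1 : ℝ), (v.2 : ℝ))) =
      (Real.exp (2 * Real.pi * v.1) : ℝ) * p x := by
    intro x v
    simp only [hpdef, map_add]
    rw [planeEquiv_apply ((v.1 : ℝ), (v.2 : ℝ)), Complex.exp_add, mul_add, Complex.exp_add]
    have : Complex.exp (2 * Real.pi * ((v.2 : ℝ) * Complex.I)) = 1 := by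
      rw [← Complex.exp_int_mul_two_pi_mul_I v.2]
      congr 1
      push_cast
      ring
    rw [this]
    push_cast
    ring
  have hs : ∀ (b : ℤ) (ξ : ℂ), Γ.expHomeo ((Real.exp (2 * Real.pi * b) : ℝ) * ξ) =
      (Real.exp (2 * Real.pi * b) : ℝ) * Γ.expHomeo ξ := by
    intro b ξ
    by_cases hξ : ξ = 0
    · simp [hξ, Γ.expHomeo_zero]
    · obtain ⟨x, rfl⟩ := hps ξ hξ
      rw [← hpv x (b, 0), hpg, hG, hpv, hpg]
  have hit : ∀ (n : ℕ) x, (Γ.expHomeo ^ n) (p x) = p (G^[n] x) := by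
    intro n
    induction n with
    | zero => intro x; rfl
    | succ n ih =>
      intro x
      rw [pow_succ, Function.iterate_succ_apply, ← ih]
      change (Γ.expHomeo ^ n) (Γ.expHomeo (p x)) = _
      rw [hpg]
  have hzM : ∀ (n : ℤ) (ξ : ℂ),
      ‖(Γ.expHomeo ^ n) ξ‖ ≤ Real.exp (2 * Real.pi * (M + n * β)) * ‖ξ‖ := by
    have hpos : ∀ (n : ℕ) (ξ : ℂ),
        ‖(Γ.expHomeo ^ n) ξ‖ ≤ Real.exp (2 * Real.pi * (M + n * β)) * ‖ξ‖ ∧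
        ‖ξ‖ ≤ Real.exp (2 * Real.pi * (M - n * β)) * ‖(Γ.expHomeo ^ n) ξ‖ := by
      intro n ξ
      by_cases hξ : ξ = 0
      · have : ∀ n : ℕ, (Γ.expHomeo ^ n) 0 = 0 := by
          intro n
          induction n with
          | zero => rfl
          | succ n ih =>
            rw [pow_succ]
            change (Γ.expHomeo ^ n) (Γ.expHomeo 0) = 0
            rw [Γ.expHomeo_zero, ih]
        simp [hξ, this]
      · obtain ⟨x, rfl⟩ := hps ξ hξ
        rw [hit, hpn, hpn, ← Real.exp_add, ← Real.exp_add, Real.exp_le_exp, Real.exp_le_exp,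
          ← mul_add, ← mul_add, mul_le_mul_iff_right₀ (by positivity),
          mul_le_mul_iff_right₀ (by positivity)]
        have h := abs_le.1 (hM x n)
        rw [Prod.fst_sub] at h
        constructor <;> linarith
    intro n ξ
    obtain ⟨n, rfl | rfl⟩ := n.eq_nat_or_neg
    · rw [zpow_natCast]
      exact_mod_cast (hpos n ξ).1
    · have h := (hpos n ((Γ.expHomeo ^ (-(n : ℤ))) ξ)).2
      have h2 : (Γ.expHomeo ^ n) ((Γ.expHomeo ^ (-(n : ℤ))) ξ) = ξ := by
        change ((Γ.expHomeo ^ n) * (Γ.expHomeo ^ (-(n : ℤ)))) ξ = ξ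
        rw [zpow_neg, zpow_natCast, mul_inv_cancel]
        rfl
      rw [h2] at h
      refine h.trans (le_of_eq ?_)
      push_cast
      ring_nf
  let S : LevelFamily Γ.logHomeo.map β M := levelFamily Γ.expHomeo β M Γ.expHomeo_zero hs hzM
  obtain ⟨P, hP⟩ := S.exists_abs_iter_quot_sub_le hβ hr hm
  obtain ⟨L, hL, hest⟩ := hP (2 * (4 + m) * P + 1) (by positivity)
  refine ⟨L, 2 * (4 + m) * P + 12, fun x => S.level (p x), fun E => p ⁻¹' S.good L E, hL,
    fun E => hpc.measurable (S.measurableSet_good L E), fun E E' h => preimage_mono (S.good_mono h),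
    fun x => S.exists_mem_good hL (hp0 x), fun E x v hx => ?_, fun x => ?_, fun x b => ?_,
    fun E k x y hxy hx hy hx' hy' => ?_⟩
  · rw [mem_preimage, hpv]
    exact S.scale_mem_good hL hx v.1
  · rw [← S.level_map Γ.expHomeo_zero (hp0 x)]
    exact congrArg S.level (hpg x).symm
  · simp only
    rw [← S.level_scale (hp0 x) b, ← hpv x (b, 0)]
    simp
  · obtain ⟨c, hc⟩ := Γ.exists_iter_quot k
    have hΓk : ∀ x, Γ.map^[k] (planeEquiv x) = planeEquiv (G^[k] x) := by
      have : Function.Semiconj planeEquiv G Γ.map := fun x => (hΓ x).symm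
      exact fun x => ((this.iterate_right k) x).symm
    have h1 : ∀ x, (Γ.logHomeo.iter k).map (p x) = p (G^[k] x) := fun x => by
      rw [hpdef, (hc _).1, hΓk]
    have h2 := hest E k (p x) (p y) (hp0 x) (hp0 y) hxy hx hy (by rwa [h1]) (by rwa [h1])
    rw [(hc _).2, (hc _).2, hΓk, hΓk, ← map_sub, ← map_sub, add_sub_add_right_eq_sub, ← map_sub,
      planeEquiv_im, abs_mul, abs_of_pos Real.two_pi_pos,
      mul_le_mul_iff_right₀ Real.two_pi_pos] at h2
    rw [← Prod.snd_sub]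
    refine h2.trans ?_
    have h3 : 2 * ((4 + m : ℝ) * (P * (k / ((2 * (4 + m) * P + 1 : ℕ) : ℝ)))) ≤ k := by
      push_cast
      rw [show 2 * ((4 + m : ℝ) * (P * (k / (2 * (4 + m) * P + 1)))) =
        k * ((2 * (4 + m) * P) / (2 * (4 + m) * P + 1)) by ring]
      refine mul_le_of_le_one_right (Nat.cast_nonneg _) ?_
      exact div_le_one_of_le₀ (by linarith) (by positivity)
    linarith

end TorusLift

theorem Irrational.exists_abs_add_lt {β : ℝ} (hβ : Irrational β) {δ : ℝ} (hδ : 0 < δ) :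
    ∃ A : ℕ, ∀ d : ℝ, ∃ a ≤ A, ∃ b : ℤ, |d + a * β + b| < δ := by
  have hd : Dense ((AddSubgroup.closure {β, 1} : AddSubgroup ℝ) : Set ℝ) :=
    dense_addSubgroupClosure_pair_iff.2 (by simpa using hβ)
  have h1 : ∀ x : ℝ, ∃ p : ℤ × ℤ, |x + p.1 * β + p.2| < δ := by
    intro x
    obtain ⟨y, hy, hyx⟩ := hd.exists_dist_lt (-x) hδ
    obtain ⟨m, n, rfl⟩ := AddSubgroup.mem_closure_pair.1 hy
    refine ⟨(m, n), ?_⟩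
    rw [Real.dist_eq, abs_sub_comm] at hyx
    convert! hyx using 2
    simp only [zsmul_eq_mul, mul_one]
    ring
  obtain ⟨t, ht⟩ := (isCompact_Icc (a := (0 : ℝ)) (b := 1)).elim_finite_subcover
    (fun p : ℤ × ℤ => {x : ℝ | |x + p.1 * β + p.2| < δ})
    (fun p => isOpen_lt (by fun_prop) (by fun_prop))
    (fun x _ => mem_iUnion.2 (h1 x))
  set B := t.sup fun p => p.1.natAbs with hB
  have h2 : ∀ d : ℝ, ∃ a : ℤ, a.natAbs ≤ B ∧ ∃ b : ℤ, |d + a * β + b| < δ := by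
    intro d
    have := ht ⟨Int.fract_nonneg d, (Int.fract_lt_one d).le⟩
    simp only [mem_iUnion] at this
    obtain ⟨p, hp, h⟩ := this
    refine ⟨p.1, Finset.le_sup (f := fun p : ℤ × ℤ => p.1.natAbs) hp, p.2 - ⌊d⌋, ?_⟩
    have h' : |Int.fract d + p.1 * β + p.2| < δ := h
    convert! h' using 2
    push_cast
    rw [← Int.self_sub_floor]
    ring
  refine ⟨2 * B, fun d => ?_⟩
  obtain ⟨a, ha, b, hb⟩ := h2 (d + B * β)
  refine ⟨(a + B).toNat, by omega, b, ?_⟩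
  have : (((a + B).toNat : ℤ) : ℝ) = a + B := by
    rw [Int.toNat_of_nonneg (by omega)]
    push_cast
    ring
  rw [← Int.cast_natCast (R := ℝ), this]
  convert! hb using 2
  ring

open MeasureTheory in
/-- The Krylov–Bogolyubov theorem, for orbit segments of a sequence of points. -/
theorem exists_invariant_probability {T : Type} [TopologicalSpace T] [CompactSpace T]
    [TopologicalSpace.MetrizableSpace T] [MeasurableSpace T] [BorelSpace T]
    {f : T → T} (hf : Continuous f) (x : ℕ → T) {n : ℕ → ℕ} (hn : StrictMono n) :
    ∃ μ : Measure T, IsProbabilityMeasure μ ∧ MeasurePreserving f μ μ ∧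
      ∀ φ : T → ℝ, Continuous φ → ∀ c : ℝ,
        Tendsto (fun i => (n i : ℝ)⁻¹ * ∑ j ∈ Finset.range (n i), φ (f^[j] (x i))) atTop (𝓝 c) →
        ∫ t, φ t ∂μ = c := by
  have hpos : ∀ i, n (i + 1) ≠ 0 := fun i =>
    (Nat.zero_le _ |>.trans_lt (hn (Nat.lt_succ_self i))).ne'
  let μs : ℕ → ProbabilityMeasure T := fun i =>
    ⟨((n (i + 1) : ENNReal)⁻¹) • ∑ j ∈ Finset.range (n (i + 1)),
      Measure.dirac (f^[j] (x (i + 1))), ⟨by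
        simp only [Measure.smul_apply, Measure.finsetSum_apply, measure_univ, Finset.sum_const,
          Finset.card_range, smul_eq_mul, nsmul_eq_mul, mul_one]
        exact ENNReal.inv_mul_cancel (by exact_mod_cast hpos i) (ENNReal.natCast_ne_top _)⟩⟩
  have hInt : ∀ (φ : T → ℝ), Continuous φ → ∀ i, ∫ t, φ t ∂(μs i : Measure T) =
      (n (i + 1) : ℝ)⁻¹ * ∑ j ∈ Finset.range (n (i + 1)), φ (f^[j] (x (i + 1))) := by
    intro φ hφ i
    change ∫ t, φ t ∂(((n (i + 1) : ENNReal)⁻¹) • ∑ j ∈ Finset.range (n (i + 1)),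
      Measure.dirac (f^[j] (x (i + 1)))) = _
    rw [integral_smul_measure, integral_finsetSum_measure fun j _ => ?_]
    · simp
    · exact integrable_dirac (by simp)
  let U : Ultrafilter ℕ := Ultrafilter.of atTop
  have hU : (U : Filter ℕ) ≤ atTop := Ultrafilter.of_le atTop
  obtain ⟨μ, hμ⟩ : ∃ μ, Tendsto μs U (𝓝 μ) := ⟨_, (U.map μs).le_nhds_lim⟩
  rw [ProbabilityMeasure.tendsto_iff_forall_integral_tendsto] at hμ
  have hlim : ∀ φ : T → ℝ, Continuous φ → ∀ c : ℝ,
      Tendsto (fun i => (n i : ℝ)⁻¹ * ∑ j ∈ Finset.range (n i), φ (f^[j] (x i))) atTop (𝓝 c) →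
      ∫ t, φ t ∂(μ : Measure T) = c := by
    intro φ hφ c hc
    refine tendsto_nhds_unique (hμ (BoundedContinuousFunction.mkOfCompact ⟨φ, hφ⟩)) ?_
    refine Tendsto.congr (fun i => (hInt φ hφ i).symm) ?_
    exact ((tendsto_add_atTop_iff_nat 1).2 hc).mono_left hU
  refine ⟨μ, inferInstance, ⟨hf.measurable, ?_⟩, hlim⟩
  have := Measure.isProbabilityMeasure_map (μ := (μ : Measure T)) hf.aemeasurable
  refine ext_of_forall_integral_eq_of_IsFiniteMeasure fun φ => ?_
  rw [integral_map hf.aemeasurable φ.continuous.aestronglyMeasurable, ← sub_eq_zero,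
    ← integral_sub (f := fun t => φ (f t)) (g := φ)
      ((φ.compContinuous ⟨f, hf⟩).integrable _) (φ.integrable _)]
  refine hlim (fun t => φ (f t) - φ t) ((φ.continuous.comp hf).sub φ.continuous) 0 ?_
  have h1 : ∀ i, ∑ j ∈ Finset.range (n i), (φ (f (f^[j] (x i))) - φ (f^[j] (x i))) =
      φ (f^[n i] (x i)) - φ (x i) := by
    intro i
    simp only [← Function.iterate_succ_apply']
    exact Finset.sum_range_sub (fun j => φ (f^[j] (x i))) (n i)
  simp only [h1]
  refine squeeze_zero_norm (a := fun i => (n i : ℝ)⁻¹ * (2 * ‖φ‖)) (fun i => ?_) ?_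
  · rw [norm_mul, norm_inv, Real.norm_natCast]
    refine mul_le_mul_of_nonneg_left ?_ (by positivity)
    refine (norm_sub_le _ _).trans ?_
    have h2 := φ.norm_coe_le_norm (f^[n i] (x i))
    have h3 := φ.norm_coe_le_norm (x i)
    linarith
  · have h4 : Tendsto (fun i => (n i : ℝ)⁻¹) atTop (𝓝 0) :=
      tendsto_inv_atTop_zero.comp (tendsto_natCast_atTop_atTop.comp hn.tendsto_atTop)
    simpa using h4.mul_const (2 * ‖φ‖)

section Torus

open MeasureTheory

/-- The projection of the plane onto the torus. -/
def torusProj : ℝ × ℝ → AddCircle (1 : ℝ) × AddCircle (1 : ℝ) :=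
  Prod.map (fun t : ℝ => (t : AddCircle (1 : ℝ))) (fun t : ℝ => (t : AddCircle (1 : ℝ)))

/-- The section of `torusProj` with values in the unit square. -/
def torusSection (t : AddCircle (1 : ℝ) × AddCircle (1 : ℝ)) : ℝ × ℝ :=
  (AddCircle.measurableEquivIco 1 0 t.1, AddCircle.measurableEquivIco 1 0 t.2)

theorem measurable_torusSection : Measurable torusSection := by
  have h := measurable_subtype_coe.comp (AddCircle.measurableEquivIco 1 0).measurable
  exact (h.comp measurable_fst).prodMk (h.comp measurable_snd)

theorem isOpenQuotientMap_torusProj : IsOpenQuotientMap torusProj :=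
  QuotientAddGroup.isOpenQuotientMap_mk.prodMap QuotientAddGroup.isOpenQuotientMap_mk

theorem torusProj_section (t : AddCircle (1 : ℝ) × AddCircle (1 : ℝ)) :
    torusProj (torusSection t) = t :=
  Prod.ext AddCircle.coe_equivIco AddCircle.coe_equivIco

theorem AddCircle.exists_eq_add_int {a b : ℝ} (h : (a : AddCircle (1 : ℝ)) = b) :
    ∃ n : ℤ, a = b + n := by
  rw [← sub_eq_zero, ← AddCircle.coe_sub, AddCircle.coe_eq_zero_iff] at h
  obtain ⟨n, hn⟩ := h
  refine ⟨n, ?_⟩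
  rw [zsmul_eq_mul, mul_one] at hn
  linarith

theorem exists_eq_add_of_torusProj_eq {x y : ℝ × ℝ} (h : torusProj x = torusProj y) :
    ∃ v : ℤ × ℤ, x = y + ((v.1 : ℝ), (v.2 : ℝ)) := by
  obtain ⟨a, ha⟩ := AddCircle.exists_eq_add_int (congrArg Prod.fst h)
  obtain ⟨b, hb⟩ := AddCircle.exists_eq_add_int (congrArg Prod.snd h)
  exact ⟨(a, b), Prod.ext ha hb⟩

theorem torusProj_add (x : ℝ × ℝ) (v : ℤ × ℤ) :
    torusProj (x + ((v.1 : ℝ), (v.2 : ℝ))) = torusProj x := by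
  have h : ∀ (a : ℝ) (n : ℤ), ((a + n : ℝ) : AddCircle (1 : ℝ)) = a := by
    intro a n
    rw [AddCircle.coe_add, (AddCircle.coe_eq_zero_iff (1 : ℝ) (x := (n : ℝ))).2 ⟨n, by simp⟩,
      add_zero]
  exact Prod.ext (h x.1 v.1) (h x.2 v.2)

theorem continuous_comp_torusSection {Y : Type} [TopologicalSpace Y] {H : ℝ × ℝ → Y}
    (hc : Continuous H) (hp : ∀ (x : ℝ × ℝ) (v : ℤ × ℤ), H (x + ((v.1 : ℝ), (v.2 : ℝ))) = H x) :
    Continuous (H ∘ torusSection) ∧ ∀ x, H (torusSection (torusProj x)) = H x := by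
  have h : ∀ x, H (torusSection (torusProj x)) = H x := by
    intro x
    obtain ⟨v, hv⟩ := exists_eq_add_of_torusProj_eq (torusProj_section (torusProj x))
    rw [hv, hp]
  refine ⟨?_, h⟩
  rw [isOpenQuotientMap_torusProj.isQuotientMap.continuous_iff]
  exact hc.congr fun x => (h x).symm

/-- A vector of the rotation set whose first coordinate is prescribed is the mean displacement of an
invariant probability measure, which is carried here by a fundamental domain. -/
theorem exists_measure_of_mem_rotSet (F : (ℝ × ℝ) ≃ₜ (ℝ × ℝ))
    (hF : ∀ (x : ℝ × ℝ) (v : ℤ × ℤ), F (x + ((v.1 : ℝ), (v.2 : ℝ))) = F x + ((v.1 : ℝ), (v.2 : ℝ)))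
    {w : ℝ × ℝ} (hw : w ∈ rotSet F) :
    ∃ (ν : Measure (ℝ × ℝ)) (f : ℝ × ℝ → ℝ × ℝ), IsProbabilityMeasure ν ∧
      MeasurePreserving f ν ν ∧ (∀ x, ∃ v : ℤ × ℤ, f x = F x + ((v.1 : ℝ), (v.2 : ℝ))) ∧
      ∫ x, (F x - x).2 ∂ν = w.2 := by
  obtain ⟨x, n, hn, hlim⟩ := hw
  obtain ⟨hfc, hfp⟩ := continuous_comp_torusSection (H := torusProj ∘ F)
    (isOpenQuotientMap_torusProj.continuous.comp F.continuous) (fun x v => by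
      rw [Function.comp_apply, hF, torusProj_add, Function.comp_apply])
  obtain ⟨hφc, hφp⟩ := continuous_comp_torusSection (H := fun x => (F x - x).2)
    ((F.continuous.sub continuous_id).snd) (fun x v => by rw [hF, add_sub_add_right_eq_sub])
  obtain ⟨μ, hμ, hinv, hμlim⟩ := exists_invariant_probability hfc (fun i => torusProj (x i)) hn
  have hs := measurable_torusSection
  have hπ := isOpenQuotientMap_torusProj.continuous.measurable
  have hit : ∀ (j : ℕ) (y : ℝ × ℝ),
      ((torusProj ∘ F) ∘ torusSection)^[j] (torusProj y) = torusProj (F^[j] y) := by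
    intro j y
    have : Function.Semiconj torusProj F ((torusProj ∘ F) ∘ torusSection) := fun y => (hfp y).symm
    exact ((this.iterate_right j) y).symm
  have hm : Measurable fun y => torusSection (torusProj (F y)) :=
    hs.comp (hπ.comp F.continuous.measurable)
  have hφ : Continuous fun x => (F x - x).2 := (F.continuous.sub continuous_id).snd
  refine ⟨μ.map torusSection, fun y => torusSection (torusProj (F y)),
    Measure.isProbabilityMeasure_map hs.aemeasurable, ⟨hm, ?_⟩,
    fun y => exists_eq_add_of_torusProj_eq (torusProj_section _), ?_⟩
  · rw [Measure.map_map hm hs]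
    nth_rewrite 2 [← hinv.map_eq]
    rw [Measure.map_map hs hfc.measurable]
    rfl
  · rw [integral_map hs.aemeasurable hφ.aestronglyMeasurable]
    refine hμlim _ hφc _ ?_
    refine ((continuous_snd.tendsto _).comp hlim).congr fun i => ?_
    simp only [Function.comp_apply, Prod.smul_snd, smul_eq_mul]
    congr 1
    have h1 : ∀ j, (F (torusSection (((torusProj ∘ F) ∘ torusSection)^[j] (torusProj (x i)))) -
        torusSection (((torusProj ∘ F) ∘ torusSection)^[j] (torusProj (x i)))).2 =
        (F^[j + 1] (x i)).2 - (F^[j] (x i)).2 := by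
      intro j
      rw [hit, hφp, Function.iterate_succ_apply', Prod.snd_sub]
    simp only [h1]
    rw [Finset.sum_range_sub fun j => (F^[j] (x i)).2]
    rfl

end Torus

theorem norm_iterate_sub_le {V : Type*} [SeminormedAddCommGroup V] {G : V → V} {B : ℝ}
    (hB : ∀ x, ‖G x - x‖ ≤ B) (a : ℕ) (x : V) : ‖G^[a] x - x‖ ≤ a * B := by
  induction a with
  | zero => simp
  | succ a ih =>
    rw [Function.iterate_succ_apply', ← sub_add_sub_cancel _ (G^[a] x)]
    refine (norm_add_le _ _).trans ((add_le_add (hB _) ih).trans (le_of_eq ?_))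
    push_cast
    ring

theorem iterate_add_int {G : ℝ × ℝ → ℝ × ℝ}
    (hG : ∀ (x : ℝ × ℝ) (v : ℤ × ℤ), G (x + ((v.1 : ℝ), (v.2 : ℝ))) = G x + ((v.1 : ℝ), (v.2 : ℝ)))
    (j : ℕ) (x : ℝ × ℝ) (v : ℤ × ℤ) :
    G^[j] (x + ((v.1 : ℝ), (v.2 : ℝ))) = G^[j] x + ((v.1 : ℝ), (v.2 : ℝ)) :=
  (Function.Semiconj.iterate_right (f := fun x => x + ((v.1 : ℝ), (v.2 : ℝ)))
    (fun x => (hG x v).symm) j x).symm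

theorem exists_iterate_eq_add {G g : ℝ × ℝ → ℝ × ℝ}
    (hG : ∀ (x : ℝ × ℝ) (v : ℤ × ℤ), G (x + ((v.1 : ℝ), (v.2 : ℝ))) = G x + ((v.1 : ℝ), (v.2 : ℝ)))
    (hg : ∀ x, ∃ v : ℤ × ℤ, g x = G x + ((v.1 : ℝ), (v.2 : ℝ))) (j : ℕ) (x : ℝ × ℝ) :
    ∃ v : ℤ × ℤ, g^[j] x = G^[j] x + ((v.1 : ℝ), (v.2 : ℝ)) := by
  induction j with
  | zero => exact ⟨0, by simp⟩
  | succ j ih =>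
    obtain ⟨v, hv⟩ := ih
    obtain ⟨w, hw⟩ := hg (g^[j] x)
    refine ⟨v + w, ?_⟩
    rw [Function.iterate_succ_apply', Function.iterate_succ_apply', hw, hv, hG, add_assoc]
    congr 1
    ext <;> simp

section Selection

open MeasureTheory

theorem exists_pos_of_integral {X : Type*} [MeasurableSpace X] {ν : Measure X}
    [IsProbabilityMeasure ν] {h : X → ℝ} (hi : Integrable h ν) {B : ℝ} (hB : ∀ x, h x ≤ B)
    {N : Set X} (hN : MeasurableSet N) (hlt : B * ν.real N < ∫ x, h x ∂ν) :
    ∃ x, x ∉ N ∧ 0 < h x := by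
  by_contra hcon
  push Not at hcon
  refine absurd hlt (not_lt.2 ?_)
  have h1 : ∫ x, h x ∂ν ≤ ∫ x, N.indicator (fun _ => B) x ∂ν := by
    refine integral_mono hi ((integrable_const B).indicator hN) fun x => ?_
    by_cases hx : x ∈ N
    · rw [indicator_of_mem hx]
      exact hB x
    · rw [indicator_of_notMem hx]
      exact hcon x hx
  rw [integral_indicator_const _ hN, smul_eq_mul, mul_comm] at h1
  exact h1

variable {G : ℝ × ℝ → ℝ × ℝ} (hGc : Continuous G)
  (hG : ∀ (x : ℝ × ℝ) (v : ℤ × ℤ), G (x + ((v.1 : ℝ), (v.2 : ℝ))) = G x + ((v.1 : ℝ), (v.2 : ℝ)))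
  {ν : Measure (ℝ × ℝ)} [IsProbabilityMeasure ν] {g : ℝ × ℝ → ℝ × ℝ}
  (hν : MeasurePreserving g ν ν) (hg : ∀ x, ∃ v : ℤ × ℤ, g x = G x + ((v.1 : ℝ), (v.2 : ℝ)))
  {ρ : ℝ} (hρ : ∫ x, (G x - x).2 ∂ν = ρ)

include hGc hG

theorem integrable_iterate_sub (j : ℕ) : Integrable (fun x => (G^[j] x - x).2) ν := by
  have hc : Continuous fun x => G^[j] x - x := (hGc.iterate j).sub continuous_id
  obtain ⟨B, hB⟩ := exists_norm_le_of_periodic hc (fun x v => by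
    rw [iterate_add_int hG, add_sub_add_right_eq_sub])
  exact Integrable.of_bound hc.snd.aestronglyMeasurable B
    (Eventually.of_forall fun x => (norm_snd_le _).trans (hB x))

include hν hg hρ

theorem integral_iterate_sub (j : ℕ) : ∫ x, (G^[j] x - x).2 ∂ν = j * ρ := by
  induction j with
  | zero => simp
  | succ j ih =>
    have hφ : Continuous fun x => (G x - x).2 := (hGc.sub continuous_id).snd
    have h1 : ∀ x, (G^[j + 1] x - x).2 = (G (g^[j] x) - g^[j] x).2 + (G^[j] x - x).2 := by
      intro x
      obtain ⟨v, hv⟩ := exists_iterate_eq_add hG hg j x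
      rw [hv, hG, add_sub_add_right_eq_sub, Function.iterate_succ_apply', ← Prod.snd_add,
        sub_add_sub_cancel]
    have hj := hν.iterate j
    have h2 : ∫ x, (G (g^[j] x) - g^[j] x).2 ∂ν = ρ := by
      rw [← integral_map (f := fun x => (G x - x).2) hj.measurable.aemeasurable
        hφ.aestronglyMeasurable, hj.map_eq, hρ]
    have h3 : Integrable (fun x => (G (g^[j] x) - g^[j] x).2) ν :=
      hj.integrable_comp_of_integrable (g := fun x => (G x - x).2)
        (integrable_iterate_sub hGc hG 1)
    simp only [h1]
    rw [integral_add h3 (integrable_iterate_sub hGc hG j), h2, ih]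
    push_cast
    ring

/-- There are points whose displacement is almost the mean displacement in a given direction, and
some segments of whose orbits stay in a large set. -/
theorem exists_orbit_of_integral {W : ℕ → Set (ℝ × ℝ)} (hW : ∀ E, MeasurableSet (W E))
    (hmono : Monotone W) (hex : ∀ x, ∃ E, x ∈ W E)
    (hper : ∀ E x, ∀ v : ℤ × ℤ, x ∈ W E → x + ((v.1 : ℝ), (v.2 : ℝ)) ∈ W E) (A : ℕ)
    {s : ℝ} (hs : |s| = 1) : ∃ E₀, ∀ E ≥ E₀, ∀ k : ℕ, 0 < k → ∃ x,
      (∀ a ≤ A, G^[a] x ∈ W E ∧ G^[k + a] x ∈ W E) ∧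
      k * (s * ρ - 1) ≤ s * (G^[k] x - x).2 := by
  obtain ⟨B, hB⟩ := exists_norm_le_of_periodic (hGc.sub continuous_id) (fun x v => by
    rw [Pi.sub_apply, Pi.sub_apply, hG, id, id, add_sub_add_right_eq_sub])
  have hB0 : 0 ≤ B := (norm_nonneg _).trans (hB 0)
  set D := B + |ρ| + 1 with hD
  have hD0 : 0 < D := by positivity
  have hlim : Tendsto (fun E => ν.real (W E)ᶜ) atTop (𝓝 0) := by
    have h1 := tendsto_measure_iInter_atTop (μ := ν) (s := fun E => (W E)ᶜ)
      (fun E => (hW E).compl.nullMeasurableSet) (fun E E' h => compl_subset_compl.2 (hmono h))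
      ⟨0, measure_ne_top _ _⟩
    have h2 : ⋂ E, (W E)ᶜ = ∅ := by
      rw [← compl_iUnion, compl_empty_iff]
      exact eq_univ_of_forall fun x => mem_iUnion.2 (hex x)
    rw [h2, measure_empty] at h1
    exact (ENNReal.tendsto_toReal ENNReal.zero_ne_top).comp h1
  obtain ⟨E₀, hE₀⟩ := eventually_atTop.1
    (hlim.eventually_lt_const (u := 1 / (2 * (A + 1) * D)) (by positivity))
  refine ⟨E₀, fun E hE k hk => ?_⟩
  have hsmall := hE₀ E hE
  rw [lt_div_iff₀ (by positivity)] at hsmall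
  have hk' : (0 : ℝ) < k := Nat.cast_pos.2 hk
  set N : Set (ℝ × ℝ) := ⋃ a ∈ Finset.range (A + 1),
    (g^[a] ⁻¹' (W E)ᶜ ∪ g^[k + a] ⁻¹' (W E)ᶜ) with hNdef
  have hpre : ∀ j, MeasurableSet (g^[j] ⁻¹' (W E)ᶜ) := fun j =>
    (hν.iterate j).measurable (hW E).compl
  have hN : MeasurableSet N :=
    Finset.measurableSet_biUnion _ fun a _ => (hpre a).union (hpre (k + a))
  have hνN : ν.real N ≤ 2 * (A + 1) * ν.real (W E)ᶜ := by
    refine (measureReal_biUnion_finset_le _ _).trans ?_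
    refine (Finset.sum_le_card_nsmul _ _ (2 * ν.real (W E)ᶜ) fun a _ => ?_).trans
      (le_of_eq ?_)
    · refine (measureReal_union_le _ _).trans (le_of_eq ?_)
      have h1 : ∀ j, ν.real (g^[j] ⁻¹' (W E)ᶜ) = ν.real (W E)ᶜ := fun j =>
        (hν.iterate j).measureReal_preimage (hW E).compl.nullMeasurableSet
      rw [h1, h1]
      ring
    · rw [Finset.card_range, nsmul_eq_mul]
      push_cast
      ring
  have hi := integrable_iterate_sub hGc hG (ν := ν) k
  obtain ⟨x, hxN, hx⟩ := exists_pos_of_integral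
    (h := fun x => s * (G^[k] x - x).2 - k * (s * ρ - 1)) (B := k * D)
    ((hi.const_mul s).sub (integrable_const _)) (fun x => by
      have h1 : |(G^[k] x - x).2| ≤ k * B := (norm_snd_le _).trans (norm_iterate_sub_le hB k x)
      have h2 : s * (G^[k] x - x).2 ≤ k * B :=
        (le_abs_self _).trans (by rwa [abs_mul, hs, one_mul])
      have h3 : -(s * ρ) ≤ |ρ| := (neg_le_abs _).trans (by rw [abs_mul, hs, one_mul])
      rw [hD]
      nlinarith) hN (by
      rw [integral_sub (hi.const_mul s) (integrable_const _), integral_const_mul,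
        integral_iterate_sub hGc hG hν hg hρ]
      simp only [integral_const, probReal_univ, smul_eq_mul, one_mul]
      have h4 : D * ν.real N < 1 :=
        (mul_le_mul_of_nonneg_left hνN hD0.le).trans_lt (by linarith)
      have h5 := mul_lt_mul_of_pos_left h4 hk'
      linarith)
  refine ⟨x, fun a ha => ?_, by linarith⟩
  have hmem : ∀ j, x ∉ g^[j] ⁻¹' (W E)ᶜ → G^[j] x ∈ W E := by
    intro j hj
    rw [mem_preimage, notMem_compl_iff] at hj
    obtain ⟨v, hv⟩ := exists_iterate_eq_add hG hg j x
    have := hper E _ (-v) hj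
    rw [hv] at this
    convert! this using 1
    ext <;> simp
  have hx' : x ∉ g^[a] ⁻¹' (W E)ᶜ ∪ g^[k + a] ⁻¹' (W E)ᶜ := fun h =>
    hxN (mem_biUnion (Finset.mem_coe.2 (Finset.mem_range.2 (Nat.lt_succ_of_le ha))) h)
  rw [mem_union, not_or] at hx'
  exact ⟨hmem a hx'.1, hmem (k + a) hx'.2⟩

end Selection

theorem Homeomorph.exists_iterate {X : Type*} [TopologicalSpace X] (F : X ≃ₜ X) (n : ℕ) :
    ∃ G : X ≃ₜ X, ⇑G = F^[n] := by
  induction n with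
  | zero => exact ⟨Homeomorph.refl X, rfl⟩
  | succ n ih =>
    obtain ⟨G, hG⟩ := ih
    exact ⟨F.trans G, by rw [Function.iterate_succ, ← hG]; rfl⟩

/-- If `f` is a torus homeomorphism homotopic to the identity (encoded by its lift
`F`, a homeomorphism of the plane commuting with integer translations) whose
rotation set is ρ(F) = {α} × [ρ⁻, ρ⁺] with ρ⁻ < ρ⁺ and α irrational, then `f`
has unbounded horizontal deviation:
sup_{x ∈ ℝ², n ∈ ℕ} |pr₁(Fⁿ(x) − x) − nα| = +∞. -/
theorem vertical_rotation_set_irrational_abscissa_unbounded_horizontal_deviation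
    (F : R2 ≃ₜ R2)
    (hF : ∀ (x : R2) (v : ℤ × ℤ), F (x + ((v.1 : ℝ), (v.2 : ℝ))) = F x + ((v.1 : ℝ), (v.2 : ℝ)))
    (α ρm ρp : ℝ) (hα : Irrational α) (hρ : ρm < ρp)
    (hrot : rotSet ⇑F = {α} ×ˢ Icc ρm ρp) :
    ∀ M : ℝ, ∃ (x : R2) (n : ℕ), M < |((⇑F)^[n] x - x).1 - (n : ℝ) * α| := by
  by_contra hcon
  push Not at hcon
  obtain ⟨M, hM⟩ := hcon
  obtain ⟨n, hn⟩ := exists_nat_gt (16 / (ρp - ρm))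
  have hΔ : 0 < ρp - ρm := sub_pos.2 hρ
  rw [div_lt_iff₀ hΔ] at hn
  have hn0 : n ≠ 0 := by
    rintro rfl
    norm_num at hn
  obtain ⟨G, hGF⟩ := F.exists_iterate n
  have hG : ∀ (x : ℝ × ℝ) (v : ℤ × ℤ),
      G (x + ((v.1 : ℝ), (v.2 : ℝ))) = G x + ((v.1 : ℝ), (v.2 : ℝ)) := by
    rw [hGF]
    exact iterate_add_int hF n
  have hβ : Irrational (n * α) := hα.natCast_mul hn0
  obtain ⟨L, C, ℓ, W, hL, hW, hmono, hex, hper, hℓG, hℓv, hest⟩ :=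
    exists_level_estimate G hG (M := M) hβ fun x j => by
      rw [hGF, ← Function.iterate_mul]
      have := hM x (n * j)
      push_cast at this
      rwa [← mul_assoc, mul_comm (j : ℝ)]
  have hL' : (0 : ℝ) < 1 / L := one_div_pos.2 (Nat.cast_pos.2 hL)
  obtain ⟨A, hA⟩ := hβ.exists_abs_add_lt hL'
  obtain ⟨B, hB⟩ := exists_norm_le_of_periodic (G.continuous.sub continuous_id) (sub_periodic G hG)
  have hB0 : 0 ≤ B := (norm_nonneg _).trans (hB 0)
  have key : ∀ ρ ∈ Icc ρm ρp, ∀ s : ℝ, |s| = 1 → ∃ E₀, ∀ E ≥ E₀, ∀ k : ℕ, 0 < k → ∃ x,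
      (∀ a ≤ A, G^[a] x ∈ W E ∧ G^[k + a] x ∈ W E) ∧
      k * (s * (n * ρ) - 1) ≤ s * (G^[k] x - x).2 := by
    intro ρ hρ s hs
    have hmem : (α, ρ) ∈ rotSet F := by
      rw [hrot]
      exact ⟨rfl, hρ⟩
    obtain ⟨ν, f, hν, hf, hfF, hInt⟩ := exists_measure_of_mem_rotSet F hF hmem
    refine exists_orbit_of_integral (ν := ν) (g := f^[n]) G.continuous hG (hf.iterate n)
      (fun x => ?_) ?_ hW hmono hex hper A hs
    · rw [hGF]
      exact exists_iterate_eq_add hF hfF n x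
    · simp only [hGF]
      exact integral_iterate_sub F.continuous hF hf hfF hInt n
  obtain ⟨E₁, h1⟩ := key ρm (left_mem_Icc.2 hρ.le) (-1) (by norm_num)
  obtain ⟨E₂, h2⟩ := key ρp (right_mem_Icc.2 hρ.le) 1 (by norm_num)
  set E := max E₁ E₂
  obtain ⟨k, hk⟩ := exists_nat_gt (max 0 (14 * E + C + 2 * A * B))
  rw [max_lt_iff] at hk
  obtain ⟨x₁, hx₁, hV₁⟩ := h1 E (le_max_left _ _) k (Nat.cast_pos.1 hk.1)
  obtain ⟨x₂, hx₂, hV₂⟩ := h2 E (le_max_right _ _) k (Nat.cast_pos.1 hk.1)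
  obtain ⟨a, ha, b, hab⟩ := hA (ℓ x₂ - ℓ x₁)
  have hℓa : ∀ j : ℕ, ℓ (G^[j] x₂) = ℓ x₂ + j * (n * α) := by
    intro j
    induction j with
    | zero => simp
    | succ j ih =>
      rw [Function.iterate_succ_apply', hℓG, ih]
      push_cast
      ring
  have hGk := iterate_add_int hG k (G^[a] x₂) (b, 0)
  rw [← Function.iterate_add_apply] at hGk
  have h3 := hest E k x₁ (G^[a] x₂ + (((b : ℤ) : ℝ), ((0 : ℤ) : ℝ))) (by
      rw [Int.cast_zero, hℓv, hℓa, abs_sub_comm]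
      convert! hab using 2
      ring) (hx₁ 0 (Nat.zero_le _)).1 (hper E _ (b, 0) (hx₂ a ha).1)
    (hx₁ 0 (Nat.zero_le _)).2 (by
      rw [hGk]
      exact hper E _ (b, 0) (hx₂ a ha).2)
  rw [hGk, add_sub_add_right_eq_sub, add_comm k a, Function.iterate_add_apply] at h3
  have h4 := abs_le.1 ((norm_snd_le _).trans (norm_iterate_sub_le hB a x₂))
  have h5 := abs_le.1 ((norm_snd_le _).trans (norm_iterate_sub_le hB a (G^[k] x₂)))
  have h6 := (abs_le.1 h3).2
  simp only [Prod.snd_sub] at h4 h5 h6 hV₁ hV₂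
  have h7 : (a : ℝ) * B ≤ A * B := mul_le_mul_of_nonneg_right (Nat.cast_le.2 ha) hB0
  have h8 : (16 : ℝ) * k ≤ n * (ρp - ρm) * k := mul_le_mul_of_nonneg_right hn.le hk.1.le
  linarith [hk.2]
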